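/- arXiv:2009.01802 — 13 statements merged into one kernel-verified Lean document; each statement's English description precedes it below -/
import Mathlib

section
/- Let G = (V,E) be a finite unweighted undirected graph in which every vertex has degree at least 1, let φ ∈ (0,1], and suppose G is a φ-expander. Fix any orientation of the edges and let A ∈ {−1,0,1}^{E×V} be the resulting incidence matrix, D ∈ ℝ^{V×V} the diagonal degree matrix, and L = AᵀA the Laplacian matrix of G. Then for every y ∈ ℝ^V with y ⊥ D·𝟙 (that is, Σ_{v∈V} deg(v)·y_v = 0), one has yᵀLy ≥ (1/2)·φ²·yᵀDy. -/
open Matrix Finset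

/-- Discrete coarea inequality: an isoperimetric inequality for all nonempty subsets of `S`
extends to nonnegative functions supported in `S`. -/
theorem sum_mul_le_sum_posPart_sub_of_isoperimetric {V : Type*} [Fintype V] [DecidableEq V]
    (w : V → V → ℝ) (d : V → ℝ) (S : Finset V)
    (hS : ∀ T ⊆ S, T.Nonempty → ∑ v ∈ T, d v ≤ ∑ u ∈ T, ∑ v ∈ Tᶜ, w u v)
    (g : V → ℝ) (hg : ∀ v, 0 ≤ g v) (hgS : ∀ v ∉ S, g v = 0) :
    ∑ v, d v * g v ≤ ∑ u, ∑ v, w u v * max (g u - g v) 0 := by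
  induction S using Finset.strongInduction generalizing g with
  | H S ih =>
  rcases S.eq_empty_or_nonempty with rfl | hne
  · have h0 : ∀ v, g v = 0 := fun v => hgS v (by simp)
    simp [h0]
  obtain ⟨x, hxS, hx⟩ := S.exists_min_image g hne
  have key := ih (S.erase x) (erase_ssubset hxS)
    (fun T hT => hS T (hT.trans (erase_subset _ _)))
    (fun v => if v ∈ S then g v - g x else 0)
    (fun v => by
      split_ifs with h
      · linarith [hx v h]
      · rfl)
    (fun v hv => by
      split_ifs with h
      · have : v = x := by
          by_contra hne
          exact hv (mem_erase.2 ⟨hne, h⟩)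
        simp [this]
      · rfl)
  have hl : ∑ v, d v * g v
      = ∑ v, d v * (if v ∈ S then g v - g x else 0) + g x * ∑ v ∈ S, d v := by
    rw [mul_sum, ← sum_filter_add_sum_filter_not univ (· ∈ S) (fun v => d v * g v),
      ← sum_filter_add_sum_filter_not univ (· ∈ S)
        (fun v => d v * (if v ∈ S then g v - g x else 0))]
    have h1 : ∑ v with v ∉ S, d v * g v = 0 :=
      sum_eq_zero fun v hv => by rw [hgS v (mem_filter.1 hv).2, mul_zero]
    have h2 : ∑ v with v ∉ S, d v * (if v ∈ S then g v - g x else 0) = 0 :=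
      sum_eq_zero fun v hv => by rw [if_neg (mem_filter.1 hv).2, mul_zero]
    rw [h1, h2, filter_mem_eq_inter, univ_inter, add_zero, add_zero, ← sum_add_distrib]
    refine sum_congr rfl fun v hv => ?_
    rw [if_pos hv]
    ring
  have hr : ∑ u, ∑ v, w u v * max (g u - g v) 0
      = ∑ u, ∑ v, w u v * max ((if u ∈ S then g u - g x else 0)
          - (if v ∈ S then g v - g x else 0)) 0
        + g x * ∑ u ∈ S, ∑ v ∈ Sᶜ, w u v := by
    have hcut : ∑ u ∈ S, ∑ v ∈ Sᶜ, w u v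
        = ∑ u, ∑ v, if u ∈ S ∧ v ∉ S then w u v else 0 := by
      rw [← sum_filter_add_sum_filter_not univ (· ∈ S)
        (fun u => ∑ v, if u ∈ S ∧ v ∉ S then w u v else 0)]
      have h2 : ∑ u with u ∉ S, ∑ v, (if u ∈ S ∧ v ∉ S then w u v else 0) = 0 :=
        sum_eq_zero fun u hu => by simp [(mem_filter.1 hu).2]
      rw [h2, add_zero, filter_mem_eq_inter, univ_inter]
      refine sum_congr rfl fun u hu => ?_
      rw [← sum_filter]
      refine sum_congr ?_ fun _ _ => rfl
      ext v
      simp [hu]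
    rw [hcut, mul_sum, ← sum_add_distrib]
    refine sum_congr rfl fun u _ => ?_
    rw [mul_sum, ← sum_add_distrib]
    refine sum_congr rfl fun v _ => ?_
    by_cases hu : u ∈ S <;> by_cases hv : v ∈ S <;> simp only [hu, hv, if_true, if_false,
      not_true, not_false_eq_true, and_true, and_false, mul_zero, add_zero]
    · congr 2
      ring
    · rw [hgS v hv, max_eq_left (by linarith [hg u]), max_eq_left (by linarith [hx u hu])]
      ring
    · rw [hgS u hu, max_eq_right (by linarith [hg v]), max_eq_right (by linarith [hx v hv])]
    · rw [hgS u hu, hgS v hv]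
  rw [hl, hr]
  exact add_le_add key (mul_le_mul_of_nonneg_left (hS S subset_rfl hne) (hg x))

/-- Every function on a finite nonempty type has a weighted median. -/
theorem exists_weighted_median {V : Type*} [Fintype V] [Nonempty V] (d : V → ℝ)
    (hd : ∀ v, 0 ≤ d v) (y : V → ℝ) :
    ∃ c : ℝ, 2 * ∑ v with c < y v, d v ≤ ∑ v, d v ∧ 2 * ∑ v with y v < c, d v ≤ ∑ v, d v := by
  classical
  let C : Finset V := {x | 2 * ∑ v with y x < y v, d v ≤ ∑ v, d v}
  have hC : C.Nonempty := by
    obtain ⟨x, -, hx⟩ := univ.exists_max_image y univ_nonempty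
    refine ⟨x, mem_filter.2 ⟨mem_univ _, ?_⟩⟩
    rw [filter_false_of_mem fun v hv => not_lt.2 (hx v hv)]
    simpa using sum_nonneg fun v _ => hd v
  obtain ⟨x, hxC, hx⟩ := C.exists_min_image y hC
  refine ⟨y x, (mem_filter.1 hxC).2, ?_⟩
  rcases (univ.filter fun v => y v < y x).eq_empty_or_nonempty with h | h
  · rw [h]
    simpa using sum_nonneg fun v _ => hd v
  obtain ⟨z, hz, hzmax⟩ := exists_max_image _ y h
  have hzx : y z < y x := (mem_filter.1 hz).2
  have hzC : z ∉ C := fun hzC => (hx z hzC).not_gt hzx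
  have hlt : ∑ v, d v < 2 * ∑ v with y z < y v, d v := by
    by_contra hcon
    exact hzC (mem_filter.2 ⟨mem_univ _, not_lt.1 hcon⟩)
  have hsplit := sum_filter_add_sum_filter_not univ (fun v => y z < y v) d
  have hset : (univ.filter fun v => ¬ y z < y v) = univ.filter fun v => y v < y x := by
    ext v
    simp only [mem_filter, mem_univ, true_and, not_lt]
    exact ⟨fun hv => hv.trans_lt hzx, fun hv => hzmax v (by simpa using hv)⟩
  rw [hset] at hsplit
  linarith

/-- Cheeger's inequality with Dirichlet boundary conditions: the Rayleigh quotient of a function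
supported in `S` is bounded below in terms of the isoperimetry of subsets of `S`. -/
theorem sq_mul_sum_le_energy_of_isoperimetric {V : Type*} [Fintype V] [DecidableEq V]
    (w : V → V → ℝ) (hw : ∀ u v, 0 ≤ w u v) (hsymm : ∀ u v, w u v = w v u)
    (φ : ℝ) (hφ : 0 ≤ φ) (S : Finset V)
    (hS : ∀ T ⊆ S, T.Nonempty → φ * ∑ v ∈ T, ∑ u, w v u ≤ ∑ u ∈ T, ∑ v ∈ Tᶜ, w u v)
    (f : V → ℝ) (hfS : ∀ v ∉ S, f v = 0) :
    φ ^ 2 * ∑ v, (∑ u, w v u) * f v ^ 2 ≤ ∑ u, ∑ v, w u v * (f u - f v) ^ 2 := by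
  set X := ∑ v, (∑ u, w v u) * f v ^ 2 with hX
  set Q := ∑ u, ∑ v, w u v * (f u - f v) ^ 2 with hQ
  set P := ∑ u, ∑ v, w u v * max (f u ^ 2 - f v ^ 2) 0 with hP
  have hX0 : 0 ≤ X :=
    sum_nonneg fun v _ => mul_nonneg (sum_nonneg fun u _ => hw v u) (sq_nonneg _)
  have hQ0 : 0 ≤ Q :=
    sum_nonneg fun u _ => sum_nonneg fun v _ => mul_nonneg (hw u v) (sq_nonneg _)
  have hcoarea : φ * X ≤ P := by
    have := sum_mul_le_sum_posPart_sub_of_isoperimetric w (fun v => φ * ∑ u, w v u) S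
      (fun T hT hne => by simpa only [← mul_sum] using hS T hT hne)
      (fun v => f v ^ 2) (fun v => sq_nonneg _) (fun v hv => by simp [hfS v hv])
    simpa only [mul_assoc, ← mul_sum] using this
  have hX1 : ∑ u, ∑ v, w u v * f u ^ 2 = X := by
    simp only [hX, sum_mul]
  have hX2 : ∑ u, ∑ v, w u v * f v ^ 2 = X := by
    rw [sum_comm, ← hX1]
    exact sum_congr rfl fun u _ => sum_congr rfl fun v _ => by rw [hsymm]
  have hsum : ∑ u, ∑ v, w u v * (f u + f v) ^ 2 ≤ 4 * X := by
    have h4 : 4 * X = ∑ u, ∑ v, w u v * (2 * f u ^ 2 + 2 * f v ^ 2) := by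
      have : 4 * X = 2 * ∑ u, ∑ v, w u v * f u ^ 2 + 2 * ∑ u, ∑ v, w u v * f v ^ 2 := by
        rw [hX1, hX2]
        ring
      rw [this]
      simp only [mul_sum, ← sum_add_distrib]
      exact sum_congr rfl fun u _ => sum_congr rfl fun v _ => by ring
    rw [h4]
    exact sum_le_sum fun u _ => sum_le_sum fun v _ =>
      mul_le_mul_of_nonneg_left (by nlinarith [sq_nonneg (f u - f v)]) (hw u v)
  have hPabs : 2 * P = ∑ u, ∑ v, w u v * |f u ^ 2 - f v ^ 2| := by
    have hswap : P = ∑ u, ∑ v, w u v * max (f v ^ 2 - f u ^ 2) 0 := by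
      rw [hP, sum_comm]
      exact sum_congr rfl fun u _ => sum_congr rfl fun v _ => by rw [hsymm]
    rw [two_mul]
    nth_rewrite 2 [hswap]
    rw [hP, ← sum_add_distrib]
    refine sum_congr rfl fun u _ => ?_
    rw [← sum_add_distrib]
    refine sum_congr rfl fun v _ => ?_
    rw [← mul_add]
    congr 1
    rcases le_total (f v ^ 2) (f u ^ 2) with h | h
    · rw [max_eq_left (by linarith), max_eq_right (by linarith), abs_of_nonneg (by linarith),
        add_zero]
    · rw [max_eq_right (by linarith), max_eq_left (by linarith), abs_of_nonpos (by linarith)]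
      ring
  have hCS : (2 * P) ^ 2 ≤ Q * ∑ u, ∑ v, w u v * (f u + f v) ^ 2 := by
    rw [hPabs, hQ]
    simp only [← Fintype.sum_prod_type']
    refine sum_sq_le_sum_mul_sum_of_sq_le_mul _ (fun p _ => mul_nonneg (hw _ _) (sq_nonneg _))
      (fun p _ => mul_nonneg (hw _ _) (sq_nonneg _)) fun p _ => ?_
    rw [mul_pow, sq_abs]
    exact le_of_eq (by ring)
  have hmain : φ ^ 2 * X * X ≤ Q * X := by
    have h1 : (φ * X) ^ 2 ≤ P ^ 2 := pow_le_pow_left₀ (mul_nonneg hφ hX0) hcoarea 2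
    nlinarith [mul_le_mul_of_nonneg_left hsum hQ0]
  rcases hX0.eq_or_lt with h | h
  · rw [← h, mul_zero]
    exact hQ0
  · exact le_of_mul_le_mul_right hmain h

/-- Cheeger's inequality for a finite symmetric weighted graph. -/
theorem sq_mul_sum_le_energy_of_expander {V : Type*} [Fintype V] [DecidableEq V]
    (w : V → V → ℝ) (hw : ∀ u v, 0 ≤ w u v) (hsymm : ∀ u v, w u v = w v u)
    (φ : ℝ) (hφ : 0 ≤ φ)
    (hS : ∀ T : Finset V, T.Nonempty → 2 * ∑ v ∈ T, ∑ u, w v u ≤ ∑ v, ∑ u, w v u →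
      φ * ∑ v ∈ T, ∑ u, w v u ≤ ∑ u ∈ T, ∑ v ∈ Tᶜ, w u v)
    (y : V → ℝ) (hy : ∑ v, (∑ u, w v u) * y v = 0) :
    φ ^ 2 * ∑ v, (∑ u, w v u) * y v ^ 2 ≤ ∑ u, ∑ v, w u v * (y u - y v) ^ 2 := by
  rcases isEmpty_or_nonempty V with hV | hV
  · simp
  have hd : ∀ v, 0 ≤ ∑ u, w v u := fun v => sum_nonneg fun u _ => hw v u
  obtain ⟨c, hc1, hc2⟩ := exists_weighted_median (fun v => ∑ u, w v u) hd y
  have hsub : ∀ S : Finset V, 2 * ∑ v ∈ S, ∑ u, w v u ≤ ∑ v, ∑ u, w v u →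
      ∀ T ⊆ S, T.Nonempty → φ * ∑ v ∈ T, ∑ u, w v u ≤ ∑ u ∈ T, ∑ v ∈ Tᶜ, w u v := by
    intro S h T hT hne
    have := sum_le_sum_of_subset_of_nonneg hT (f := fun v => ∑ u, w v u) fun v _ _ => hd v
    exact hS T hne (by linarith)
  have hpos := sq_mul_sum_le_energy_of_isoperimetric w hw hsymm φ hφ _ (hsub _ hc1)
    (fun v => max (y v - c) 0) (fun v hv => max_eq_right (by simpa using hv))
  have hneg := sq_mul_sum_le_energy_of_isoperimetric w hw hsymm φ hφ _ (hsub _ hc2)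
    (fun v => max (c - y v) 0) (fun v hv => max_eq_right (by simpa using hv))
  have hmass : ∑ v, (∑ u, w v u) * y v ^ 2 ≤
      ∑ v, (∑ u, w v u) * max (y v - c) 0 ^ 2 + ∑ v, (∑ u, w v u) * max (c - y v) 0 ^ 2 := by
    have hsq : ∀ v, max (y v - c) 0 ^ 2 + max (c - y v) 0 ^ 2 = y v ^ 2 - 2 * c * y v + c ^ 2 := by
      intro v
      rcases le_total c (y v) with h | h
      · rw [max_eq_left (by linarith), max_eq_right (by linarith)]
        ring
      · rw [max_eq_right (by linarith), max_eq_left (by linarith)]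
        ring
    have : ∑ v, (∑ u, w v u) * (max (y v - c) 0 ^ 2 + max (c - y v) 0 ^ 2)
        = ∑ v, (∑ u, w v u) * y v ^ 2 - 2 * c * ∑ v, (∑ u, w v u) * y v
          + c ^ 2 * ∑ v, ∑ u, w v u := by
      rw [mul_sum, mul_sum, ← sum_sub_distrib, ← sum_add_distrib]
      exact sum_congr rfl fun v _ => by rw [hsq]; ring
    rw [← sum_add_distrib]
    simp only [← mul_add]
    rw [this, hy]
    nlinarith [mul_nonneg (sq_nonneg c) (sum_nonneg fun v (_ : v ∈ univ) => hd v)]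
  have henergy : ∑ u, ∑ v, w u v * (max (y u - c) 0 - max (y v - c) 0) ^ 2
      + ∑ u, ∑ v, w u v * (max (c - y u) 0 - max (c - y v) 0) ^ 2
      ≤ ∑ u, ∑ v, w u v * (y u - y v) ^ 2 := by
    rw [← sum_add_distrib]
    refine sum_le_sum fun u _ => ?_
    rw [← sum_add_distrib]
    refine sum_le_sum fun v _ => ?_
    rw [← mul_add]
    refine mul_le_mul_of_nonneg_left ?_ (hw u v)
    rcases le_total c (y u) with h | h <;> rcases le_total c (y v) with h' | h'
    · rw [max_eq_left (by linarith), max_eq_left (by linarith), max_eq_right (by linarith),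
        max_eq_right (by linarith)]
      nlinarith
    · rw [max_eq_left (by linarith), max_eq_right (by linarith), max_eq_right (by linarith),
        max_eq_left (by linarith)]
      nlinarith [mul_nonneg (sub_nonneg.2 h) (sub_nonneg.2 h')]
    · rw [max_eq_right (by linarith), max_eq_left (by linarith), max_eq_left (by linarith),
        max_eq_right (by linarith)]
      nlinarith [mul_nonneg (sub_nonneg.2 h) (sub_nonneg.2 h')]
    · rw [max_eq_right (by linarith), max_eq_right (by linarith), max_eq_left (by linarith),
        max_eq_left (by linarith)]
      nlinarith
  have := mul_le_mul_of_nonneg_left hmass (sq_nonneg φ)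
  linarith

/-- The quadratic form of `AᵀA`, for an oriented incidence matrix `A`, as a sum over ordered pairs
of adjacent vertices. -/
theorem two_mul_dotProduct_transpose_mul_incidence {V : Type*} [Fintype V] [DecidableEq V]
    (G : SimpleGraph V) [DecidableRel G.Adj] (A : Matrix G.edgeSet V ℝ)
    (hA : ∀ e : G.edgeSet, ∃ u v : V, (e : Sym2 V) = s(u, v) ∧
      A e u = -1 ∧ A e v = 1 ∧ ∀ w : V, w ≠ u → w ≠ v → A e w = 0)
    (y : V → ℝ) :
    2 * (y ⬝ᵥ ((Aᵀ * A) *ᵥ y)) =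
      ∑ u, ∑ v, (if G.Adj u v then (1 : ℝ) else 0) * (y u - y v) ^ 2 := by
  have hform : y ⬝ᵥ ((Aᵀ * A) *ᵥ y) = ∑ e, (A *ᵥ y) e ^ 2 := by
    rw [← mulVec_mulVec, dotProduct_mulVec, vecMul_transpose]
    simp only [dotProduct, sq]
  have hedge : ∀ e : G.edgeSet, 2 * (A *ᵥ y) e ^ 2
      = ∑ p : V × V, if s(p.1, p.2) = (e : Sym2 V) then (y p.1 - y p.2) ^ 2 else 0 := by
    intro e
    obtain ⟨u, v, he, hu, hv, h0⟩ := hA e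
    have huv : u ≠ v := by
      rintro rfl
      linarith
    have hAy : (A *ᵥ y) e = y v - y u := by
      rw [mulVec, dotProduct, ← sum_subset (subset_univ {u, v}), sum_pair huv, hu, hv]
      · ring
      · intro x _ hx
        simp only [mem_insert, mem_singleton, not_or] at hx
        rw [h0 x hx.1 hx.2, zero_mul]
    have hfib : (univ.filter fun p : V × V => s(p.1, p.2) = (e : Sym2 V)) = {(u, v), (v, u)} := by
      ext ⟨a, b⟩
      simp [he]
    rw [← sum_filter, hfib, sum_pair (by simp [huv]), hAy]
    ring
  rw [hform, mul_sum]
  simp only [hedge]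
  rw [sum_comm, Fintype.sum_prod_type]
  refine sum_congr rfl fun u _ => sum_congr rfl fun v _ => ?_
  by_cases huv : G.Adj u v
  · rw [sum_eq_single_of_mem (⟨s(u, v), huv⟩ : G.edgeSet) (mem_univ _)]
    · simp [huv]
    · intro e _ he
      exact if_neg fun h => he (Subtype.ext h.symm)
  · rw [if_neg huv, zero_mul]
    refine sum_eq_zero fun e _ => if_neg fun h => huv ?_
    have := e.2
    rwa [← h, SimpleGraph.mem_edgeSet] at this

/-- **Cheeger-based lemma.**  Let `G` be a `φ`-expander (every vertex of degree ≥ 1),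
`A` the edge-vertex incidence matrix for an arbitrary orientation of its edges,
`D` the degree matrix and `L = AᵀA` its Laplacian.  Then for every `y ⊥ D·𝟙`,
`yᵀ L y ≥ (1/2) φ² yᵀ D y`. -/
theorem cheeger_based_expander_bound
    {V : Type*} [Fintype V] [DecidableEq V]
    (G : SimpleGraph V) [DecidableRel G.Adj]
    (hdeg : ∀ v : V, 1 ≤ G.degree v)
    (φ : ℝ) (hφ0 : 0 < φ) (hφ1 : φ ≤ 1)
    (hexp : ∀ S : Finset V, S.Nonempty → S ≠ Finset.univ →
      φ ≤ ((Finset.univ.filter fun p : V × V => p.1 ∈ S ∧ p.2 ∉ S ∧ G.Adj p.1 p.2).card : ℝ) /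
          min (∑ v ∈ S, (G.degree v : ℝ)) (∑ v ∈ Sᶜ, (G.degree v : ℝ)))
    (A : Matrix G.edgeSet V ℝ)
    (hA : ∀ e : G.edgeSet, ∃ u v : V, (e : Sym2 V) = s(u, v) ∧
      A e u = -1 ∧ A e v = 1 ∧ ∀ w : V, w ≠ u → w ≠ v → A e w = 0)
    (y : V → ℝ) (hy : ∑ v : V, (G.degree v : ℝ) * y v = 0) :
    (1 / 2) * (∑ v : V, (G.degree v : ℝ) * y v ^ 2) * φ ^ 2 ≤ y ⬝ᵥ ((Aᵀ * A) *ᵥ y) := by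
  set w : V → V → ℝ := fun u v => if G.Adj u v then 1 else 0 with hw
  have hdw : ∀ v, ∑ u, w v u = (G.degree v : ℝ) := fun v => by
    simp only [hw, sum_boole, ← SimpleGraph.card_neighborFinset_eq_degree,
      SimpleGraph.neighborFinset_eq_filter]
  have hcut : ∀ T : Finset V, ∑ u ∈ T, ∑ v ∈ Tᶜ, w u v =
      ((univ.filter fun p : V × V => p.1 ∈ T ∧ p.2 ∉ T ∧ G.Adj p.1 p.2).card : ℝ) := fun T => by
    rw [← sum_product', hw, sum_boole]
    congr 2
    ext p
    simp [and_assoc]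
  have hcheeger := sq_mul_sum_le_energy_of_expander w
    (fun u v => by simp only [hw]; split_ifs <;> norm_num)
    (fun u v => by simp only [hw, G.adj_comm]) φ hφ0.le
    (fun T hne hT => by
      simp only [hdw] at hT ⊢
      have hTpos : 0 < ∑ v ∈ T, (G.degree v : ℝ) :=
        sum_pos (fun v _ => by exact_mod_cast hdeg v) hne
      have hsplit := sum_add_sum_compl T fun v => (G.degree v : ℝ)
      have hTuniv : T ≠ univ := by
        rintro rfl
        linarith
      have := hexp T hne hTuniv
      rwa [min_eq_left (by linarith), le_div_iff₀ hTpos, ← hcut] at this)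
    y (by simpa only [hdw] using hy)
  rw [← two_mul_dotProduct_transpose_mul_incidence G A hA y] at hcheeger
  simp only [hdw] at hcheeger
  linarith
end

section
/- Fix λ ≥ 1 and let φ(t) := exp(λ(t−1)) + exp(−λ(t−1)), Φ(v) := Σ_{i=1}^n φ(v_i). Let k, n ≥ 1 and for each j ∈ {1,…,k} let u^{(j)} ∈ ℝ^n be entrywise positive, c_j ∈ ℝ, and δ^{(j)} ∈ ℝ^n, with U_j := diag(u^{(j)}). Define v, v^new ∈ ℝ^n by v_i := Π_{j=1}^k (u_i^{(j)})^{c_j} and v_i^new := Π_{j=1}^k (u_i^{(j)} + δ_i^{(j)})^{c_j}, and let V := diag(v). Suppose ‖U_j^{−1}δ^{(j)}‖_∞ ≤ 1/(12(1 + λ‖c‖₁)) for all j, and v_i ≤ 13/12 for all i. Then v^new ≈_{1/(11λ)} v, and Φ(v^new) ≤ Φ(v) + Σ_{j=1}^k c_j·φ'(v)ᵀ V U_j^{−1} δ^{(j)} + 2(1 + ‖c‖₁)·Σ_{j=1}^k |c_j|·‖U_j^{−1}δ^{(j)}‖²_{φ''(v)}. -/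
open Finset

/-- The potential function `φ(t) = exp(λ(t-1)) + exp(-λ(t-1))`. -/
noncomputable def phiPot (lam t : ℝ) : ℝ :=
  Real.exp (lam * (t - 1)) + Real.exp (-(lam * (t - 1)))

/-- Its first derivative `φ'(w) = λ(exp(λ(w-1)) - exp(λ(1-w)))`. -/
noncomputable def phiPot' (lam w : ℝ) : ℝ :=
  lam * (Real.exp (lam * (w - 1)) - Real.exp (lam * (1 - w)))

/-- Its second derivative `φ''(w) = λ²(exp(λ(w-1)) + exp(λ(1-w)))`. -/
noncomputable def phiPot'' (lam w : ℝ) : ℝ :=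
  lam ^ 2 * (Real.exp (lam * (w - 1)) + Real.exp (lam * (1 - w)))

theorem abs_exp_sub_one_sub_id_le_of_le_eighth {x : ℝ} (hx : |x| ≤ 1 / 8) :
    |Real.exp x - 1 - x| ≤ 11 / 20 * x ^ 2 := by
  have h := Real.exp_bound (x := x) (by linarith) (n := 3) (by norm_num)
  norm_num [Finset.sum_range_succ, Nat.factorial] at h
  have h3 : |x| ^ 3 ≤ 1 / 8 * x ^ 2 := by
    rw [← sq_abs x]
    nlinarith [mul_le_mul_of_nonneg_right hx (sq_nonneg |x|)]
  rw [abs_le] at h ⊢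
  constructor <;> nlinarith [h.1, h.2, sq_nonneg x]

theorem abs_log_one_add_le_of_le_twelfth {r : ℝ} (hr : |r| ≤ 1 / 12) :
    |Real.log (1 + r)| ≤ 12 / 11 * |r| := by
  have h := Real.abs_log_sub_add_sum_range_le (x := -r) (by rw [abs_neg]; linarith) 0
  simp only [Finset.range_zero, Finset.sum_empty, zero_add, sub_neg_eq_add, abs_neg,
    pow_one] at h
  refine h.trans ?_
  rw [div_le_iff₀ (by linarith)]
  nlinarith [abs_nonneg r]

theorem abs_log_one_add_sub_self_le_of_le_twelfth {r : ℝ} (hr : |r| ≤ 1 / 12) :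
    |Real.log (1 + r) - r| ≤ 12 / 11 * r ^ 2 := by
  have h := Real.abs_log_sub_add_sum_range_le (x := -r) (by rw [abs_neg]; linarith) 1
  norm_num at h
  rw [show Real.log (1 + r) - r = -r + Real.log (1 + r) by ring]
  refine h.trans ?_
  rw [div_le_iff₀ (by linarith)]
  nlinarith [sq_nonneg r]

/-- The second-order expansion of the potential under a multiplicative perturbation `exp S`
of one coordinate, where `L` is the linear part of `S`. -/
theorem phiPot_mul_exp_le {lam w S L C Q : ℝ} (hlam : 1 ≤ lam) (hw : 0 < w)
    (hwb : w ≤ 13 / 12) (hS : |S| ≤ 1 / (11 * lam)) (hQ : 0 ≤ Q)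
    (hSL : |S - L| ≤ 12 / 11 * Q) (hSQ : S ^ 2 ≤ 144 / 121 * (C * Q)) :
    phiPot lam (w * Real.exp S) ≤
      phiPot lam w + phiPot' lam w * w * L + 2 * (1 + C) * (phiPot'' lam w * Q) := by
  have hlam0 : 0 < lam := by linarith
  have hlS : lam * |S| ≤ 1 / 11 := by
    rw [le_div_iff₀ (by positivity)] at hS
    linarith
  have hS11 : |S| ≤ 1 / 11 := by nlinarith [abs_nonneg S]
  have he2 := abs_exp_sub_one_sub_id_le_of_le_eighth (x := S) (by linarith)
  set d := w * (Real.exp S - 1) with hd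
  have he1 : |Real.exp S - 1| ≤ 12 / 11 * |S| := by
    have h1 : |Real.exp S - 1| ≤ |Real.exp S - 1 - S| + |S| := by
      simpa using abs_add_le (Real.exp S - 1 - S) S
    nlinarith [abs_nonneg S, sq_abs S]
  have hdS : |d| ≤ 13 / 11 * |S| := by
    rw [hd, abs_mul, abs_of_pos hw]
    nlinarith [abs_nonneg (Real.exp S - 1)]
  have hd2 : d ^ 2 ≤ 169 / 121 * S ^ 2 := by
    rw [← sq_abs d, ← sq_abs S]
    nlinarith [abs_nonneg d, abs_nonneg S]
  have hdL : |d - w * L| ≤ 13 / 12 * (11 / 20 * S ^ 2 + 12 / 11 * Q) := by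
    have h : d - w * L = w * ((Real.exp S - 1 - S) + (S - L)) := by rw [hd]; ring
    rw [h, abs_mul, abs_of_pos hw]
    have := abs_add_le (Real.exp S - 1 - S) (S - L)
    exact mul_le_mul hwb (by linarith) (abs_nonneg _) (by norm_num)
  have hld : |lam * d| ≤ 1 / 8 := by
    rw [abs_mul, abs_of_pos hlam0]
    nlinarith
  have hp := (abs_le.1 (abs_exp_sub_one_sub_id_le_of_le_eighth hld)).2
  have hm := (abs_le.1 (abs_exp_sub_one_sub_id_le_of_le_eighth
    (x := -(lam * d)) (by rwa [abs_neg]))).2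
  have hkey : |d - w * L| + 11 / 20 * d ^ 2 ≤ 2 * (1 + C) * Q := by
    nlinarith
  unfold phiPot phiPot' phiPot''
  rw [show lam * (w * Real.exp S - 1) = lam * (w - 1) + lam * d by rw [hd]; ring,
    neg_add, Real.exp_add, Real.exp_add,
    show lam * (1 - w) = -(lam * (w - 1)) by ring]
  have hA := Real.exp_pos (lam * (w - 1))
  have hB := Real.exp_pos (-(lam * (w - 1)))
  set A := Real.exp (lam * (w - 1))
  set B := Real.exp (-(lam * (w - 1)))
  have h1 : A * Real.exp (lam * d) ≤ A * (1 + lam * d + 11 / 20 * (lam * d) ^ 2) :=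
    mul_le_mul_of_nonneg_left (by linarith) hA.le
  have h2 : B * Real.exp (-(lam * d)) ≤ B * (1 - lam * d + 11 / 20 * (lam * d) ^ 2) :=
    mul_le_mul_of_nonneg_left (by linarith) hB.le
  have h3 : lam * (A - B) * (d - w * L) ≤ lam ^ 2 * (A + B) * |d - w * L| := by
    refine (le_abs_self _).trans ?_
    rw [abs_mul, abs_mul, abs_of_pos hlam0]
    refine mul_le_mul_of_nonneg_right ?_ (abs_nonneg _)
    refine mul_le_mul (by nlinarith) ?_ (abs_nonneg _) (by positivity)
    rw [abs_le]
    constructor <;> linarith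
  have h4 : lam ^ 2 * (A + B) * (|d - w * L| + 11 / 20 * d ^ 2) ≤
      lam ^ 2 * (A + B) * (2 * (1 + C) * Q) :=
    mul_le_mul_of_nonneg_left hkey (by positivity)
  linarith

/-- **Expansion of the potential.**  With `v_i = Π_j (u_i⁽ʲ⁾)^{c_j}` and
`v_i^new = Π_j (u_i⁽ʲ⁾ + δ_i⁽ʲ⁾)^{c_j}`, if `‖U_j⁻¹δ⁽ʲ⁾‖_∞ ≤ 1/(12(1+λ‖c‖₁))` for all `j`
and `v ≤ 13/12`, then `v^new ≈_{1/(11λ)} v` and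
`Φ(v^new) ≤ Φ(v) + Σ_j c_j φ'(v)ᵀ V U_j⁻¹ δ⁽ʲ⁾ + 2(1+‖c‖₁) Σ_j |c_j| ‖U_j⁻¹δ⁽ʲ⁾‖²_{φ''(v)}`. -/
theorem expand_potential
    (lam : ℝ) (hlam : 1 ≤ lam) (k n : ℕ) (hk : 1 ≤ k) (hn : 1 ≤ n)
    (u : Fin k → Fin n → ℝ) (hu : ∀ j i, 0 < u j i)
    (c : Fin k → ℝ) (δ : Fin k → Fin n → ℝ)
    (hδ : ∀ j i, |δ j i / u j i| ≤ 1 / (12 * (1 + lam * ∑ j', |c j'|)))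
    (v vnew : Fin n → ℝ)
    (hv : ∀ i, v i = ∏ j, (u j i) ^ (c j))
    (hvnew : ∀ i, vnew i = ∏ j, (u j i + δ j i) ^ (c j))
    (hvb : ∀ i, v i ≤ 13 / 12) :
    (∀ i, Real.exp (-(1 / (11 * lam))) * v i ≤ vnew i ∧
        vnew i ≤ Real.exp (1 / (11 * lam)) * v i) ∧
    ∑ i, phiPot lam (vnew i) ≤ ∑ i, phiPot lam (v i)
      + ∑ j, c j * ∑ i, phiPot' lam (v i) * v i * (δ j i / u j i)
      + 2 * (1 + ∑ j', |c j'|) * ∑ j, |c j| * ∑ i, phiPot'' lam (v i) * (δ j i / u j i) ^ 2 := by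
  have hlam0 : 0 < lam := by linarith
  set C := ∑ j', |c j'| with hCdef
  have hC : 0 ≤ C := Finset.sum_nonneg fun _ _ => abs_nonneg _
  have hr : ∀ j i, |δ j i / u j i| ≤ 1 / 12 := fun j i =>
    (hδ j i).trans (one_div_le_one_div_of_le (by norm_num) (by nlinarith))
  have hvpos : ∀ i, 0 < v i := fun i => by
    rw [hv]
    exact Finset.prod_pos fun j _ => Real.rpow_pos_of_pos (hu j i) _
  set S : Fin n → ℝ := fun i => ∑ j, c j * Real.log (1 + δ j i / u j i) with hSdef
  have hnew : ∀ i, vnew i = v i * Real.exp (S i) := fun i => by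
    rw [hvnew, hv, hSdef, Real.exp_sum, ← Finset.prod_mul_distrib]
    refine Finset.prod_congr rfl fun j _ => ?_
    have h1 : 0 < 1 + δ j i / u j i := by linarith [(abs_le.1 (hr j i)).1]
    have h2 : u j i + δ j i = u j i * (1 + δ j i / u j i) := by
      field_simp [(hu j i).ne']
    rw [h2, Real.mul_rpow (hu j i).le h1.le, Real.rpow_def_of_pos h1, mul_comm (c j)]
  have hSr : ∀ i, |S i| ≤ 12 / 11 * ∑ j, |c j| * |δ j i / u j i| := fun i => by
    refine (Finset.abs_sum_le_sum_abs _ _).trans ?_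
    rw [Finset.mul_sum]
    refine Finset.sum_le_sum fun j _ => ?_
    rw [abs_mul]
    nlinarith [mul_le_mul_of_nonneg_left (abs_log_one_add_le_of_le_twelfth (hr j i))
      (abs_nonneg (c j))]
  have hS : ∀ i, |S i| ≤ 1 / (11 * lam) := fun i => by
    have h1 : ∑ j, |c j| * |δ j i / u j i| ≤ C * (1 / (12 * (1 + lam * C))) := by
      rw [hCdef, Finset.sum_mul]
      exact Finset.sum_le_sum fun j _ => mul_le_mul_of_nonneg_left (hδ j i) (abs_nonneg _)
    have h2 : C * (1 / (12 * (1 + lam * C))) ≤ 1 / (12 * lam) := by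
      rw [mul_one_div, div_le_div_iff₀ (by positivity) (by positivity)]
      nlinarith
    have h3 : 12 / 11 * (1 / (12 * lam)) = 1 / (11 * lam) := by field_simp
    linarith [hSr i]
  refine ⟨fun i => ?_, ?_⟩
  · have h := abs_le.1 (hS i)
    rw [hnew, mul_comm (v i)]
    exact ⟨mul_le_mul_of_nonneg_right (Real.exp_le_exp.2 h.1) (hvpos i).le,
      mul_le_mul_of_nonneg_right (Real.exp_le_exp.2 h.2) (hvpos i).le⟩
  · have key : ∀ i, phiPot lam (vnew i) ≤ phiPot lam (v i)
        + phiPot' lam (v i) * v i * (∑ j, c j * (δ j i / u j i))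
        + 2 * (1 + C) * (phiPot'' lam (v i) * ∑ j, |c j| * (δ j i / u j i) ^ 2) := fun i => by
      rw [hnew]
      refine phiPot_mul_exp_le hlam (hvpos i) (hvb i) (hS i)
        (Finset.sum_nonneg fun j _ => by positivity) ?_ ?_
      · rw [hSdef, ← Finset.sum_sub_distrib, Finset.mul_sum]
        refine (Finset.abs_sum_le_sum_abs _ _).trans (Finset.sum_le_sum fun j _ => ?_)
        rw [← mul_sub, abs_mul]
        nlinarith [mul_le_mul_of_nonneg_left
          (abs_log_one_add_sub_self_le_of_le_twelfth (hr j i)) (abs_nonneg (c j))]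
      · have hcs : (∑ j, |c j| * |δ j i / u j i|) ^ 2 ≤
            C * ∑ j, |c j| * (δ j i / u j i) ^ 2 := by
          refine Finset.sum_sq_le_sum_mul_sum_of_sq_le_mul _ (fun _ _ => abs_nonneg _)
            (fun _ _ => by positivity) fun j _ => le_of_eq ?_
          rw [mul_pow, sq_abs (δ j i / u j i)]
          ring
        have h := pow_le_pow_left₀ (abs_nonneg _) (hSr i) 2
        rw [sq_abs, mul_pow] at h
        linarith
    refine (Finset.sum_le_sum fun i _ => key i).trans (le_of_eq ?_)
    rw [Finset.sum_add_distrib, Finset.sum_add_distrib, ← Finset.mul_sum]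
    simp only [Finset.mul_sum]
    congr 1
    · congr 1
      rw [Finset.sum_comm]
      exact Finset.sum_congr rfl fun j _ => Finset.sum_congr rfl fun i _ => by ring
    · rw [Finset.sum_comm]
      exact Finset.sum_congr rfl fun j _ => Finset.sum_congr rfl fun i _ => by ring
end

section
/- Fix λ ≥ 1 and let φ(t) := exp(λ(t−1)) + exp(−λ(t−1)), Φ(w) := Σ_{i=1}^m φ(w_i). Let U ⊂ ℝ^m be a compact, axis-symmetric, convex set that is contained in the ℓ∞-ball of radius 1 and contains the ℓ∞-ball of radius u for some 0 < u ≤ 1, and for h ∈ ℝ^m set ‖h‖_U := max_{z∈U} ⟨h, z⟩. Let w, v ∈ ℝ^m with ‖w − v‖_∞ ≤ δ for some 0 ≤ δ ≤ 1/(5λ), let γ ≥ 0, and set g := −γ·z*, where z* ∈ U attains max_{z∈U} ⟨∇Φ(v), z⟩. Let c₁, c₂ ≥ 0 satisfy λγ ≤ 1/8 and 2λδ + c₂λγ ≤ 0.5·(1 − c₁), and define δ_Φ := φ'(w)ᵀ g + c₁·γ·‖φ'(w)‖_U + c₂·γ²·‖φ''(w)‖_U. Then δ_Φ ≤ −0.5·(1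 − c₁)·λγu·Φ(w) + m. -/
open Finset

/-- `‖h‖_U := max_{z ∈ U} ⟨h, z⟩` for a compact set `U` (formalized with `sSup`). -/
noncomputable def dualNorm {m : ℕ} (U : Set (Fin m → ℝ)) (h : Fin m → ℝ) : ℝ :=
  sSup ((fun z => ∑ i, h i * z i) '' U)

/-- A coordinatewise sign change of `z` inside an axis-symmetric set aligns it with `h`. -/
lemma exists_mem_mul_eq_abs_mul_abs {m : ℕ} {U : Set (Fin m → ℝ)}
    (hU : ∀ x ∈ U, ∀ y : Fin m → ℝ, (∀ i, y i = x i ∨ y i = -x i) → y ∈ U)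
    (h : Fin m → ℝ) {z : Fin m → ℝ} (hz : z ∈ U) :
    ∃ y ∈ U, ∀ i, h i * y i = |h i| * |z i| := by
  refine ⟨fun i => if 0 ≤ h i then |z i| else -|z i|, hU z hz _ fun i => ?_, fun i => ?_⟩
  · split_ifs <;> rcases abs_choice (z i) with h | h <;> simp [h]
  · dsimp only
    split_ifs with hi
    · rw [abs_of_nonneg hi]
    · rw [abs_of_neg (not_le.mp hi)]
      ring

lemma sum_mul_le_dualNorm {m : ℕ} {U : Set (Fin m → ℝ)} (hU : IsCompact U)
    (h : Fin m → ℝ) {z : Fin m → ℝ} (hz : z ∈ U) : ∑ i, h i * z i ≤ dualNorm U h :=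
  le_csSup (hU.image (by fun_prop)).bddAbove (Set.mem_image_of_mem _ hz)

lemma exists_dualNorm_eq {m : ℕ} {U : Set (Fin m → ℝ)} (hU : IsCompact U) (hne : U.Nonempty)
    (h : Fin m → ℝ) : ∃ z ∈ U, ∑ i, h i * z i = dualNorm U h :=
  (hU.image (by fun_prop)).sSup_mem (hne.image _)

lemma exp_sub_exp_neg_shift_of_nonneg {x y ε : ℝ} (hxy : |x - y| ≤ ε) (hε : ε ≤ 1 / 5)
    (hy : 0 ≤ y) :
    Real.exp (-ε) * (Real.exp y - Real.exp (-y)) - 2 ≤ Real.exp x - Real.exp (-x) := by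
  have h := abs_le.mp hxy
  have h1 : Real.exp (-ε) * Real.exp y ≤ Real.exp x := by
    rw [← Real.exp_add]
    exact Real.exp_le_exp.mpr (by linarith)
  have h2 : 0 ≤ Real.exp (-ε) * Real.exp (-y) := by positivity
  have h3 : Real.exp (-x) ≤ 2 := by
    have h4 : Real.exp (-x) ≤ Real.exp (1 / 5) := Real.exp_le_exp.mpr (by linarith)
    have h5 := Real.exp_bound_div_one_sub_of_interval (x := 1 / 5) (by norm_num) (by norm_num)
    norm_num at h5
    linarith
  linarith

lemma exp_sub_exp_neg_mul_shift {x y z ε : ℝ} (hxy : |x - y| ≤ ε) (hε : ε ≤ 1 / 5)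
    (hz : |z| ≤ 1) (hyz : 0 ≤ (Real.exp y - Real.exp (-y)) * z) :
    Real.exp (-ε) * ((Real.exp y - Real.exp (-y)) * z) - 2 ≤
      (Real.exp x - Real.exp (-x)) * z := by
  have hz' := abs_le.mp hz
  have key : 0 ≤ y ∧ 0 ≤ z ∨ y ≤ 0 ∧ z ≤ 0 := by
    rcases lt_trichotomy y 0 with hy | hy | hy
    · have : Real.exp y < Real.exp (-y) := Real.exp_lt_exp.mpr (by linarith)
      exact Or.inr ⟨hy.le, by nlinarith⟩
    · rcases le_total 0 z with h | h
      · exact Or.inl ⟨hy.ge, h⟩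
      · exact Or.inr ⟨hy.le, h⟩
    · have : Real.exp (-y) < Real.exp y := Real.exp_lt_exp.mpr (by linarith)
      exact Or.inl ⟨hy.le, by nlinarith⟩
  rcases key with ⟨hy, h⟩ | ⟨hy, h⟩
  · have := mul_le_mul_of_nonneg_right (exp_sub_exp_neg_shift_of_nonneg hxy hε hy) h
    linarith
  · have hxy' : |-x - -y| ≤ ε := by
      rwa [neg_sub_neg, abs_sub_comm]
    have := mul_le_mul_of_nonneg_right
      (exp_sub_exp_neg_shift_of_nonneg hxy' hε (neg_nonneg.mpr hy)) (neg_nonneg.mpr h)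
    rw [neg_neg, neg_neg] at this
    linarith

lemma phiPot'_mul_shift {lam w v δ z : ℝ} (hlam : 0 < lam) (hδ : lam * δ ≤ 1 / 5)
    (hwv : |w - v| ≤ δ) (hz : |z| ≤ 1) (hvz : 0 ≤ phiPot' lam v * z) :
    Real.exp (-(lam * δ)) * (phiPot' lam v * z) - 2 * lam ≤ phiPot' lam w * z := by
  have e (t : ℝ) : lam * (1 - t) = -(lam * (t - 1)) := by ring
  unfold phiPot' at *
  rw [e] at *
  rw [e]
  have hxy : |lam * (w - 1) - lam * (v - 1)| ≤ lam * δ := by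
    rw [show lam * (w - 1) - lam * (v - 1) = lam * (w - v) by ring, abs_mul, abs_of_pos hlam]
    exact mul_le_mul_of_nonneg_left hwv hlam.le
  rw [mul_assoc] at hvz
  have := mul_le_mul_of_nonneg_left
    (exp_sub_exp_neg_mul_shift hxy hδ hz (nonneg_of_mul_nonneg_right hvz hlam)) hlam.le
  linarith

lemma abs_phiPot'_shift {lam w v δ : ℝ} (hlam : 0 < lam) (hδ : lam * δ ≤ 1 / 5)
    (hwv : |w - v| ≤ δ) :
    Real.exp (-(lam * δ)) * |phiPot' lam w| - 2 * lam ≤ |phiPot' lam v| := by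
  rw [abs_sub_comm] at hwv
  rcases le_total 0 (phiPot' lam w) with h | h
  · have := phiPot'_mul_shift (z := 1) hlam hδ hwv (by simp) (by simpa using h)
    rw [abs_of_nonneg h]
    have := le_abs_self (phiPot' lam v)
    linarith
  · have := phiPot'_mul_shift (z := -1) hlam hδ hwv (by simp) (by simpa using h)
    rw [abs_of_nonpos h]
    have := neg_le_abs (phiPot' lam v)
    linarith

lemma mul_phiPot_le {lam : ℝ} (hlam : 0 < lam) (t : ℝ) :
    lam * phiPot lam t ≤ |phiPot' lam t| + 2 * lam := by
  unfold phiPot phiPot'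
  rw [show lam * (1 - t) = -(lam * (t - 1)) by ring, abs_mul, abs_of_pos hlam]
  set x := lam * (t - 1)
  have : Real.exp x + Real.exp (-x) ≤ |Real.exp x - Real.exp (-x)| + 2 := by
    rcases le_total 0 x with h | h
    · have := Real.exp_le_one_iff.mpr (neg_nonpos.mpr h)
      linarith [le_abs_self (Real.exp x - Real.exp (-x))]
    · have := Real.exp_le_one_iff.mpr h
      linarith [neg_le_abs (Real.exp x - Real.exp (-x))]
  nlinarith

lemma phiPot''_eq (lam t : ℝ) : phiPot'' lam t = lam * (lam * phiPot lam t) := by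
  unfold phiPot phiPot''
  rw [show lam * (1 - t) = -(lam * (t - 1)) by ring]
  ring

lemma phiPot_pos (lam t : ℝ) : 0 < phiPot lam t := by
  unfold phiPot
  positivity

/-- **Main potential-decrease lemma.**  Let `U` be a compact, axis-symmetric convex set
with `B_∞(u) ⊆ U ⊆ B_∞(1)`, `‖w - v‖_∞ ≤ δ ≤ 1/(5λ)`, and
`g = -γ·argmax_{z∈U}⟨∇Φ(v), z⟩`.  If `λγ ≤ 1/8` and `2λδ + c₂λγ ≤ 0.5(1 - c₁)`,
then `δ_Φ := φ'(w)ᵀg + c₁γ‖φ'(w)‖_U + c₂γ²‖φ''(w)‖_U ≤ -0.5(1-c₁)λγu·Φ(w) + m`. -/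
theorem centrality_main_general
    (lam : ℝ) (hlam : 1 ≤ lam) (m : ℕ) (hm : 1 ≤ m)
    (U : Set (Fin m → ℝ)) (hUcomp : IsCompact U) (hUconv : Convex ℝ U)
    (hUsym : ∀ x ∈ U, ∀ y : Fin m → ℝ, (∀ i, y i = x i ∨ y i = -x i) → y ∈ U)
    (u : ℝ) (hu0 : 0 < u) (hu1 : u ≤ 1)
    (hUsub : ∀ x ∈ U, ∀ i, |x i| ≤ 1)
    (hUsup : ∀ x : Fin m → ℝ, (∀ i, |x i| ≤ u) → x ∈ U)
    (w v : Fin m → ℝ) (δ : ℝ) (hδ0 : 0 ≤ δ) (hδ1 : δ ≤ 1 / (5 * lam))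
    (hwv : ∀ i, |w i - v i| ≤ δ)
    (γ : ℝ) (hγ : 0 ≤ γ)
    (zstar : Fin m → ℝ) (hzmem : zstar ∈ U)
    (hzmax : ∀ z ∈ U, ∑ i, phiPot' lam (v i) * z i ≤ ∑ i, phiPot' lam (v i) * zstar i)
    (c₁ c₂ : ℝ) (hc₁ : 0 ≤ c₁) (hc₂ : 0 ≤ c₂)
    (hlγ : lam * γ ≤ 1 / 8)
    (hcomb : 2 * lam * δ + c₂ * lam * γ ≤ 0.5 * (1 - c₁)) :
    (∑ i, phiPot' lam (w i) * (-γ * zstar i))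
        + c₁ * γ * dualNorm U (fun i => phiPot' lam (w i))
        + c₂ * γ ^ 2 * dualNorm U (fun i => phiPot'' lam (w i))
      ≤ -(0.5 * (1 - c₁) * lam * γ * u * ∑ i, phiPot lam (w i)) + m := by
  have hl : 0 < lam := by linarith
  have hlδ : lam * δ ≤ 1 / 5 := by
    rw [le_div_iff₀ (by positivity)] at hδ1
    linarith
  have hne : U.Nonempty := ⟨zstar, hzmem⟩
  have hsum (c : ℝ) : ∑ _i : Fin m, c = m * c := by simp
  set N := dualNorm U (fun i => phiPot' lam (w i)) with hN
  set M := dualNorm U (fun i => phiPot'' lam (w i)) with hM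
  set E := Real.exp (-(lam * δ)) with hE
  set T := ∑ i, phiPot' lam (v i) * zstar i with hT
  set W := ∑ i, phiPot' lam (w i) * zstar i with hW
  have hEpos : 0 < E := Real.exp_pos _
  have hEle : E ≤ 1 := Real.exp_le_one_iff.mpr (by nlinarith)
  have hE2 : 1 - 2 * (lam * δ) ≤ E * E := by
    rw [hE, ← Real.exp_add]
    linarith [Real.add_one_le_exp (-(lam * δ) + -(lam * δ))]
  have hNabs : ∀ z ∈ U, ∑ i, |phiPot' lam (w i)| * |z i| ≤ N := fun z hz => by
    obtain ⟨y, hy, hyz⟩ := exists_mem_mul_eq_abs_mul_abs hUsym (fun i => phiPot' lam (w i)) hz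
    simpa only [hyz] using sum_mul_le_dualNorm hUcomp (fun i => phiPot' lam (w i)) hy
  have hTabs : ∀ z ∈ U, ∑ i, |phiPot' lam (v i)| * |z i| ≤ T := fun z hz => by
    obtain ⟨y, hy, hyz⟩ := exists_mem_mul_eq_abs_mul_abs hUsym (fun i => phiPot' lam (v i)) hz
    simpa only [hyz] using hzmax y hy
  have hNT : E * N - m * (2 * lam) ≤ T := by
    obtain ⟨z, hz, hzN⟩ := exists_dualNorm_eq hUcomp hne (fun i => phiPot' lam (w i))
    refine le_trans ?_ (hTabs z hz)
    rw [hN, ← hzN, ← hsum, Finset.mul_sum, ← Finset.sum_sub_distrib]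
    refine Finset.sum_le_sum fun i _ => ?_
    have h1 := mul_le_mul_of_nonneg_right (abs_phiPot'_shift hl hlδ (hwv i)) (abs_nonneg (z i))
    have h2 : phiPot' lam (w i) * z i ≤ |phiPot' lam (w i)| * |z i| := by
      rw [← abs_mul]
      exact le_abs_self _
    have h3 := mul_le_mul_of_nonneg_left h2 hEpos.le
    have h4 := mul_le_mul_of_nonneg_left (hUsub z hz i) hl.le
    linarith
  have hpos : ∀ i, 0 ≤ phiPot' lam (v i) * zstar i := by
    have hle : ∀ i ∈ univ, phiPot' lam (v i) * zstar i ≤ |phiPot' lam (v i)| * |zstar i| :=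
      fun i _ => by
        rw [← abs_mul]
        exact le_abs_self _
    have heq := (Finset.sum_eq_sum_iff_of_le hle).mp
      (le_antisymm (Finset.sum_le_sum hle) (hTabs zstar hzmem))
    intro i
    rw [heq i (mem_univ i)]
    positivity
  have hTW : E * T - m * (2 * lam) ≤ W := by
    rw [hT, hW, ← hsum, Finset.mul_sum, ← Finset.sum_sub_distrib]
    exact Finset.sum_le_sum fun i _ =>
      phiPot'_mul_shift hl hlδ (hwv i) (hUsub zstar hzmem i) (hpos i)
  have hMN : M ≤ lam * N + m * (2 * lam ^ 2) := by
    obtain ⟨z, hz, hzM⟩ := exists_dualNorm_eq hUcomp hne (fun i => phiPot'' lam (w i))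
    refine le_trans ?_ (add_le_add_left (mul_le_mul_of_nonneg_left (hNabs z hz) hl.le) _)
    rw [hM, ← hzM, ← hsum, Finset.mul_sum, ← Finset.sum_add_distrib]
    refine Finset.sum_le_sum fun i _ => ?_
    rw [phiPot''_eq]
    have hφ := phiPot_pos lam (w i)
    have h1 := mul_le_mul_of_nonneg_left (le_abs_self (z i))
      (show 0 ≤ lam * (lam * phiPot lam (w i)) by positivity)
    have h2 := mul_le_mul_of_nonneg_left (mul_le_mul_of_nonneg_right
      (mul_phiPot_le hl (w i)) (abs_nonneg (z i))) hl.le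
    have h3 := mul_le_mul_of_nonneg_left (hUsub z hz i) (sq_nonneg lam)
    linarith
  have hΦN : lam * u * ∑ i, phiPot lam (w i) ≤ N + m * (2 * lam) := by
    have h1 := hNabs (fun _ => u) (hUsup _ fun _ => (abs_of_pos hu0).le)
    refine le_trans ?_ (add_le_add_left h1 _)
    rw [← hsum, Finset.mul_sum, ← Finset.sum_add_distrib]
    refine Finset.sum_le_sum fun i _ => ?_
    rw [abs_of_pos hu0]
    have h2 := mul_le_mul_of_nonneg_right (mul_phiPot_le hl (w i)) hu0.le
    have h3 := mul_le_mul_of_nonneg_left hu1 hl.le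
    linarith
  have hN0 : 0 ≤ N := (Finset.sum_nonneg fun i _ => by positivity).trans (hNabs zstar hzmem)
  have hm0 : (0 : ℝ) ≤ m := Nat.cast_nonneg m
  have hWN : (1 - 2 * (lam * δ)) * N - m * (4 * lam) ≤ W := by
    have h1 := mul_le_mul_of_nonneg_left hNT hEpos.le
    have h2 := mul_le_mul_of_nonneg_right hE2 hN0
    have h3 := mul_le_mul_of_nonneg_right hEle (show 0 ≤ m * (2 * lam) by positivity)
    linarith
  have hc₁' : 0 ≤ 1 - c₁ := by
    have : 0 ≤ 2 * lam * δ + c₂ * lam * γ := by positivity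
    linarith
  have hlγ0 : 0 ≤ lam * γ := by positivity
  have hWsum : ∑ i, phiPot' lam (w i) * (-γ * zstar i) = -γ * W := by
    rw [hW, Finset.mul_sum]
    exact Finset.sum_congr rfl fun i _ => by ring
  rw [hWsum]
  have b1 := mul_le_mul_of_nonneg_left hWN hγ
  have b2 := mul_le_mul_of_nonneg_left hMN (show 0 ≤ c₂ * γ ^ 2 by positivity)
  have b3 := mul_le_mul_of_nonneg_left hΦN (show 0 ≤ 0.5 * (1 - c₁) * γ by positivity)
  have b4 := mul_le_mul_of_nonneg_right hcomb (show 0 ≤ γ * N by positivity)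
  have b5 := mul_le_mul_of_nonneg_left hlγ hm0
  have b6 : c₂ * lam * γ ≤ 1 / 2 := by
    have : 0 ≤ lam * δ := by positivity
    linarith
  have b7 := mul_le_mul_of_nonneg_right b6 (show 0 ≤ m * (lam * γ) by positivity)
  have b8 := mul_le_mul_of_nonneg_right (show 1 - c₁ ≤ 1 by linarith)
    (show 0 ≤ m * (lam * γ) by positivity)
  linarith
end

section
/- Let A ∈ ℝ^{m×n} be non-degenerate, let w, w' ∈ ℝ^m be entrywise positive with w' ≈_γ w for some γ > 0, and let v ∈ ℝ^m be entrywise nonnegative. Then ‖v‖_{P⁽²⁾(W'A)} ≤ e^{4γ}·‖v‖_{P⁽²⁾(WA)}. -/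
open Matrix

/-- The orthogonal projection matrix `P(B) = B(BᵀB)⁻¹Bᵀ` onto the image of `B`. -/
noncomputable def projMat {m n : ℕ} (B : Matrix (Fin m) (Fin n) ℝ) :
    Matrix (Fin m) (Fin m) ℝ :=
  B * (Bᵀ * B)⁻¹ * Bᵀ

/-- The entrywise (Hadamard) square `P⁽²⁾(B) = P(B) ∘ P(B)`. -/
noncomputable def projSq {m n : ℕ} (B : Matrix (Fin m) (Fin n) ℝ) :
    Matrix (Fin m) (Fin m) ℝ :=
  Matrix.hadamard (projMat B) (projMat B)

namespace Matrix

variable {ι κ : Type*}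

section WeightedGram

variable [Fintype κ] [DecidableEq κ]

/-- The Gram matrix `Aᵀ diag(u) A` of `A` with row weights `u`. -/
def weightedGram (A : Matrix κ ι ℝ) (u : κ → ℝ) : Matrix ι ι ℝ :=
  Aᵀ * diagonal u * A

theorem weightedGram_smul (A : Matrix κ ι ℝ) (c : ℝ) (u : κ → ℝ) :
    weightedGram A (c • u) = c • weightedGram A u := by
  simp [weightedGram, diagonal_smul]

theorem weightedGram_sub (A : Matrix κ ι ℝ) (u v : κ → ℝ) :
    weightedGram A (u - v) = weightedGram A u - weightedGram A v := by
  rw [weightedGram, show diagonal (u - v) = diagonal u - diagonal v from (diagonal_sub u v).symm,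
    Matrix.mul_sub, Matrix.sub_mul, weightedGram, weightedGram]

variable [Fintype ι]

theorem posSemidef_weightedGram (A : Matrix κ ι ℝ) {u : κ → ℝ} (hu : 0 ≤ u) :
    (weightedGram A u).PosSemidef := by
  simpa [weightedGram] using (PosSemidef.diagonal hu).conjTranspose_mul_mul_same A

theorem posDef_weightedGram {A : Matrix κ ι ℝ} (hA : Function.Injective A.mulVec) {u : κ → ℝ}
    (hu : ∀ i, 0 < u i) : (weightedGram A u).PosDef := by
  simpa [weightedGram] using (PosDef.diagonal hu).conjTranspose_mul_mul_same hA

end WeightedGram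

variable [Fintype ι]

theorem mulVec_injective_of_rank_eq_card {A : Matrix κ ι ℝ} (hA : A.rank = Fintype.card ι) :
    Function.Injective A.mulVec := by
  have h := A.mulVecLin.finrank_range_add_finrank_ker
  rw [Module.finrank_fintype_fun_eq_card] at h
  have hk : Module.finrank ℝ (LinearMap.ker A.mulVecLin) = 0 := by
    rw [Matrix.rank] at hA; omega
  exact LinearMap.ker_eq_bot.mp (Submodule.finrank_eq_zero.mp hk)

variable [DecidableEq ι]

/-- The trace of a product of two positive semidefinite real matrices is nonnegative. -/
theorem PosSemidef.trace_mul_nonneg {X Y : Matrix ι ι ℝ} (hX : X.PosSemidef)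
    (hY : Y.PosSemidef) : 0 ≤ (X * Y).trace := by
  open scoped MatrixOrder in
  obtain ⟨C, rfl⟩ := CStarAlgebra.nonneg_iff_eq_star_mul_self.mp hX.nonneg
  rw [star_eq_conjTranspose, Matrix.mul_assoc, trace_mul_comm]
  exact (hY.mul_mul_conjTranspose_same C).trace_nonneg

/-- Matrix inversion is antitone on positive definite matrices. -/
theorem PosDef.posSemidef_inv_sub_inv {P Q : Matrix ι ι ℝ} (hP : P.PosDef) (hQ : Q.PosDef)
    (hPQ : (Q - P).PosSemidef) : (P⁻¹ - Q⁻¹).PosSemidef := by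
  have hPu : IsUnit P.det := (isUnit_iff_isUnit_det P).mp hP.isUnit
  have hQu : IsUnit Q.det := (isUnit_iff_isUnit_det Q).mp hQ.isUnit
  have hmid : ((Q - P) + (Q - P) * P⁻¹ * (Q - P)ᴴ).PosSemidef :=
    hPQ.add (hP.inv.posSemidef.mul_mul_conjTranspose_same (Q - P))
  have h := hmid.mul_mul_conjTranspose_same Q⁻¹
  have hexp : (Q - P) + (Q - P) * P⁻¹ * (Q - P) = Q * P⁻¹ * Q - Q := by
    simp only [Matrix.sub_mul, Matrix.mul_sub, Matrix.mul_nonsing_inv P hPu,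
      Matrix.nonsing_inv_mul_cancel_right _ Q hPu, Matrix.one_mul, Matrix.mul_assoc]
    abel
  rw [hPQ.isHermitian.eq, hQ.inv.isHermitian.eq, hexp, Matrix.mul_sub, Matrix.sub_mul,
    Matrix.nonsing_inv_mul Q hQu, Matrix.one_mul, ← Matrix.mul_assoc, ← Matrix.mul_assoc,
    Matrix.nonsing_inv_mul Q hQu, Matrix.one_mul, Matrix.mul_nonsing_inv_cancel_right _ _ hQu] at h
  exact h

/-- `X ↦ tr (X N X N)` is monotone on positive semidefinite matrices. -/
theorem PosSemidef.trace_mul_mul_mul_mono {X Y N : Matrix ι ι ℝ} (hX : X.PosSemidef)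
    (hY : Y.PosSemidef) (hN : N.PosSemidef) (hYX : (X - Y).PosSemidef) :
    (Y * N * Y * N).trace ≤ (X * N * X * N).trace := by
  have key := hYX.trace_mul_nonneg ((hX.add hY).mul_mul_conjTranspose_same N)
  have hcomm : (X * N * Y * N).trace = (Y * N * X * N).trace := by
    rw [Matrix.mul_assoc (X * N), trace_mul_comm, ← Matrix.mul_assoc]
  rw [hN.isHermitian.eq] at key
  simp only [Matrix.mul_add, Matrix.sub_mul, Matrix.add_mul, trace_add, trace_sub,
    ← Matrix.mul_assoc] at key
  linarith

variable [Fintype κ] [DecidableEq κ]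

/-- `tr ((G⁻¹ H)²)` for the weighted Gram matrices `G = Aᵀ diag(u) A`, `H = Aᵀ diag(z) A`. -/
noncomputable def gramRatioTrace (A : Matrix κ ι ℝ) (u z : κ → ℝ) : ℝ :=
  ((weightedGram A u)⁻¹ * weightedGram A z * (weightedGram A u)⁻¹ * weightedGram A z).trace

theorem gramRatioTrace_anti_left {A : Matrix κ ι ℝ} (hA : Function.Injective A.mulVec)
    {u u' z : κ → ℝ} (hu : ∀ i, 0 < u i) (huu' : u ≤ u') (hz : 0 ≤ z) :
    gramRatioTrace A u' z ≤ gramRatioTrace A u z := by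
  have hG := posDef_weightedGram hA hu
  have hG' := posDef_weightedGram hA fun i => (hu i).trans_le (huu' i)
  refine hG.inv.posSemidef.trace_mul_mul_mul_mono hG'.inv.posSemidef
    (posSemidef_weightedGram A hz) (hG.posSemidef_inv_sub_inv hG' ?_)
  rw [← weightedGram_sub]
  exact posSemidef_weightedGram A (sub_nonneg.mpr huu')

theorem gramRatioTrace_mono_right {A : Matrix κ ι ℝ} (hA : Function.Injective A.mulVec)
    {u z z' : κ → ℝ} (hu : ∀ i, 0 < u i) (hz : 0 ≤ z) (hzz' : z ≤ z') :
    gramRatioTrace A u z ≤ gramRatioTrace A u z' := by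
  have h := (posSemidef_weightedGram A (hz.trans hzz')).trace_mul_mul_mul_mono
    (posSemidef_weightedGram A hz) (posDef_weightedGram hA hu).inv.posSemidef
    (by rw [← weightedGram_sub]; exact posSemidef_weightedGram A (sub_nonneg.mpr hzz'))
  have hcycle (X N : Matrix ι ι ℝ) : (X * N * X * N).trace = (N * X * N * X).trace := by
    rw [trace_mul_comm]
    simp only [Matrix.mul_assoc]
  rw [gramRatioTrace, hcycle, gramRatioTrace, hcycle _ (weightedGram A z')]
  exact h

theorem gramRatioTrace_smul_smul {A : Matrix κ ι ℝ} (hA : Function.Injective A.mulVec)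
    {u : κ → ℝ} (hu : ∀ i, 0 < u i) (z : κ → ℝ) {c : ℝ} (hc : c ≠ 0) (d : ℝ) :
    gramRatioTrace A (c⁻¹ • u) (d • z) = (c * d) ^ 2 * gramRatioTrace A u z := by
  have hG := (posDef_weightedGram hA hu).isUnit
  have hinv : (c⁻¹ • weightedGram A u)⁻¹ = c • (weightedGram A u)⁻¹ := by
    refine inv_eq_left_inv ?_
    rw [Matrix.smul_mul, Matrix.mul_smul, smul_smul, mul_inv_cancel₀ hc, one_smul,
      nonsing_inv_mul _ ((isUnit_iff_isUnit_det _).mp hG)]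
  simp only [gramRatioTrace, weightedGram_smul, hinv, Matrix.smul_mul, Matrix.mul_smul,
    trace_smul, smul_eq_mul]
  ring

end Matrix

theorem dotProduct_projSq_mulVec {m n : ℕ} (A : Matrix (Fin m) (Fin n) ℝ) (w v : Fin m → ℝ) :
    v ⬝ᵥ (projSq (Matrix.diagonal w * A) *ᵥ v) = gramRatioTrace A (w ^ 2) (v * w ^ 2) := by
  set B := Matrix.diagonal w * A with hB
  have hgram (z : Fin m → ℝ) : Bᵀ * diagonal z * B = weightedGram A (z * w ^ 2) := by
    rw [hB, weightedGram, transpose_mul, diagonal_transpose]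
    simp only [← Matrix.mul_assoc]
    rw [Matrix.mul_assoc Aᵀ, Matrix.mul_assoc Aᵀ, diagonal_mul_diagonal, diagonal_mul_diagonal]
    congr 3
    ext i
    simp; ring
  have hone : Bᵀ * B = weightedGram A (w ^ 2) := by
    simpa [show diagonal (1 : Fin m → ℝ) = 1 from diagonal_one] using hgram 1
  have hsymm : (projMat B)ᵀ = projMat B := by
    simp [projMat, transpose_mul, transpose_nonsing_inv, Matrix.mul_assoc]
  have htrace : v ⬝ᵥ (projSq B *ᵥ v)
      = (diagonal v * projMat B * diagonal v * projMat B).trace := by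
    rw [Matrix.mul_assoc (diagonal v * projMat B)]
    simp only [trace, diag_apply, mul_apply (M := diagonal v * projMat B), diagonal_mul,
      dotProduct, mulVec, projSq, hadamard_apply, Finset.mul_sum]
    refine Finset.sum_congr rfl fun i _ => Finset.sum_congr rfl fun j _ => ?_
    have hij : projMat B j i = projMat B i j := congrFun₂ hsymm i j
    rw [hij]; ring
  have hfactor : diagonal v * projMat B * diagonal v * projMat B
      = diagonal v * B * ((Bᵀ * B)⁻¹ * Bᵀ * diagonal v * B * (Bᵀ * B)⁻¹ * Bᵀ) := by
    simp only [projMat, Matrix.mul_assoc]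
  rw [htrace, hfactor, trace_mul_comm, gramRatioTrace, ← hone, ← hgram]
  simp only [Matrix.mul_assoc]

/-- **Stability of `P⁽²⁾` under reweighting.**  For non-degenerate `A`, entrywise positive
weights `w' ≈_γ w`, and any entrywise nonnegative vector `v`,
`‖v‖_{P⁽²⁾(W'A)} ≤ e^{4γ} ‖v‖_{P⁽²⁾(WA)}`. -/
theorem p2_stability {m n : ℕ}
    (A : Matrix (Fin m) (Fin n) ℝ) (hrank : A.rank = n) (hrows : ∀ i, A i ≠ 0)
    (w w' : Fin m → ℝ) (hw : ∀ i, 0 < w i) (hw' : ∀ i, 0 < w' i)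
    (γ : ℝ) (hγ : 0 < γ)
    (happrox : ∀ i, Real.exp (-γ) * w i ≤ w' i ∧ w' i ≤ Real.exp γ * w i)
    (v : Fin m → ℝ) (hv : ∀ i, 0 ≤ v i) :
    Real.sqrt (v ⬝ᵥ (projSq (Matrix.diagonal w' * A) *ᵥ v)) ≤
      Real.exp (4 * γ) * Real.sqrt (v ⬝ᵥ (projSq (Matrix.diagonal w * A) *ᵥ v)) := by
  have hA : Function.Injective A.mulVec :=
    mulVec_injective_of_rank_eq_card (hrank.trans (Fintype.card_fin n).symm)
  have hc : 0 < Real.exp (2 * γ) := Real.exp_pos _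
  have hlow (i : Fin m) : (Real.exp (2 * γ))⁻¹ * w i ^ 2 ≤ w' i ^ 2 := by
    have h := pow_le_pow_left₀ (mul_pos (Real.exp_pos _) (hw i)).le (happrox i).1 2
    rwa [mul_pow, ← Real.exp_nat_mul, Nat.cast_ofNat, mul_neg, Real.exp_neg] at h
  have hupp (i : Fin m) : w' i ^ 2 ≤ Real.exp (2 * γ) * w i ^ 2 := by
    have h := pow_le_pow_left₀ (hw' i).le (happrox i).2 2
    rwa [mul_pow, ← Real.exp_nat_mul, Nat.cast_ofNat] at h
  have hw2 (i : Fin m) : 0 < (w ^ 2) i := pow_pos (hw i) 2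
  have hlowpos (i : Fin m) : 0 < ((Real.exp (2 * γ))⁻¹ • w ^ 2) i :=
    mul_pos (inv_pos.mpr hc) (hw2 i)
  have hz : 0 ≤ v * w' ^ 2 := fun i => mul_nonneg (hv i) (sq_nonneg _)
  have hzz : v * w' ^ 2 ≤ Real.exp (2 * γ) • (v * w ^ 2) := fun i => by
    simpa [mul_left_comm] using mul_le_mul_of_nonneg_left (hupp i) (hv i)
  have hexp : Real.exp (2 * γ) * Real.exp (2 * γ) = Real.exp (4 * γ) := by
    rw [← Real.exp_add]
    ring_nf
  rw [dotProduct_projSq_mulVec, dotProduct_projSq_mulVec,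
    ← Real.sqrt_sq (Real.exp_pos (4 * γ)).le, ← Real.sqrt_mul (sq_nonneg _)]
  refine Real.sqrt_le_sqrt ?_
  calc gramRatioTrace A (w' ^ 2) (v * w' ^ 2)
      ≤ gramRatioTrace A ((Real.exp (2 * γ))⁻¹ • w ^ 2) (v * w' ^ 2) :=
        gramRatioTrace_anti_left hA hlowpos hlow hz
    _ ≤ gramRatioTrace A ((Real.exp (2 * γ))⁻¹ • w ^ 2) (Real.exp (2 * γ) • (v * w ^ 2)) :=
        gramRatioTrace_mono_right hA hlowpos hz hzz
    _ = Real.exp (4 * γ) ^ 2 * gramRatioTrace A (w ^ 2) (v * w ^ 2) := by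
        rw [gramRatioTrace_smul_smul hA hw2 _ hc.ne', hexp]
end

section
/- Let A ∈ ℝ^{m×n} be non-degenerate and let w, w' ∈ ℝ^m be entrywise positive with w' ≈_γ w for some 0 ≤ γ ≤ 1/80. Then σ(W'A) ≈_{4γ} σ(WA) entrywise. Consequently, for any entrywise-positive η ∈ ℝ^m, setting τ := σ(WA) + η, τ' := σ(W'A) + η, and T := diag(τ), one has ‖T⁻¹(τ' − τ)‖_∞ ≤ 5γ. -/
open Matrix

/-- The leverage scores `σ(B)ᵢ = P(B)ᵢᵢ`. -/
noncomputable def lev {m n : ℕ} (B : Matrix (Fin m) (Fin n) ℝ) (i : Fin m) : ℝ :=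
  projMat B i i

/-- If `c • M ≤ N` as quadratic forms, then `c • N⁻¹ ≤ M⁻¹`. -/
lemma dotProduct_inv_mulVec_le {n : ℕ} {M N : Matrix (Fin n) (Fin n) ℝ}
    (hM : M.PosDef) (hN : N.PosDef) {c : ℝ} (hc : 0 ≤ c)
    (h : ∀ x, c * (x ⬝ᵥ M *ᵥ x) ≤ x ⬝ᵥ N *ᵥ x) (a : Fin n → ℝ) :
    c * (a ⬝ᵥ N⁻¹ *ᵥ a) ≤ a ⬝ᵥ M⁻¹ *ᵥ a := by
  set x := M⁻¹ *ᵥ a with hx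
  set y := N⁻¹ *ᵥ a with hy
  have hMx : M *ᵥ x = a := by
    rw [hx, mulVec_mulVec, mul_nonsing_inv _ hM.det_pos.ne'.isUnit, one_mulVec]
  have hNy : N *ᵥ y = a := by
    rw [hy, mulVec_mulVec, mul_nonsing_inv _ hN.det_pos.ne'.isUnit, one_mulVec]
  have hMt : Mᵀ = M := by simpa using hM.isHermitian.eq
  have hxy : x ⬝ᵥ M *ᵥ y = y ⬝ᵥ a := by
    rw [dotProduct_mulVec, ← mulVec_transpose, hMt, hMx, dotProduct_comm]
  have hnonneg : 0 ≤ (c • y - x) ⬝ᵥ M *ᵥ (c • y - x) := by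
    simpa using hM.posSemidef.dotProduct_mulVec_nonneg (c • y - x)
  have hcy := h y
  rw [hNy] at hcy
  simp only [mulVec_sub, mulVec_smul, sub_dotProduct, dotProduct_sub, smul_dotProduct,
    dotProduct_smul, smul_eq_mul, hMx, hxy] at hnonneg
  rw [dotProduct_comm a y, dotProduct_comm a x]
  nlinarith [mul_le_mul_of_nonneg_left hcy hc]

lemma dotProduct_gram_mulVec {m n : ℕ} (B : Matrix (Fin m) (Fin n) ℝ) (x : Fin n → ℝ) :
    x ⬝ᵥ (Bᵀ * B) *ᵥ x = ∑ i, (B *ᵥ x) i ^ 2 := by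
  rw [← mulVec_mulVec, dotProduct_mulVec, vecMul_transpose]
  simp [dotProduct, sq]

lemma posDef_gram_diagonal_mul {m n : ℕ} {A : Matrix (Fin m) (Fin n) ℝ} (hrank : A.rank = n)
    {w : Fin m → ℝ} (hw : ∀ i, 0 < w i) :
    ((diagonal w * A)ᵀ * (diagonal w * A)).PosDef := by
  have hA : Function.Injective A.mulVec := by
    rw [mulVec_injective_iff, linearIndependent_iff_card_eq_finrank_span, Set.finrank,
      ← rank_eq_finrank_span_cols, hrank, Fintype.card_fin]
  have hD : Function.Injective (diagonal w * A).mulVec := by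
    intro x y hxy
    apply hA
    funext i
    have hi := congrFun hxy i
    simp only [← mulVec_mulVec, mulVec_diagonal] at hi
    exact mul_left_cancel₀ (hw i).ne' hi
  simpa using PosDef.conjTranspose_mul_self (diagonal w * A) hD

lemma lev_eq_dotProduct {m n : ℕ} (B : Matrix (Fin m) (Fin n) ℝ) (i : Fin m) :
    lev B i = B i ⬝ᵥ (Bᵀ * B)⁻¹ *ᵥ B i := by
  rw [lev, projMat, mul_apply', dotProduct_mulVec]
  rfl

lemma lev_diagonal_mul {m n : ℕ} (A : Matrix (Fin m) (Fin n) ℝ) (w : Fin m → ℝ) (i : Fin m) :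
    lev (diagonal w * A) i =
      w i ^ 2 * (A i ⬝ᵥ ((diagonal w * A)ᵀ * (diagonal w * A))⁻¹ *ᵥ A i) := by
  have hrow : (diagonal w * A) i = w i • A i := by
    funext j
    simp [diagonal_mul]
  rw [lev_eq_dotProduct, hrow, mulVec_smul, smul_dotProduct, dotProduct_smul]
  simp only [smul_eq_mul]
  ring

lemma lev_nonneg {m n : ℕ} {A : Matrix (Fin m) (Fin n) ℝ} (hrank : A.rank = n)
    {w : Fin m → ℝ} (hw : ∀ i, 0 < w i) (i : Fin m) : 0 ≤ lev (diagonal w * A) i := by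
  rw [lev_eq_dotProduct]
  simpa using (posDef_gram_diagonal_mul hrank hw).inv.posSemidef.dotProduct_mulVec_nonneg
    ((diagonal w * A) i)

lemma lev_diagonal_mul_le {m n : ℕ} {A : Matrix (Fin m) (Fin n) ℝ} (hrank : A.rank = n)
    {w w' : Fin m → ℝ} (hw : ∀ i, 0 < w i) (hw' : ∀ i, 0 < w' i) {γ : ℝ}
    (hlow : ∀ i, Real.exp (-γ) * w i ≤ w' i) (hupp : ∀ i, w' i ≤ Real.exp γ * w i) (i : Fin m) :
    lev (diagonal w' * A) i ≤ Real.exp (4 * γ) * lev (diagonal w * A) i := by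
  have hM := posDef_gram_diagonal_mul hrank hw
  have hM' := posDef_gram_diagonal_mul hrank hw'
  have hform := dotProduct_inv_mulVec_le hM hM' (sq_nonneg (Real.exp (-γ))) (fun x => by
    rw [dotProduct_gram_mulVec, dotProduct_gram_mulVec, Finset.mul_sum]
    refine Finset.sum_le_sum fun j _ => ?_
    simp only [← mulVec_mulVec, mulVec_diagonal]
    rw [mul_pow, mul_pow, ← mul_assoc, ← mul_pow]
    exact mul_le_mul_of_nonneg_right
      (pow_le_pow_left₀ (mul_nonneg (Real.exp_pos _).le (hw j).le) (hlow j) 2)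
      (sq_nonneg _)) (A i)
  have hq' : 0 ≤ A i ⬝ᵥ ((diagonal w' * A)ᵀ * (diagonal w' * A))⁻¹ *ᵥ A i := by
    simpa using hM'.inv.posSemidef.dotProduct_mulVec_nonneg (A i)
  have hsq : w' i ^ 2 ≤ (Real.exp γ * w i) ^ 2 := pow_le_pow_left₀ (hw' i).le (hupp i) 2
  have hexp : Real.exp (4 * γ) * Real.exp (-γ) ^ 2 = Real.exp γ ^ 2 := by
    rw [← Real.exp_nat_mul, ← Real.exp_nat_mul, ← Real.exp_add]
    congr 1
    push_cast
    ring
  rw [lev_diagonal_mul, lev_diagonal_mul]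
  calc _ ≤ (Real.exp γ * w i) ^ 2 *
        (A i ⬝ᵥ ((diagonal w' * A)ᵀ * (diagonal w' * A))⁻¹ *ᵥ A i) := mul_le_mul_of_nonneg_right hsq hq'
    _ = Real.exp (4 * γ) * (w i ^ 2 * (Real.exp (-γ) ^ 2 *
        (A i ⬝ᵥ ((diagonal w' * A)ᵀ * (diagonal w' * A))⁻¹ *ᵥ A i))) := by
      rw [mul_pow, ← hexp]; ring
    _ ≤ _ := by gcongr

/-- **Stability of leverage scores.**  For non-degenerate `A` and entrywise positive
weights `w' ≈_γ w` with `0 ≤ γ ≤ 1/80`, one has `σ(W'A) ≈_{4γ} σ(WA)` entrywise, and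
consequently, for τ = σ(WA) + η, τ' = σ(W'A) + η with η entrywise positive,
`‖T⁻¹(τ' - τ)‖_∞ ≤ 5γ`. -/
theorem leverage_score_stability {m n : ℕ}
    (A : Matrix (Fin m) (Fin n) ℝ) (hrank : A.rank = n) (hrows : ∀ i, A i ≠ 0)
    (w w' : Fin m → ℝ) (hw : ∀ i, 0 < w i) (hw' : ∀ i, 0 < w' i)
    (γ : ℝ) (hγ0 : 0 ≤ γ) (hγ1 : γ ≤ 1 / 80)
    (happrox : ∀ i, Real.exp (-γ) * w i ≤ w' i ∧ w' i ≤ Real.exp γ * w i)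
    (η : Fin m → ℝ) (hη : ∀ i, 0 < η i) :
    (∀ i, Real.exp (-(4 * γ)) * lev (Matrix.diagonal w * A) i ≤ lev (Matrix.diagonal w' * A) i ∧
        lev (Matrix.diagonal w' * A) i ≤ Real.exp (4 * γ) * lev (Matrix.diagonal w * A) i) ∧
    ∀ i, |((lev (Matrix.diagonal w' * A) i + η i) - (lev (Matrix.diagonal w * A) i + η i)) /
        (lev (Matrix.diagonal w * A) i + η i)| ≤ 5 * γ := by
  have hupper := lev_diagonal_mul_le hrank hw hw' (fun i => (happrox i).1) fun i => (happrox i).2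
  have hlower := lev_diagonal_mul_le hrank hw' hw (γ := γ)
    (fun i => by
      rw [Real.exp_neg, inv_mul_le_iff₀ (Real.exp_pos γ)]
      exact (happrox i).2)
    (fun i => by
      have h := (happrox i).1
      rwa [Real.exp_neg, inv_mul_le_iff₀ (Real.exp_pos γ)] at h)
  have hlower' (i : Fin m) : Real.exp (-(4 * γ)) * lev (diagonal w * A) i ≤
      lev (diagonal w' * A) i := by
    rw [Real.exp_neg, inv_mul_le_iff₀ (Real.exp_pos _)]
    exact hlower i
  refine ⟨fun i => ⟨hlower' i, hupper i⟩, fun i => ?_⟩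
  have hσ := lev_nonneg hrank hw i
  have hτ : 0 < lev (diagonal w * A) i + η i := add_pos_of_nonneg_of_pos hσ (hη i)
  have hexp_le : Real.exp (4 * γ) ≤ 1 + 5 * γ := by
    have h := Real.exp_pos (4 * γ)
    have h1 : (1 - 4 * γ) * Real.exp (4 * γ) ≤ 1 := by
      have h2 := mul_le_mul_of_nonneg_right (Real.add_one_le_exp (-(4 * γ))) h.le
      rw [← Real.exp_add, neg_add_cancel, Real.exp_zero] at h2
      linarith
    nlinarith
  have hle_exp : 1 - 5 * γ ≤ Real.exp (-(4 * γ)) := by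
    linarith [Real.add_one_le_exp (-(4 * γ))]
  have hη_mul := mul_nonneg hγ0 (hη i).le
  rw [abs_div, abs_of_pos hτ, div_le_iff₀ hτ, abs_le]
  constructor
  · nlinarith [hlower' i, mul_le_mul_of_nonneg_right hle_exp hσ]
  · nlinarith [hupper i, mul_le_mul_of_nonneg_right hexp_le hσ]
end

section
/- Let A ∈ ℝ^{m×n} be non-degenerate, let δ ∈ ℝ^m, let k > 0, and let p ∈ (0,1]^m satisfy p_i ≥ min{1, k·σ(A)_i} for every i ∈ {1,…,m}. Let δ̃ ∈ ℝ^m be a random vector whose coordinates are independent, with δ̃_i = δ_i/p_i with probability p_i and δ̃_i = 0 otherwise. Then 𝔼[δ̃] = δ and 𝔼[ ‖δ̃‖²_{P⁽²⁾(A)} ] ≤ (1 + 1/k)·‖δ‖²_{σ(A)}. -/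
open Matrix Finset

/-- The independent-coordinates sampled vector: `δ̃(ω)ᵢ = δᵢ/pᵢ` if `ωᵢ` and `0` otherwise. -/
noncomputable def sampledVec {m : ℕ} (δ p : Fin m → ℝ) (ω : Fin m → Bool) (i : Fin m) : ℝ :=
  if ω i then δ i / p i else 0

/-- The probability of the outcome `ω` when each coordinate `i` is independently `true`
with probability `pᵢ`. -/
noncomputable def bernoulliWeight {m : ℕ} (p : Fin m → ℝ) (ω : Fin m → Bool) : ℝ :=
  ∏ j, if ω j then p j else 1 - p j

lemma projMat_transpose {m n : ℕ} (B : Matrix (Fin m) (Fin n) ℝ) : (projMat B)ᵀ = projMat B := by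
  simp only [projMat, transpose_mul, transpose_transpose, transpose_nonsing_inv, Matrix.mul_assoc]

lemma projMat_mul_self {m n : ℕ} (B : Matrix (Fin m) (Fin n) ℝ) :
    projMat B * projMat B = projMat B := by
  by_cases h : IsUnit (Bᵀ * B).det
  · calc projMat B * projMat B = B * ((Bᵀ * B)⁻¹ * (Bᵀ * B)) * (Bᵀ * B)⁻¹ * Bᵀ := by
          simp only [projMat, Matrix.mul_assoc]
      _ = projMat B := by rw [nonsing_inv_mul _ h, Matrix.mul_one, projMat]
  · simp [projMat, nonsing_inv_apply_not_isUnit _ h]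

lemma sum_projMat_sq {m n : ℕ} (B : Matrix (Fin m) (Fin n) ℝ) (i : Fin m) :
    ∑ j, projMat B i j ^ 2 = lev B i := by
  conv_rhs => rw [lev, ← projMat_mul_self, Matrix.mul_apply]
  refine sum_congr rfl fun j _ => ?_
  rw [sq, ← transpose_apply (projMat B) i j, projMat_transpose]

lemma lev_nonneg_s9 {m n : ℕ} (B : Matrix (Fin m) (Fin n) ℝ) (i : Fin m) : 0 ≤ lev B i := by
  rw [← sum_projMat_sq]
  exact sum_nonneg fun j _ => sq_nonneg _

/-- The quadratic form of `P⁽²⁾(B)` is dominated by the diagonal form of the leverage scores. -/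
lemma sum_projSq_le {m n : ℕ} (B : Matrix (Fin m) (Fin n) ℝ) (δ : Fin m → ℝ) :
    ∑ i, ∑ j, projSq B i j * (δ i * δ j) ≤ ∑ i, lev B i * δ i ^ 2 := by
  have hsymm : ∑ i, ∑ j, projMat B i j ^ 2 * δ j ^ 2 = ∑ i, ∑ j, projMat B i j ^ 2 * δ i ^ 2 := by
    rw [sum_comm]
    refine sum_congr rfl fun i _ => sum_congr rfl fun j _ => ?_
    rw [← transpose_apply (projMat B) i j, projMat_transpose]
  calc ∑ i, ∑ j, projSq B i j * (δ i * δ j)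
      ≤ ∑ i, ∑ j, (projMat B i j ^ 2 * δ i ^ 2 + projMat B i j ^ 2 * δ j ^ 2) / 2 := by
        refine sum_le_sum fun i _ => sum_le_sum fun j _ => ?_
        rw [projSq, hadamard_apply]
        nlinarith [mul_nonneg (sq_nonneg (projMat B i j)) (sq_nonneg (δ i - δ j))]
    _ = ∑ i, lev B i * δ i ^ 2 := by
        simp only [← sum_div, sum_add_distrib]
        rw [hsymm, add_self_div_two]
        simp only [← sum_mul, sum_projMat_sq]

/-- Expectations of products of functions of the coordinates factor. -/
lemma sum_bernoulliWeight_mul_prod {m : ℕ} (p : Fin m → ℝ) (g : Fin m → Bool → ℝ) :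
    ∑ ω : Fin m → Bool, bernoulliWeight p ω * ∏ j, g j (ω j) =
      ∏ j, (p j * g j true + (1 - p j) * g j false) := by
  have h := Fintype.prod_sum fun (j : Fin m) (b : Bool) => (if b then p j else 1 - p j) * g j b
  simp only [Fintype.sum_bool, if_true, Bool.false_eq_true, if_false] at h
  rw [h]
  simp only [bernoulliWeight, prod_mul_distrib]

lemma sum_bernoulliWeight_mul_sampledVec {m : ℕ} (δ p : Fin m → ℝ) (hp : ∀ i, p i ≠ 0)
    (i : Fin m) : ∑ ω : Fin m → Bool, bernoulliWeight p ω * sampledVec δ p ω i = δ i := by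
  have h := sum_bernoulliWeight_mul_prod p
    fun l b => if l = i then (if b then δ l / p l else 0) else 1
  simp only [prod_ite_eq', mem_univ, if_true] at h
  simp only [sampledVec]
  rw [h, prod_eq_single_of_mem i (mem_univ i) fun l _ hl => by simp [hl]]
  simp [mul_div_cancel₀, hp i]

lemma sum_bernoulliWeight_mul_sampledVec_mul {m : ℕ} (δ p : Fin m → ℝ) (hp : ∀ i, p i ≠ 0)
    (i j : Fin m) :
    ∑ ω : Fin m → Bool, bernoulliWeight p ω * (sampledVec δ p ω i * sampledVec δ p ω j) =
      δ i * δ j + if i = j then δ i ^ 2 * (1 / p i - 1) else 0 := by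
  have h := sum_bernoulliWeight_mul_prod p fun l b =>
    (if l = i then (if b then δ l / p l else 0) else 1) *
      (if l = j then (if b then δ l / p l else 0) else 1)
  simp only [prod_mul_distrib, prod_ite_eq', mem_univ, if_true] at h
  simp only [sampledVec]
  rw [h]
  have hi := hp i
  by_cases hij : i = j
  · subst hij
    rw [prod_eq_single_of_mem i (mem_univ i) fun l _ hl => by simp [hl]]
    simp only [if_true, Bool.false_eq_true, if_false]
    field_simp
    ring
  · have hj := hp j
    rw [prod_eq_mul_of_mem i j (mem_univ i) (mem_univ j) hij fun l _ hl => by simp [hl.1, hl.2]]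
    simp only [hij, Ne.symm hij, if_true, Bool.false_eq_true, if_false]
    field_simp
    ring

/-- The second moment of the sampled vector in a quadratic form splits into the form at the mean
plus the variances of the coordinates. -/
lemma sum_bernoulliWeight_mul_quadForm {m : ℕ} (M : Matrix (Fin m) (Fin m) ℝ) (δ p : Fin m → ℝ)
    (hp : ∀ i, p i ≠ 0) :
    ∑ ω : Fin m → Bool, bernoulliWeight p ω * (sampledVec δ p ω ⬝ᵥ (M *ᵥ sampledVec δ p ω)) =
      ∑ i, ∑ j, M i j * (δ i * δ j) + ∑ i, M i i * (δ i ^ 2 * (1 / p i - 1)) := by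
  calc ∑ ω : Fin m → Bool, bernoulliWeight p ω * (sampledVec δ p ω ⬝ᵥ (M *ᵥ sampledVec δ p ω))
      = ∑ ω : Fin m → Bool, ∑ i, ∑ j,
          M i j * (bernoulliWeight p ω * (sampledVec δ p ω i * sampledVec δ p ω j)) := by
        simp only [dotProduct, mulVec, mul_sum]
        refine sum_congr rfl fun ω _ => sum_congr rfl fun i _ => sum_congr rfl fun j _ => ?_
        ring
    _ = ∑ i, ∑ j, M i j * ∑ ω : Fin m → Bool,
          bernoulliWeight p ω * (sampledVec δ p ω i * sampledVec δ p ω j) := by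
        rw [sum_comm]
        refine sum_congr rfl fun i _ => ?_
        rw [sum_comm]
        simp only [mul_sum]
    _ = _ := by
        simp only [sum_bernoulliWeight_mul_sampledVec_mul δ p hp, mul_add, sum_add_distrib,
          mul_ite, mul_zero, sum_ite_eq, mem_univ, if_true]

lemma sq_mul_one_div_sub_one_le {s k p : ℝ} (hs : 0 ≤ s) (hk : 0 < k) (hp : 0 < p)
    (hle : min 1 (k * s) ≤ p) : s ^ 2 * (1 / p - 1) ≤ 1 / k * s := by
  rcases min_le_iff.1 hle with h | h
  · have h1 : 1 / p - 1 ≤ 0 := sub_nonpos.2 ((div_le_one hp).2 h)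
    exact (mul_nonpos_of_nonneg_of_nonpos (sq_nonneg s) h1).trans (by positivity)
  · have h1 : s ^ 2 * (1 / p) ≤ 1 / k * s := by
      rw [mul_one_div, one_div_mul_eq_div, div_le_div_iff₀ hp hk]
      nlinarith
    nlinarith [sq_nonneg s]

/-- **Leverage-score sampling (Lemma `P2sample`).**  If `δ̃` has independent coordinates with
`δ̃ᵢ = δᵢ/pᵢ` with probability `pᵢ ≥ min{1, k·σ(A)ᵢ}` and `δ̃ᵢ = 0` otherwise, then
`𝔼[δ̃] = δ` and `𝔼[‖δ̃‖²_{P⁽²⁾(A)}] ≤ (1 + 1/k)·‖δ‖²_{σ(A)}`. -/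
theorem leverage_score_sampling {m n : ℕ}
    (A : Matrix (Fin m) (Fin n) ℝ) (hrank : A.rank = n) (hrows : ∀ i, A i ≠ 0)
    (δ : Fin m → ℝ) (k : ℝ) (hk : 0 < k)
    (p : Fin m → ℝ) (hp : ∀ i, 0 < p i ∧ p i ≤ 1)
    (hpk : ∀ i, min 1 (k * lev A i) ≤ p i) :
    (∀ i, ∑ ω : Fin m → Bool, bernoulliWeight p ω * sampledVec δ p ω i = δ i) ∧
    ∑ ω : Fin m → Bool,
        bernoulliWeight p ω * (sampledVec δ p ω ⬝ᵥ (projSq A *ᵥ sampledVec δ p ω)) ≤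
      (1 + 1 / k) * ∑ i, lev A i * δ i ^ 2 := by
  have hp0 : ∀ i, p i ≠ 0 := fun i => (hp i).1.ne'
  refine ⟨sum_bernoulliWeight_mul_sampledVec δ p hp0, ?_⟩
  rw [sum_bernoulliWeight_mul_quadForm _ δ p hp0, add_mul, one_mul, mul_sum]
  refine add_le_add (sum_projSq_le A δ) (sum_le_sum fun i _ => ?_)
  have h := mul_le_mul_of_nonneg_right
    (sq_mul_one_div_sub_one_le (lev_nonneg_s9 A i) hk (hp i).1 (hpk i)) (sq_nonneg (δ i))
  calc projSq A i i * (δ i ^ 2 * (1 / p i - 1))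
      = lev A i ^ 2 * (1 / p i - 1) * δ i ^ 2 := by
        rw [projSq, hadamard_apply, lev]
        ring
    _ ≤ 1 / k * lev A i * δ i ^ 2 := h
    _ = 1 / k * (lev A i * δ i ^ 2) := mul_assoc _ _ _
end

section
/- Let A ∈ ℝ^{m×n} be non-degenerate, b ∈ ℝ^n, μ > 0, and let 0 < ε ≤ 1/80 and 0 < γ ≤ ε. Let x, s, x̄, s̄ ∈ ℝ^m be entrywise positive with x̄ ≈_ε x, s̄ ≈_ε s, and xs ≈_ε μ·𝟙 entrywise, and suppose ‖Aᵀx − b‖_{(AᵀXS⁻¹A)⁻¹} ≤ εγ√μ. Set Ā := X̄^{1/2}S̄^{−1/2}A, w̄ := x̄s̄/μ, W̄ := diag(w̄), and let H̄ be any symmetric positive definite matrix with H̄ ≈_γ ĀᵀĀ. For any g ∈ ℝ^m with ‖g‖₂ = γ, define δ_p := W̄^{−1/2}ĀH̄⁻¹ĀᵀW̄^{1/2}g and δ_c := μ^{−1/2}·W̄^{−1/2}ĀH̄⁻¹(Aᵀx − b). Then ‖δ_p‖₂ ≤ e^{4ε}·γ and ‖δ_c‖₂ ≤ ε·e^{4ε}·γ.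 -/
open Matrix Finset

theorem dotProduct_sq_le {ι : Type*} [Fintype ι] (p q : ι → ℝ) :
    (p ⬝ᵥ q) ^ 2 ≤ (p ⬝ᵥ p) * (q ⬝ᵥ q) := by
  have h := Finset.sum_mul_sq_le_sq_mul_sq Finset.univ p q
  simpa only [dotProduct, sq] using h

theorem dotProduct_self_nonneg' {ι : Type*} [Fintype ι] (p : ι → ℝ) : 0 ≤ p ⬝ᵥ p :=
  Finset.sum_nonneg fun i _ => mul_self_nonneg (p i)

theorem diagonal_mulVec_dotProduct_self_le {ι : Type*} [Fintype ι] [DecidableEq ι]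
    (d v : ι → ℝ) (C : ℝ) (hd : ∀ i, d i ^ 2 ≤ C) :
    (diagonal d *ᵥ v) ⬝ᵥ (diagonal d *ᵥ v) ≤ C * (v ⬝ᵥ v) := by
  simp only [dotProduct, mulVec_diagonal, Finset.mul_sum]
  refine Finset.sum_le_sum fun i _ => ?_
  nlinarith [mul_le_mul_of_nonneg_right (hd i) (sq_nonneg (v i))]

theorem mulVec_dotProduct_mulVec {m n : Type*} [Fintype m] [Fintype n]
    (B : Matrix m n ℝ) (u v : n → ℝ) :
    (B *ᵥ u) ⬝ᵥ (B *ᵥ v) = u ⬝ᵥ ((Bᵀ * B) *ᵥ v) := by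
  rw [← mulVec_mulVec, dotProduct_mulVec u, vecMul_transpose]

/-- If `c • BᵀB ⪯ H` and `⟨H⁻¹r, r⟩² ≤ K ‖B H⁻¹ r‖²`, then `‖B H⁻¹ r‖² ≤ c⁻² K`. -/
theorem mulVec_inv_mulVec_dotProduct_self_le {m n : Type*} [Fintype m] [Fintype n]
    [DecidableEq n] (B : Matrix m n ℝ) (H : Matrix n n ℝ) (hH : H.PosDef) (c K : ℝ)
    (hc : 0 < c) (hK : 0 ≤ K) (hBH : (H - c • (Bᵀ * B)).PosSemidef) (r : n → ℝ)
    (hr : ((H⁻¹ *ᵥ r) ⬝ᵥ r) ^ 2 ≤ K * ((B *ᵥ (H⁻¹ *ᵥ r)) ⬝ᵥ (B *ᵥ (H⁻¹ *ᵥ r)))) :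
    c ^ 2 * ((B *ᵥ (H⁻¹ *ᵥ r)) ⬝ᵥ (B *ᵥ (H⁻¹ *ᵥ r))) ≤ K := by
  have hHr : H *ᵥ (H⁻¹ *ᵥ r) = r := by
    rw [mulVec_mulVec, mul_nonsing_inv _ ((isUnit_iff_isUnit_det _).mp hH.isUnit), one_mulVec]
  set u := H⁻¹ *ᵥ r
  have h := hBH.dotProduct_mulVec_nonneg u
  rw [star_trivial, sub_mulVec, dotProduct_sub, hHr, smul_mulVec, dotProduct_smul,
    ← mulVec_dotProduct_mulVec, smul_eq_mul] at h
  have hP := dotProduct_self_nonneg' (B *ᵥ u)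
  set P := (B *ᵥ u) ⬝ᵥ (B *ᵥ u)
  rcases hP.eq_or_lt with h0 | h0
  · simpa [← h0] using hK
  · have h1 : (c * P) ^ 2 ≤ (u ⬝ᵥ r) ^ 2 := pow_le_pow_left₀ (by positivity) (by linarith) 2
    refine le_of_mul_le_mul_right ?_ h0
    nlinarith

theorem mulVec_injective_of_rank_eq {m n : ℕ} (A : Matrix (Fin m) (Fin n) ℝ)
    (h : A.rank = n) : Function.Injective A.mulVec := by
  rw [mulVec_injective_iff, linearIndependent_iff_card_eq_finrank_span, Set.finrank,
    ← rank_eq_finrank_span_cols, h, Fintype.card_fin]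

/-- **Basic step-size bounds (log-barrier short step).**  Under `ε`-centering and
approximate primal feasibility, the projected step `δ_p` and the correction step `δ_c`
satisfy `‖δ_p‖₂ ≤ e^{4ε}γ` and `‖δ_c‖₂ ≤ ε e^{4ε}γ`. -/
theorem projection_sizes
    {m n : ℕ} (A : Matrix (Fin m) (Fin n) ℝ) (hrank : A.rank = n) (hrows : ∀ i, A i ≠ 0)
    (b : Fin n → ℝ) (μ : ℝ) (hμ : 0 < μ)
    (ε γ : ℝ) (hε0 : 0 < ε) (hε1 : ε ≤ 1 / 80) (hγ0 : 0 < γ) (hγ1 : γ ≤ ε)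
    (x s xb sb : Fin m → ℝ)
    (hx : ∀ i, 0 < x i) (hs : ∀ i, 0 < s i) (hxb : ∀ i, 0 < xb i) (hsb : ∀ i, 0 < sb i)
    (hxa : ∀ i, Real.exp (-ε) * x i ≤ xb i ∧ xb i ≤ Real.exp ε * x i)
    (hsa : ∀ i, Real.exp (-ε) * s i ≤ sb i ∧ sb i ≤ Real.exp ε * s i)
    (hcenter : ∀ i, Real.exp (-ε) * μ ≤ x i * s i ∧ x i * s i ≤ Real.exp ε * μ)
    (hfeas : Real.sqrt ((Aᵀ *ᵥ x - b) ⬝ᵥ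
        ((Aᵀ * Matrix.diagonal (fun i => x i / s i) * A)⁻¹ *ᵥ (Aᵀ *ᵥ x - b))) ≤
      ε * γ * Real.sqrt μ)
    (Ab : Matrix (Fin m) (Fin n) ℝ)
    (hAb : Ab = Matrix.diagonal (fun i => Real.sqrt (xb i / sb i)) * A)
    (wb : Fin m → ℝ) (hwb : ∀ i, wb i = xb i * sb i / μ)
    (Hb : Matrix (Fin n) (Fin n) ℝ) (hHbpd : Hb.PosDef)
    (hHb1 : (Hb - Real.exp (-γ) • (Abᵀ * Ab)).PosSemidef)
    (hHb2 : (Real.exp γ • (Abᵀ * Ab) - Hb).PosSemidef)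
    (g : Fin m → ℝ) (hg : Real.sqrt (∑ i, g i ^ 2) = γ)
    (δp δc : Fin m → ℝ)
    (hδp : δp = (Matrix.diagonal (fun i => (Real.sqrt (wb i))⁻¹) * Ab * Hb⁻¹ * Abᵀ *
        Matrix.diagonal (fun i => Real.sqrt (wb i))) *ᵥ g)
    (hδc : δc = (Real.sqrt μ)⁻¹ •
        ((Matrix.diagonal (fun i => (Real.sqrt (wb i))⁻¹) * Ab * Hb⁻¹) *ᵥ (Aᵀ *ᵥ x - b))) :
    Real.sqrt (∑ i, δp i ^ 2) ≤ Real.exp (4 * ε) * γ ∧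
    Real.sqrt (∑ i, δc i ^ 2) ≤ ε * Real.exp (4 * ε) * γ := by
  have hε : Real.exp (-ε) * Real.exp ε = 1 := by rw [← Real.exp_add]; simp
  have hE : 0 < Real.exp ε := Real.exp_pos _
  have hE' : 0 < Real.exp (-ε) := Real.exp_pos _
  have hwpos : ∀ i, 0 < wb i := fun i => by
    rw [hwb]; exact div_pos (mul_pos (hxb i) (hsb i)) hμ
  have hw_le : ∀ i, wb i ≤ Real.exp ε ^ 3 := fun i => by
    rw [hwb, div_le_iff₀ hμ]
    calc xb i * sb i ≤ (Real.exp ε * x i) * (Real.exp ε * s i) :=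
          mul_le_mul (hxa i).2 (hsa i).2 (hsb i).le (mul_pos hE (hx i)).le
      _ = Real.exp ε ^ 2 * (x i * s i) := by ring
      _ ≤ Real.exp ε ^ 2 * (Real.exp ε * μ) := mul_le_mul_of_nonneg_left (hcenter i).2 (by positivity)
      _ = _ := by ring
  have hw_ge : ∀ i, Real.exp (-ε) ^ 3 ≤ wb i := fun i => by
    rw [hwb, le_div_iff₀ hμ]
    calc Real.exp (-ε) ^ 3 * μ = Real.exp (-ε) ^ 2 * (Real.exp (-ε) * μ) := by ring
      _ ≤ Real.exp (-ε) ^ 2 * (x i * s i) := mul_le_mul_of_nonneg_left (hcenter i).1 (by positivity)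
      _ = (Real.exp (-ε) * x i) * (Real.exp (-ε) * s i) := by ring
      _ ≤ xb i * sb i :=
          mul_le_mul (hxa i).1 (hsa i).1 (mul_pos hE' (hs i)).le (hxb i).le
  have hd_sqrt : ∀ i, Real.sqrt (wb i) ^ 2 ≤ Real.exp ε ^ 3 := fun i => by
    rw [Real.sq_sqrt (hwpos i).le]; exact hw_le i
  have hd_inv : ∀ i, (Real.sqrt (wb i))⁻¹ ^ 2 ≤ Real.exp ε ^ 3 := fun i => by
    rw [inv_pow, Real.sq_sqrt (hwpos i).le]
    refine inv_le_of_inv_le₀ (by positivity) ?_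
    rw [← inv_pow, ← Real.exp_neg]
    exact hw_ge i
  have hγε : Real.exp γ ≤ Real.exp ε := Real.exp_le_exp.mpr hγ1
  have hcγ : Real.exp γ * Real.exp (-γ) = 1 := by rw [← Real.exp_add]; simp
  -- From a bound on `⟨H̄⁻¹r, r⟩` to a bound on `‖W̄^{-1/2} Ā H̄⁻¹ r‖²`.
  have key : ∀ (r : Fin n → ℝ) (K : ℝ), 0 ≤ K →
      ((Hb⁻¹ *ᵥ r) ⬝ᵥ r) ^ 2 ≤ K * ((Ab *ᵥ (Hb⁻¹ *ᵥ r)) ⬝ᵥ (Ab *ᵥ (Hb⁻¹ *ᵥ r))) →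
      ((diagonal (fun i => (Real.sqrt (wb i))⁻¹) * Ab * Hb⁻¹) *ᵥ r) ⬝ᵥ
        ((diagonal (fun i => (Real.sqrt (wb i))⁻¹) * Ab * Hb⁻¹) *ᵥ r) ≤
        Real.exp ε ^ 5 * K := by
    intro r K hK hr
    have h1 := mulVec_inv_mulVec_dotProduct_self_le Ab Hb hHbpd _ K (Real.exp_pos _) hK hHb1 r hr
    have h2 := diagonal_mulVec_dotProduct_self_le (fun i => (Real.sqrt (wb i))⁻¹)
      (Ab *ᵥ (Hb⁻¹ *ᵥ r)) _ hd_inv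
    rw [← mulVec_mulVec, ← mulVec_mulVec]
    refine h2.trans ?_
    set P := (Ab *ᵥ (Hb⁻¹ *ᵥ r)) ⬝ᵥ (Ab *ᵥ (Hb⁻¹ *ᵥ r))
    have h3 : P ≤ Real.exp ε ^ 2 * K :=
      calc P = Real.exp γ ^ 2 * (Real.exp (-γ) ^ 2 * P) := by
            rw [← mul_assoc, ← mul_pow, hcγ]; ring
        _ ≤ Real.exp γ ^ 2 * K := by gcongr
        _ ≤ Real.exp ε ^ 2 * K := by gcongr
    calc Real.exp ε ^ 3 * P ≤ Real.exp ε ^ 3 * (Real.exp ε ^ 2 * K) := by gcongr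
      _ = _ := by ring
  have h4 : Real.exp (4 * ε) = Real.exp ε ^ 4 := by
    rw [← Real.exp_nat_mul]; norm_num
  have hdot : ∀ v : Fin m → ℝ, ∑ i, v i ^ 2 = v ⬝ᵥ v := fun v => by
    simp only [dotProduct, sq]
  have hgg : g ⬝ᵥ g = γ ^ 2 := by
    rw [← hg, hdot, Real.sq_sqrt (dotProduct_self_nonneg' g)]
  rw [h4, hdot, hdot]
  constructor
  · set q := diagonal (fun i => Real.sqrt (wb i)) *ᵥ g with hq
    have hqq : q ⬝ᵥ q ≤ Real.exp ε ^ 3 * γ ^ 2 := by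
      rw [← hgg]; exact diagonal_mulVec_dotProduct_self_le _ g _ hd_sqrt
    have hk := key (Abᵀ *ᵥ q) (q ⬝ᵥ q) (dotProduct_self_nonneg' q) (by
      set u := Hb⁻¹ *ᵥ (Abᵀ *ᵥ q)
      rw [dotProduct_mulVec, vecMul_transpose, mul_comm]
      exact dotProduct_sq_le _ _)
    have hδ : δp = (diagonal (fun i => (Real.sqrt (wb i))⁻¹) * Ab * Hb⁻¹) *ᵥ (Abᵀ *ᵥ q) := by
      rw [hδp, hq]; simp only [mulVec_mulVec, Matrix.mul_assoc]
    rw [← hδ] at hk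
    refine Real.sqrt_le_iff.mpr ⟨by positivity, hk.trans ?_⟩
    calc Real.exp ε ^ 5 * (q ⬝ᵥ q) ≤ Real.exp ε ^ 5 * (Real.exp ε ^ 3 * γ ^ 2) := by gcongr
      _ = _ := by ring
  · set r := Aᵀ *ᵥ x - b
    set B := diagonal (fun i => Real.sqrt (x i / s i)) * A with hB
    have hM : Aᵀ * diagonal (fun i => x i / s i) * A = Bᵀ * B := by
      rw [hB, transpose_mul, diagonal_transpose, Matrix.mul_assoc, Matrix.mul_assoc,
        ← Matrix.mul_assoc (diagonal _) (diagonal _) A, diagonal_mul_diagonal]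
      simp only [Real.mul_self_sqrt (div_pos (hx _) (hs _)).le]
    have hBinj : Function.Injective B.mulVec := by
      intro u v huv
      apply mulVec_injective_of_rank_eq A hrank
      funext i
      have h := congrFun huv i
      simp only [hB, ← mulVec_mulVec, mulVec_diagonal] at h
      exact mul_left_cancel₀ (Real.sqrt_pos.mpr (div_pos (hx i) (hs i))).ne' h
    have hMpd : (Bᵀ * B).PosDef := by
      rw [← conjTranspose_eq_transpose_of_trivial]
      exact PosDef.conjTranspose_mul_self B hBinj
    rw [hM] at hfeas
    have hMy : (Bᵀ * B) *ᵥ ((Bᵀ * B)⁻¹ *ᵥ r) = r := by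
      rw [mulVec_mulVec, mul_nonsing_inv _ ((isUnit_iff_isUnit_det _).mp hMpd.isUnit),
        one_mulVec]
    set y := (Bᵀ * B)⁻¹ *ᵥ r
    have hyy : (B *ᵥ y) ⬝ᵥ (B *ᵥ y) ≤ (ε * γ) ^ 2 * μ := by
      rw [mulVec_dotProduct_mulVec, hMy, dotProduct_comm]
      have h := (Real.sqrt_le_iff.mp hfeas).2
      rwa [mul_pow, Real.sq_sqrt hμ.le] at h
    have hBA : ∀ u, (B *ᵥ u) ⬝ᵥ (B *ᵥ u) ≤ Real.exp ε ^ 2 * ((Ab *ᵥ u) ⬝ᵥ (Ab *ᵥ u)) := by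
      intro u
      simp only [hB, hAb, ← mulVec_mulVec, dotProduct, mulVec_diagonal, Finset.mul_sum]
      refine Finset.sum_le_sum fun i _ => ?_
      have h1 : x i ≤ Real.exp ε * xb i := by
        calc x i = Real.exp ε * (Real.exp (-ε) * x i) := by
              rw [← mul_assoc, mul_comm (Real.exp ε), hε, one_mul]
          _ ≤ _ := by gcongr; exact (hxa i).1
      have h2 : x i / s i ≤ Real.exp ε ^ 2 * (xb i / sb i) := by
        rw [← mul_div_assoc, div_le_div_iff₀ (hs i) (hsb i)]
        calc x i * sb i ≤ (Real.exp ε * xb i) * (Real.exp ε * s i) :=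
              mul_le_mul h1 (hsa i).2 (hsb i).le (mul_pos hE (hxb i)).le
          _ = _ := by ring
      rw [mul_mul_mul_comm, mul_mul_mul_comm (Real.sqrt (xb i / sb i)),
        Real.mul_self_sqrt (div_pos (hx i) (hs i)).le,
        Real.mul_self_sqrt (div_pos (hxb i) (hsb i)).le, ← mul_assoc (Real.exp ε ^ 2)]
      exact mul_le_mul_of_nonneg_right h2 (mul_self_nonneg _)
    have hk := key r (Real.exp ε ^ 2 * ((ε * γ) ^ 2 * μ)) (by positivity) (by
      set u := Hb⁻¹ *ᵥ r
      have h : u ⬝ᵥ r = (B *ᵥ u) ⬝ᵥ (B *ᵥ y) := by rw [mulVec_dotProduct_mulVec, hMy]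
      rw [h]
      calc _ ≤ _ := dotProduct_sq_le _ _
        _ ≤ (Real.exp ε ^ 2 * ((Ab *ᵥ u) ⬝ᵥ (Ab *ᵥ u))) * ((ε * γ) ^ 2 * μ) :=
            mul_le_mul (hBA u) hyy (dotProduct_self_nonneg' _)
              (mul_nonneg (by positivity) (dotProduct_self_nonneg' _))
        _ = _ := by ring)
    refine Real.sqrt_le_iff.mpr ⟨by positivity, ?_⟩
    rw [hδc, smul_dotProduct, dotProduct_smul, smul_smul, smul_eq_mul, ← mul_inv,
      Real.mul_self_sqrt hμ.le]
    calc _ ≤ μ⁻¹ * (Real.exp ε ^ 5 * (Real.exp ε ^ 2 * ((ε * γ) ^ 2 * μ))) := by gcongr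
      _ = Real.exp ε ^ 7 * (ε * γ) ^ 2 := by field_simp
      _ ≤ Real.exp ε ^ 8 * (ε * γ) ^ 2 := by
          gcongr
          · exact Real.one_le_exp hε0.le
          · norm_num
      _ = _ := by ring
end

section
/- Let A ∈ ℝ^{m×n} be non-degenerate, b ∈ ℝ^n, μ > 0, and δ ∈ [0, 1/10]. Let x, s ∈ ℝ^m be entrywise positive with e^{−1}·μ ≤ x_i·s_i ≤ e·μ for every i (this is the centering condition xs ≈₁ μ·τ(x,s) for the logarithmic-barrier weight function τ(x,s) ≡ 𝟙), and let H be a symmetric positive definite matrix with H⁻¹ ≈_δ (AᵀXS⁻¹A)⁻¹. Then the point x' := x + XS⁻¹AH⁻¹(b − Aᵀx) satisfies both ‖Aᵀx' − b‖²_{(AᵀXS⁻¹A)⁻¹} ≤ 5δ·‖Aᵀx − b‖²_{(AᵀXS⁻¹A)⁻¹} and ‖X⁻¹(x − x')‖_∞² ≤ (5/μ)·‖Aᵀx − b‖²_{(AᵀXS⁻¹A)⁻¹}. -/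
open Matrix

namespace Matrix

variable {ι κ : Type*} [Fintype ι] [Fintype κ]

theorem PosSemidef.smul_dotProduct_mulVec_le {M N : Matrix ι ι ℝ} {c : ℝ}
    (h : (M - c • N).PosSemidef) (v : ι → ℝ) : c * (v ⬝ᵥ (N *ᵥ v)) ≤ v ⬝ᵥ (M *ᵥ v) := by
  simpa [Matrix.sub_mulVec, Matrix.smul_mulVec] using h.dotProduct_mulVec_nonneg v

theorem PosSemidef.dotProduct_mulVec_le_smul {M N : Matrix ι ι ℝ} {c : ℝ}
    (h : (c • N - M).PosSemidef) (v : ι → ℝ) : v ⬝ᵥ (M *ᵥ v) ≤ c * (v ⬝ᵥ (N *ᵥ v)) := by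
  simpa [Matrix.sub_mulVec, Matrix.smul_mulVec] using h.dotProduct_mulVec_nonneg v

theorem dotProduct_mulVec_comm_of_transpose_eq {M : Matrix ι ι ℝ} (hM : Mᵀ = M) (v w : ι → ℝ) :
    v ⬝ᵥ (M *ᵥ w) = w ⬝ᵥ (M *ᵥ v) := by
  rw [dotProduct_mulVec, ← mulVec_transpose, hM, dotProduct_comm]

theorem inv_mulVec_mulVec [DecidableEq ι] {Q : Matrix ι ι ℝ} (hdet : IsUnit Q.det) (v : ι → ℝ) :
    Q⁻¹ *ᵥ (Q *ᵥ v) = v := by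
  rw [mulVec_mulVec, nonsing_inv_mul _ hdet, one_mulVec]

/-- If `K ⪯ c • Q⁻¹` then `K * Q * K ⪯ c • K`. -/
theorem dotProduct_mulVec_le_of_le_smul_inv [DecidableEq ι] {Q K : Matrix ι ι ℝ} {c : ℝ}
    (hdet : IsUnit Q.det) (hK : K.PosSemidef) (hc : 0 < c)
    (h : (c • Q⁻¹ - K).PosSemidef) (r : ι → ℝ) :
    (K *ᵥ r) ⬝ᵥ (Q *ᵥ (K *ᵥ r)) ≤ c * (r ⬝ᵥ (K *ᵥ r)) := by
  have hKs : Kᵀ = K := by simpa using hK.isHermitian.eq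
  set y := K *ᵥ r with hy
  have h1 := h.dotProduct_mulVec_le_smul (Q *ᵥ y)
  rw [inv_mulVec_mulVec hdet, dotProduct_comm (Q *ᵥ y) y] at h1
  have h2 : 0 ≤ (Q *ᵥ y - c • r) ⬝ᵥ (K *ᵥ (Q *ᵥ y - c • r)) := by
    simpa using hK.dotProduct_mulVec_nonneg (Q *ᵥ y - c • r)
  have h3 := dotProduct_mulVec_comm_of_transpose_eq hKs r (Q *ᵥ y)
  simp only [mulVec_sub, mulVec_smul, dotProduct_sub, sub_dotProduct, smul_dotProduct,
    dotProduct_smul, smul_eq_mul, h3, ← hy, dotProduct_comm (Q *ᵥ y) y] at h2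
  by_contra! hlt
  nlinarith [mul_lt_mul_of_pos_left hlt hc]

theorem dotProduct_inv_mulVec_sub [DecidableEq ι] {Q : Matrix ι ι ℝ} (hQ : Qᵀ = Q)
    (hdet : IsUnit Q.det) (r y : ι → ℝ) :
    (r - Q *ᵥ y) ⬝ᵥ (Q⁻¹ *ᵥ (r - Q *ᵥ y)) =
      r ⬝ᵥ (Q⁻¹ *ᵥ r) - 2 * (r ⬝ᵥ y) + y ⬝ᵥ (Q *ᵥ y) := by
  have hP : (Q⁻¹)ᵀ = Q⁻¹ := by rw [transpose_nonsing_inv, hQ]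
  have hy := inv_mulVec_mulVec hdet y
  have h := dotProduct_mulVec_comm_of_transpose_eq hP (Q *ᵥ y) r
  rw [hy] at h
  rw [mulVec_sub, hy, dotProduct_sub, sub_dotProduct, sub_dotProduct, h,
    dotProduct_comm (Q *ᵥ y) y]
  ring

theorem mul_sq_le_dotProduct_transpose_diagonal_mulVec [DecidableEq ι] (A : Matrix ι κ ℝ)
    {d : ι → ℝ} (hd : ∀ j, 0 ≤ d j) (y : κ → ℝ) (i : ι) :
    d i * (A *ᵥ y) i ^ 2 ≤ y ⬝ᵥ ((Aᵀ * diagonal d * A) *ᵥ y) := by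
  have h : y ⬝ᵥ ((Aᵀ * diagonal d * A) *ᵥ y) = ∑ j, d j * (A *ᵥ y) j ^ 2 := by
    rw [← mulVec_mulVec, ← mulVec_mulVec, dotProduct_mulVec, vecMul_transpose]
    simp only [dotProduct, mulVec_diagonal]
    exact Finset.sum_congr rfl fun j _ => by ring
  rw [h]
  exact Finset.single_le_sum (f := fun j => d j * (A *ᵥ y) j ^ 2)
    (fun j _ => mul_nonneg (hd j) (sq_nonneg _)) (Finset.mem_univ i)

end Matrix

/-- **Feasibility-restoring projection.**  If `xs ≈₁ μ·𝟙` and `H⁻¹ ≈_δ (AᵀXS⁻¹A)⁻¹`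
with `δ ∈ [0, 1/10]`, then `x' = x + XS⁻¹AH⁻¹(b - Aᵀx)` satisfies
`‖Aᵀx' - b‖²_{(AᵀXS⁻¹A)⁻¹} ≤ 5δ‖Aᵀx - b‖²_{(AᵀXS⁻¹A)⁻¹}` and
`‖X⁻¹(x - x')‖_∞² ≤ (5/μ)‖Aᵀx - b‖²_{(AᵀXS⁻¹A)⁻¹}`. -/
theorem feasible_projection
    {m n : ℕ} (A : Matrix (Fin m) (Fin n) ℝ) (hrank : A.rank = n) (hrows : ∀ i, A i ≠ 0)
    (b : Fin n → ℝ) (μ : ℝ) (hμ : 0 < μ) (δ : ℝ) (hδ0 : 0 ≤ δ) (hδ1 : δ ≤ 1 / 10)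
    (x s : Fin m → ℝ) (hx : ∀ i, 0 < x i) (hs : ∀ i, 0 < s i)
    (hcenter : ∀ i, Real.exp (-1) * μ ≤ x i * s i ∧ x i * s i ≤ Real.exp 1 * μ)
    (H : Matrix (Fin n) (Fin n) ℝ) (hHpd : H.PosDef)
    (hH1 : (H⁻¹ -
      Real.exp (-δ) • (Aᵀ * Matrix.diagonal (fun i => x i / s i) * A)⁻¹).PosSemidef)
    (hH2 : (Real.exp δ • (Aᵀ * Matrix.diagonal (fun i => x i / s i) * A)⁻¹ -
      H⁻¹).PosSemidef)
    (x' : Fin m → ℝ)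
    (hx' : x' = x + (Matrix.diagonal (fun i => x i / s i) * A * H⁻¹) *ᵥ (b - Aᵀ *ᵥ x)) :
    (Aᵀ *ᵥ x' - b) ⬝ᵥ
        ((Aᵀ * Matrix.diagonal (fun i => x i / s i) * A)⁻¹ *ᵥ (Aᵀ *ᵥ x' - b)) ≤
      5 * δ * ((Aᵀ *ᵥ x - b) ⬝ᵥ
        ((Aᵀ * Matrix.diagonal (fun i => x i / s i) * A)⁻¹ *ᵥ (Aᵀ *ᵥ x - b))) ∧
    ∀ i, ((x i - x' i) / x i) ^ 2 ≤
      (5 / μ) * ((Aᵀ *ᵥ x - b) ⬝ᵥ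
        ((Aᵀ * Matrix.diagonal (fun i => x i / s i) * A)⁻¹ *ᵥ (Aᵀ *ᵥ x - b))) := by
  set D := Matrix.diagonal (fun i => x i / s i) with hD
  set Q := Aᵀ * D * A with hQdef
  set r := Aᵀ *ᵥ x - b with hr
  have hK : (H⁻¹).PosDef := hHpd.inv
  have hc := Real.exp_pos δ
  have hQsymm : Qᵀ = Q := by
    simp [hQdef, hD, Matrix.transpose_mul, Matrix.mul_assoc]
  have hQ : IsUnit Q := by
    have h := (hK.add_posSemidef hH2).isUnit
    rw [add_sub_cancel] at h
    have h' := h.smul (Units.mk0 (Real.exp δ) hc.ne')⁻¹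
    rw [Units.smul_def, smul_smul, Units.val_inv_eq_inv_val, Units.val_mk0,
      inv_mul_cancel₀ hc.ne', one_smul] at h'
    exact Matrix.isUnit_nonsing_inv_iff.mp h'
  have hQdet := (Matrix.isUnit_iff_isUnit_det Q).mp hQ
  have hlow := hH1.smul_dotProduct_mulVec_le r
  have hupp := hH2.dotProduct_mulVec_le_smul r
  have hN := dotProduct_mulVec_le_of_le_smul_inv hQdet hK.posSemidef hc hH2 r
  have hpos : 0 ≤ r ⬝ᵥ (H⁻¹ *ᵥ r) := by simpa using hK.posSemidef.dotProduct_mulVec_nonneg r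
  have hdiff : x' - x = -(D *ᵥ (A *ᵥ (H⁻¹ *ᵥ r))) := by
    rw [hx', add_sub_cancel_left, ← neg_sub (Aᵀ *ᵥ x) b, ← hr, Matrix.mulVec_neg]
    simp [Matrix.mulVec_mulVec, Matrix.mul_assoc]
  have hres : Aᵀ *ᵥ x' - b = r - Q *ᵥ (H⁻¹ *ᵥ r) := by
    rw [← add_sub_cancel x x', hdiff, Matrix.mulVec_add, Matrix.mulVec_neg, hr, hQdef]
    simp only [← Matrix.mulVec_mulVec]
    abel
  have hquad := dotProduct_inv_mulVec_sub hQsymm hQdet r (H⁻¹ *ᵥ r)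
  have hexp : Real.exp δ * Real.exp (-δ) = 1 := by rw [← Real.exp_add]; simp
  have hexp' : 1 - δ ≤ Real.exp (-δ) := by linarith [Real.add_one_le_exp (-δ)]
  have hc1 : Real.exp δ ≤ 10 / 9 := by nlinarith
  have hp : 0 ≤ r ⬝ᵥ (Q⁻¹ *ᵥ r) := by
    by_contra! h
    nlinarith
  generalize hpe : r ⬝ᵥ (Q⁻¹ *ᵥ r) = p at *
  generalize hke : r ⬝ᵥ (H⁻¹ *ᵥ r) = k at *
  constructor
  · rw [hres, hquad]
    have h1 : (2 - Real.exp δ) * (Real.exp (-δ) * p) ≤ (2 - Real.exp δ) * k :=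
      mul_le_mul_of_nonneg_left hlow (by linarith)
    have h2 : (2 - Real.exp δ) * (Real.exp (-δ) * p) = 2 * Real.exp (-δ) * p - p := by
      linear_combination -p * hexp
    nlinarith [mul_le_mul_of_nonneg_right hexp' hp, mul_nonneg hδ0 hp]
  · intro i
    set y := H⁻¹ *ᵥ r
    have hi : x i - x' i = x i / s i * (A *ᵥ y) i := by
      have := congrFun hdiff i
      simp only [Pi.sub_apply, Pi.neg_apply, hD, Matrix.mulVec_diagonal] at this
      linarith
    have hw : x i / s i * (A *ᵥ y) i ^ 2 ≤ y ⬝ᵥ (Q *ᵥ y) :=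
      mul_sq_le_dotProduct_transpose_diagonal_mulVec A
        (fun j => (div_pos (hx j) (hs j)).le) y i
    have hxs : 0 < x i * s i := mul_pos (hx i) (hs i)
    have hle : 1 / (x i * s i) ≤ Real.exp 1 / μ := by
      rw [div_le_div_iff₀ hxs hμ]
      have h := mul_le_mul_of_nonneg_left (hcenter i).1 (Real.exp_pos 1).le
      rw [← mul_assoc, ← Real.exp_add] at h
      simpa using h
    have hbound : y ⬝ᵥ (Q *ᵥ y) ≤ 100 / 81 * p := by nlinarith
    calc ((x i - x' i) / x i) ^ 2
        = 1 / (x i * s i) * (x i / s i * (A *ᵥ y) i ^ 2) := by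
          have := (hx i).ne'
          have := (hs i).ne'
          rw [hi]
          field_simp
      _ ≤ Real.exp 1 / μ * (100 / 81 * p) :=
          mul_le_mul hle (hw.trans hbound)
            (mul_nonneg (div_pos (hx i) (hs i)).le (sq_nonneg _)) (by positivity)
      _ = (Real.exp 1 * (100 / 81)) / μ * p := by ring
      _ ≤ 5 / μ * p := by
          gcongr
          linarith [Real.exp_one_lt_d9]
end

section
/- Fix a non-degenerate matrix A ∈ ℝ^{m×n}, b ∈ ℝ^n, and c ∈ ℝ^m. Let w⁰, w¹ ∈ ℝ^m be entrywise positive, and suppose (x⁰, y⁰, s⁰) and (x¹, y¹, s¹) with x⁰, s⁰, x¹, s¹ ∈ ℝ^m entrywise positive satisfy x⁰·s⁰ = w⁰ (entrywise), Aᵀx⁰ = b, Ay⁰ + s⁰ = c, and x¹·s¹ = w¹ (entrywise), Aᵀx¹ = b, Ay¹ + s¹ = c. Set W₁ := ‖w⁰‖₁ + ‖w¹‖₁, W_min := min_{i} min(w⁰_i, w¹_i), and κ := 4·(W₁/W_min)². Then entrywise (1/κ)·x¹ ≤ x⁰ ≤ κ·x¹ and (1/κ)·s¹ ≤ s⁰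 ≤ κ·s¹. -/
open Matrix Finset

/-- Differences of primal feasible points are orthogonal to differences of dual feasible slacks. -/
theorem dotProduct_sub_sub_eq_zero_of_feasible {ι κ : Type*} [Fintype ι] [Fintype κ]
    {A : Matrix ι κ ℝ} {b : κ → ℝ} {c x x' s s' : ι → ℝ} {y y' : κ → ℝ}
    (hx : Aᵀ *ᵥ x = b) (hx' : Aᵀ *ᵥ x' = b) (hs : A *ᵥ y + s = c) (hs' : A *ᵥ y' + s' = c) :
    (x - x') ⬝ᵥ (s - s') = 0 := by
  have hdiff : s - s' = A *ᵥ (y' - y) := by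
    rw [mulVec_sub, ← sub_eq_of_eq_add' hs.symm, ← sub_eq_of_eq_add' hs'.symm]
    abel
  rw [hdiff, dotProduct_mulVec, ← mulVec_transpose, mulVec_sub, hx, hx', sub_self,
    zero_dotProduct]

/-- The cross terms of two primal-dual feasible pairs add up to the sum of their weights. -/
theorem sum_cross_eq_sum_weights {ι κ : Type*} [Fintype ι] [Fintype κ]
    {A : Matrix ι κ ℝ} {b : κ → ℝ} {c x x' s s' : ι → ℝ} {y y' : κ → ℝ}
    (hx : Aᵀ *ᵥ x = b) (hx' : Aᵀ *ᵥ x' = b) (hs : A *ᵥ y + s = c) (hs' : A *ᵥ y' + s' = c) :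
    ∑ j, (x j * s' j + x' j * s j) = ∑ j, x j * s j + ∑ j, x' j * s' j := by
  have h := dotProduct_sub_sub_eq_zero_of_feasible hx hx' hs hs'
  rw [sub_dotProduct, dotProduct_sub, dotProduct_sub] at h
  simp only [dotProduct] at h
  rw [sum_add_distrib]
  linarith

theorem le_div_mul_of_mul_le {x x' t W M : ℝ} (ht : 0 < t) (hM : 0 < M)
    (hW : x * t ≤ W) (hMt : M ≤ x' * t) (hW0 : 0 ≤ W) : x ≤ W / M * x' := by
  refine le_of_mul_le_mul_right (hW.trans ?_) ht
  rw [mul_assoc, div_mul_eq_mul_div, le_div_iff₀ hM]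
  exact mul_le_mul_of_nonneg_left hMt hW0

/-- **Stability of the weighted central path.**  If `(x⁰,s⁰)` and `(x¹,s¹)` lie on the
weighted central path of the primal-dual pair given by `(A,b,c)` with weight vectors
`w⁰` and `w¹`, then with `κ = 4(W₁/W_min)²`, where `W₁ = ‖w⁰‖₁ + ‖w¹‖₁` and
`W_min = minᵢ min(w⁰ᵢ, w¹ᵢ)`, one has `κ⁻¹ x¹ ≤ x⁰ ≤ κ x¹` and `κ⁻¹ s¹ ≤ s⁰ ≤ κ s¹`
entrywise. -/
theorem central_path_stability
    {m n : ℕ} (hm : 0 < m)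
    (A : Matrix (Fin m) (Fin n) ℝ) (hrank : A.rank = n) (hrows : ∀ i, A i ≠ 0)
    (b : Fin n → ℝ) (c : Fin m → ℝ)
    (w0 w1 : Fin m → ℝ) (hw0 : ∀ i, 0 < w0 i) (hw1 : ∀ i, 0 < w1 i)
    (x0 s0 x1 s1 : Fin m → ℝ) (y0 y1 : Fin n → ℝ)
    (hx0 : ∀ i, 0 < x0 i) (hs0 : ∀ i, 0 < s0 i) (hx1 : ∀ i, 0 < x1 i) (hs1 : ∀ i, 0 < s1 i)
    (hw0eq : ∀ i, x0 i * s0 i = w0 i) (hf0 : Aᵀ *ᵥ x0 = b) (hd0 : A *ᵥ y0 + s0 = c)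
    (hw1eq : ∀ i, x1 i * s1 i = w1 i) (hf1 : Aᵀ *ᵥ x1 = b) (hd1 : A *ᵥ y1 + s1 = c)
    (κ : ℝ)
    (hκ : κ = 4 * (((∑ j, |w0 j|) + ∑ j, |w1 j|) /
      Finset.univ.inf' (Finset.univ_nonempty_iff.mpr ⟨⟨0, hm⟩⟩)
        (fun j => min (w0 j) (w1 j))) ^ 2) :
    ∀ i, (1 / κ) * x1 i ≤ x0 i ∧ x0 i ≤ κ * x1 i ∧
      (1 / κ) * s1 i ≤ s0 i ∧ s0 i ≤ κ * s1 i := by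
  have habs : (∑ j, |w0 j|) + ∑ j, |w1 j| = ∑ j, w0 j + ∑ j, w1 j := by
    simp only [abs_of_pos (hw0 _), abs_of_pos (hw1 _)]
  rw [habs] at hκ
  set M := Finset.univ.inf' (Finset.univ_nonempty_iff.mpr ⟨⟨0, hm⟩⟩)
    (fun j => min (w0 j) (w1 j)) with hMdef
  set W := ∑ j, w0 j + ∑ j, w1 j with hWdef
  have hM : 0 < M := (lt_inf'_iff _).mpr fun j _ => lt_min (hw0 j) (hw1 j)
  have hMle (j) : M ≤ min (w0 j) (w1 j) := inf'_le _ (mem_univ j)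
  have hM0 (j) : M ≤ x0 j * s0 j := by rw [hw0eq]; exact (hMle j).trans (min_le_left _ _)
  have hM1 (j) : M ≤ x1 j * s1 j := by rw [hw1eq]; exact (hMle j).trans (min_le_right _ _)
  have hsum : ∑ j, (x0 j * s1 j + x1 j * s0 j) = W := by
    simpa only [hw0eq, hw1eq] using sum_cross_eq_sum_weights hf0 hf1 hd0 hd1
  have hcross (j) : x0 j * s1 j + x1 j * s0 j ≤ W := by
    rw [← hsum]
    exact single_le_sum (f := fun j => x0 j * s1 j + x1 j * s0 j)
      (fun k _ => (add_pos (mul_pos (hx0 k) (hs1 k)) (mul_pos (hx1 k) (hs0 k))).le) (mem_univ j)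
  have hMW : M ≤ W := by
    have h0 : w0 ⟨0, hm⟩ ≤ ∑ j, w0 j := single_le_sum (fun k _ => (hw0 k).le) (mem_univ _)
    have h1 : 0 ≤ ∑ j, w1 j := sum_nonneg fun k _ => (hw1 k).le
    linarith [(hMle ⟨0, hm⟩).trans (min_le_left _ _)]
  have hr : 1 ≤ W / M := (one_le_div hM).mpr hMW
  have hrκ : W / M ≤ κ := by rw [hκ]; nlinarith
  have hκ0 : 0 < κ := by linarith
  have hbound {x x' t : ℝ} (ht : 0 < t) (hx' : 0 < x') (hW : x * t ≤ W) (hMt : M ≤ x' * t) :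
      x ≤ κ * x' :=
    (le_div_mul_of_mul_le ht hM hW hMt (hM.le.trans hMW)).trans
      (mul_le_mul_of_nonneg_right hrκ hx'.le)
  intro i
  have h01 := mul_pos (hx0 i) (hs1 i)
  have h10 := mul_pos (hx1 i) (hs0 i)
  have hi := hcross i
  rw [one_div, inv_mul_le_iff₀ hκ0, inv_mul_le_iff₀ hκ0]
  exact ⟨hbound (hs0 i) (hx0 i) (by linarith) (hM0 i),
    hbound (hs1 i) (hx1 i) (by linarith) (hM1 i),
    hbound (hx0 i) (hs0 i) (by linarith) (by linarith [hM0 i]),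
    hbound (hx1 i) (hs1 i) (by linarith) (by linarith [hM1 i])⟩
end

section
/- Let A₁ ∈ ℝ^{n×m'}, b₁ ∈ ℝ^{m'}, A₂ ∈ ℝ^{n×k}, b₂ ∈ ℝ^k, and b₃ ∈ ℝ^n, and define Ω := {x ∈ ℝ^n : A₁ᵀx = b₁ and A₂ᵀx > b₂ entrywise}. For w ∈ ℝ^k entrywise positive, consider the weighted barrier objective F_w(x) := b₃ᵀx − Σ_{i=1}^k w_i·log([A₂ᵀx − b₂]_i) on Ω. Let w⁰, w¹ ∈ ℝ^k be entrywise positive with w⁰ ≠ w¹, and suppose x⁰ ∈ Ω minimizes F_{w⁰} over Ω and x¹ ∈ Ω minimizes F_{w¹} over Ω. Set θ := ( min_{i} min(w⁰_i, w¹_i) ) / ( Σ_{i=1}^k |w⁰_i − w¹_i| ) and γ := θ²/(1 + 2θ). Then x⁰ + t·(x¹ − x⁰) ∈ Ω for every t ∈ (−γ, 1 + γ). -/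
open Matrix Finset

/-- First-order optimality of a minimizer of a weighted log-barrier objective, along a
direction in the kernel of the equality constraints. -/
lemma barrier_minimizer_stationary {n p k : ℕ}
    (A1 : Matrix (Fin n) (Fin p) ℝ) (b1 : Fin p → ℝ)
    (A2 : Matrix (Fin n) (Fin k) ℝ) (b2 : Fin k → ℝ) (b3 : Fin n → ℝ)
    (w : Fin k → ℝ) (x d : Fin n → ℝ)
    (hx : A1ᵀ *ᵥ x = b1 ∧ ∀ i, b2 i < (A2ᵀ *ᵥ x) i)
    (hmin : ∀ y : Fin n → ℝ, (A1ᵀ *ᵥ y = b1 ∧ ∀ i, b2 i < (A2ᵀ *ᵥ y) i) →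
      b3 ⬝ᵥ x - ∑ i, w i * Real.log ((A2ᵀ *ᵥ x) i - b2 i) ≤
        b3 ⬝ᵥ y - ∑ i, w i * Real.log ((A2ᵀ *ᵥ y) i - b2 i))
    (hd : A1ᵀ *ᵥ d = 0) :
    b3 ⬝ᵥ d = ∑ i, w i * ((A2ᵀ *ᵥ d) i / ((A2ᵀ *ᵥ x) i - b2 i)) := by
  have hslack : ∀ i, HasDerivAt
      (fun t : ℝ => (A2ᵀ *ᵥ x) i + t * (A2ᵀ *ᵥ d) i - b2 i) ((A2ᵀ *ᵥ d) i) 0 := fun i => by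
    simpa using (((hasDerivAt_id (0 : ℝ)).mul_const ((A2ᵀ *ᵥ d) i)).const_add
      ((A2ᵀ *ᵥ x) i)).sub_const (b2 i)
  have hderiv : HasDerivAt
      (fun t : ℝ => (b3 ⬝ᵥ x + t * (b3 ⬝ᵥ d)) -
        ∑ i, w i * Real.log ((A2ᵀ *ᵥ x) i + t * (A2ᵀ *ᵥ d) i - b2 i))
      (b3 ⬝ᵥ d - ∑ i, w i * ((A2ᵀ *ᵥ d) i / ((A2ᵀ *ᵥ x) i - b2 i))) 0 := by
    refine HasDerivAt.sub ?_ (HasDerivAt.fun_sum fun i _ => HasDerivAt.const_mul _ ?_)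
    · simpa using ((hasDerivAt_id (0 : ℝ)).mul_const (b3 ⬝ᵥ d)).const_add (b3 ⬝ᵥ x)
    · have hne : (A2ᵀ *ᵥ x) i + 0 * (A2ᵀ *ᵥ d) i - b2 i ≠ 0 := by
        rw [zero_mul, add_zero]
        exact (sub_pos.2 (hx.2 i)).ne'
      simpa using (hslack i).log hne
  have hloc : IsLocalMin
      (fun t : ℝ => (b3 ⬝ᵥ x + t * (b3 ⬝ᵥ d)) -
        ∑ i, w i * Real.log ((A2ᵀ *ᵥ x) i + t * (A2ᵀ *ᵥ d) i - b2 i)) 0 := by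
    have hev : ∀ᶠ t : ℝ in nhds 0, ∀ i, 0 < (A2ᵀ *ᵥ x) i + t * (A2ᵀ *ᵥ d) i - b2 i := by
      refine Filter.eventually_all.2 fun i => (hslack i).continuousAt.eventually_const_lt ?_
      simpa using hx.2 i
    filter_upwards [hev] with t ht
    have h := hmin (x + t • d) ⟨by simp [mulVec_add, mulVec_smul, hd, hx.1], fun i => by
      have := ht i
      simp only [mulVec_add, mulVec_smul, Pi.add_apply, Pi.smul_apply, smul_eq_mul]
      linarith⟩
    simpa [mulVec_add, mulVec_smul, dotProduct_add, dotProduct_smul] using h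
  exact sub_eq_zero.1 (hloc.hasDerivAt_eq_zero hderiv)

/-- Lower bound for a single term of the stationarity identity of two weighted centers with
weights `a`, `b` and slacks `s`, `u`. -/
lemma neg_sq_div_le_center_term {m a b s u : ℝ} (hm : 0 < m) (ha : m ≤ a) (hb : m ≤ b)
    (hs : 0 < s) (hu : 0 < u) :
    -((a - b) ^ 2 / (4 * m)) ≤ (u - s) * (a / s - b / u) := by
  have key : ∀ {a b s u : ℝ}, m ≤ a → 0 < s → 0 < u → s ≤ u →
      -((a - b) ^ 2 / (4 * m)) ≤ (u - s) * (a / s - b / u) := by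
    intro a b s u ha hs hu hsu
    have e : (u - s) * (a / s - b / u) + (a - b) ^ 2 / (4 * m) =
        ((2 * m * (u - s) + (a - b) * s) ^ 2 + 4 * m * (a - m) * (u - s) ^ 2
          + (a - b) ^ 2 * s * (u - s)) / (4 * m * s * u) := by
      field_simp
      ring
    have h1 : 0 ≤ a - m := sub_nonneg.2 ha
    have h2 : 0 ≤ u - s := sub_nonneg.2 hsu
    have : 0 ≤ (u - s) * (a / s - b / u) + (a - b) ^ 2 / (4 * m) := by
      rw [e]
      positivity
    linarith
  rcases le_total s u with h | h
  · exact key ha hs hu h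
  · calc -((a - b) ^ 2 / (4 * m)) = -((b - a) ^ 2 / (4 * m)) := by ring
      _ ≤ (s - u) * (b / u - a / s) := key hb hu hs h
      _ = (u - s) * (a / s - b / u) := by ring

/-- The growth of a slack between two weighted centers is controlled by the relative distance
of the weights. -/
lemma center_slack_growth {ι : Type*} [Fintype ι] {m S θ : ℝ} {a b s u : ι → ℝ}
    (hm : 0 < m) (hθ : 0 < θ) (hmS : m = θ * S) (hS : S = ∑ i, |a i - b i|)
    (ha : ∀ i, m ≤ a i) (hb : ∀ i, m ≤ b i) (hs : ∀ i, 0 < s i) (hu : ∀ i, 0 < u i)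
    (hsum : ∑ i, (u i - s i) * (a i / s i - b i / u i) = 0) (j : ι) :
    θ ^ 2 / (1 + 2 * θ) * (u j - s j) ≤ s j := by
  classical
  have hSpos : 0 < S := pos_of_mul_pos_right (hmS ▸ hm) hθ.le
  have hsq : ∑ i ∈ univ.erase j, (a i - b i) ^ 2 ≤ S ^ 2 := by
    calc ∑ i ∈ univ.erase j, (a i - b i) ^ 2 ≤ ∑ i, (a i - b i) ^ 2 :=
          sum_le_sum_of_subset_of_nonneg (erase_subset _ _) fun _ _ _ => sq_nonneg _
      _ = ∑ i, |a i - b i| ^ 2 := by simp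
      _ ≤ (∑ i, |a i - b i|) ^ 2 := sum_sq_le_sq_sum_of_nonneg fun _ _ => abs_nonneg _
      _ = S ^ 2 := by rw [hS]
  have hother : -(S ^ 2 / (4 * m)) ≤
      ∑ i ∈ univ.erase j, (u i - s i) * (a i / s i - b i / u i) := by
    calc -(S ^ 2 / (4 * m)) ≤ -((∑ i ∈ univ.erase j, (a i - b i) ^ 2) / (4 * m)) := by
          gcongr
      _ = ∑ i ∈ univ.erase j, -((a i - b i) ^ 2 / (4 * m)) := by
          rw [sum_neg_distrib, sum_div]
      _ ≤ _ := sum_le_sum fun i _ =>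
          neg_sq_div_le_center_term hm (ha i) (hb i) (hs i) (hu i)
  have hj : (u j - s j) * (a j / s j - b j / u j) ≤ S ^ 2 / (4 * m) := by
    have := add_sum_erase univ (fun i => (u i - s i) * (a i / s i - b i / u i)) (mem_univ j)
    simp only [hsum] at this
    linarith
  have hab : b j - a j ≤ S := by
    have h1 : |a j - b j| ≤ S := by
      rw [hS]
      exact single_le_sum (f := fun i => |a i - b i|) (fun _ _ => abs_nonneg _) (mem_univ j)
    linarith [neg_abs_le (a j - b j)]
  have hsj := hs j
  have huj := hu j
  have haj := ha j
  by_contra! hcon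
  rw [div_mul_eq_mul_div, lt_div_iff₀ (by positivity)] at hcon
  obtain ⟨y, hy⟩ : ∃ y, y = u j - s j := ⟨_, rfl⟩
  have huy : u j = s j + y := by rw [hy]; ring
  rw [← hy] at hcon
  have hy0 : 0 < y := by
    by_contra! hneg
    nlinarith [mul_nonneg (sq_nonneg θ) (neg_nonneg.2 hneg), mul_pos hsj hθ]
  have hθy : s j < θ * y := by
    have : θ * (2 * s j) < θ * (θ * y) := by nlinarith
    have := lt_of_mul_lt_mul_left this hθ.le
    linarith
  have hlow : (m * y ^ 2 - S * y * s j) / (s j * u j) ≤ (u j - s j) * (a j / s j - b j / u j) := by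
    have e : (u j - s j) * (a j / s j - b j / u j) =
        (y * (a j * u j - b j * s j)) / (s j * u j) := by
      rw [← hy]
      field_simp
    rw [e]
    gcongr
    rw [huy]
    nlinarith [mul_nonneg (mul_nonneg hy0.le hsj.le) (sub_nonneg.2 hab),
      mul_nonneg (sq_nonneg y) (sub_nonneg.2 haj)]
  have hfin := hlow.trans hj
  rw [div_le_div_iff₀ (by positivity) (by positivity), hmS, huy] at hfin
  have hfin' : 4 * θ ^ 2 * y ^ 2 - 4 * θ * y * s j ≤ s j * (s j + y) := by
    refine le_of_mul_le_mul_left ?_ (by positivity : 0 < S ^ 2)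
    linarith
  nlinarith [mul_lt_mul_of_pos_left hcon hy0, mul_lt_mul_of_pos_left hθy hsj, mul_pos hsj hy0]

/-- **Stability of weighted log-barrier centers.**  Let
`Ω = {x : A₁ᵀx = b₁, A₂ᵀx > b₂}` and for entrywise positive `w` let
`F_w(x) = b₃ᵀx - Σᵢ wᵢ log([A₂ᵀx - b₂]ᵢ)`.  If `x⁰` minimizes `F_{w⁰}` over `Ω` and
`x¹` minimizes `F_{w¹}` over `Ω`, then with
`θ = (minᵢ min(w⁰ᵢ, w¹ᵢ)) / Σᵢ|w⁰ᵢ - w¹ᵢ|` and `γ = θ²/(1 + 2θ)`, the segment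
`x⁰ + t(x¹ - x⁰)` lies in `Ω` for every `t ∈ (-γ, 1 + γ)`. -/
theorem weighted_center_segment
    {n m' k : ℕ} (hk : 0 < k)
    (A1 : Matrix (Fin n) (Fin m') ℝ) (b1 : Fin m' → ℝ)
    (A2 : Matrix (Fin n) (Fin k) ℝ) (b2 : Fin k → ℝ) (b3 : Fin n → ℝ)
    (w0 w1 : Fin k → ℝ) (hw0 : ∀ i, 0 < w0 i) (hw1 : ∀ i, 0 < w1 i) (hww : w0 ≠ w1)
    (x0 x1 : Fin n → ℝ)
    (hx0mem : A1ᵀ *ᵥ x0 = b1 ∧ ∀ i, b2 i < (A2ᵀ *ᵥ x0) i)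
    (hx1mem : A1ᵀ *ᵥ x1 = b1 ∧ ∀ i, b2 i < (A2ᵀ *ᵥ x1) i)
    (hx0min : ∀ x : Fin n → ℝ, (A1ᵀ *ᵥ x = b1 ∧ ∀ i, b2 i < (A2ᵀ *ᵥ x) i) →
      b3 ⬝ᵥ x0 - ∑ i, w0 i * Real.log ((A2ᵀ *ᵥ x0) i - b2 i) ≤
        b3 ⬝ᵥ x - ∑ i, w0 i * Real.log ((A2ᵀ *ᵥ x) i - b2 i))
    (hx1min : ∀ x : Fin n → ℝ, (A1ᵀ *ᵥ x = b1 ∧ ∀ i, b2 i < (A2ᵀ *ᵥ x) i) →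
      b3 ⬝ᵥ x1 - ∑ i, w1 i * Real.log ((A2ᵀ *ᵥ x1) i - b2 i) ≤
        b3 ⬝ᵥ x - ∑ i, w1 i * Real.log ((A2ᵀ *ᵥ x) i - b2 i))
    (θ γ : ℝ)
    (hθ : θ = (Finset.univ.inf' (Finset.univ_nonempty_iff.mpr ⟨⟨0, hk⟩⟩)
        (fun i => min (w0 i) (w1 i))) / ∑ i, |w0 i - w1 i|)
    (hγ : γ = θ ^ 2 / (1 + 2 * θ)) :
    ∀ t : ℝ, -γ < t → t < 1 + γ →
      A1ᵀ *ᵥ (x0 + t • (x1 - x0)) = b1 ∧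
        ∀ i, b2 i < (A2ᵀ *ᵥ (x0 + t • (x1 - x0))) i := by
  have hne : (univ : Finset (Fin k)).Nonempty := univ_nonempty_iff.mpr ⟨⟨0, hk⟩⟩
  obtain ⟨m, hm_def⟩ : ∃ m, m = univ.inf' hne (fun i => min (w0 i) (w1 i)) := ⟨_, rfl⟩
  have hm : 0 < m := by
    rw [hm_def, lt_inf'_iff]
    exact fun i _ => lt_min (hw0 i) (hw1 i)
  have hle : ∀ i, m ≤ min (w0 i) (w1 i) := fun i => by
    rw [hm_def]
    exact inf'_le _ (mem_univ i)
  have hS : 0 < ∑ i, |w0 i - w1 i| := by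
    obtain ⟨i, hi⟩ := Function.ne_iff.1 hww
    exact sum_pos' (fun _ _ => abs_nonneg _) ⟨i, mem_univ i, abs_pos.2 (sub_ne_zero.2 hi)⟩
  rw [← hm_def] at hθ
  have hθpos : 0 < θ := hθ ▸ div_pos hm hS
  have hmS : m = θ * ∑ i, |w0 i - w1 i| := by
    rw [hθ, div_mul_cancel₀ _ hS.ne']
  have hd : A1ᵀ *ᵥ (x1 - x0) = 0 := by
    rw [mulVec_sub, hx0mem.1, hx1mem.1, sub_self]
  have hs : ∀ i, 0 < (A2ᵀ *ᵥ x0) i - b2 i := fun i => sub_pos.2 (hx0mem.2 i)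
  have hu : ∀ i, 0 < (A2ᵀ *ᵥ x1) i - b2 i := fun i => sub_pos.2 (hx1mem.2 i)
  have hsum : ∑ i, (((A2ᵀ *ᵥ x1) i - b2 i) - ((A2ᵀ *ᵥ x0) i - b2 i)) *
      (w0 i / ((A2ᵀ *ᵥ x0) i - b2 i) - w1 i / ((A2ᵀ *ᵥ x1) i - b2 i)) = 0 := by
    have h0 := barrier_minimizer_stationary A1 b1 A2 b2 b3 w0 x0 _ hx0mem hx0min hd
    have h1 := barrier_minimizer_stationary A1 b1 A2 b2 b3 w1 x1 _ hx1mem hx1min hd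
    rw [← sub_eq_zero.2 (h0.symm.trans h1), ← sum_sub_distrib]
    refine sum_congr rfl fun i _ => ?_
    rw [mulVec_sub, Pi.sub_apply]
    ring
  have hup := center_slack_growth hm hθpos hmS rfl (fun i => (hle i).trans (min_le_left _ _))
    (fun i => (hle i).trans (min_le_right _ _)) hs hu hsum
  have hdown := center_slack_growth (a := w1) (b := w0) hm hθpos hmS
    (sum_congr rfl fun i _ => abs_sub_comm _ _) (fun i => (hle i).trans (min_le_right _ _))
    (fun i => (hle i).trans (min_le_left _ _)) hu hs
    (hsum ▸ sum_congr rfl fun i _ => by ring)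
  rw [← hγ] at hup hdown
  intro t ht0 ht1
  refine ⟨by rw [mulVec_add, mulVec_smul, hd, smul_zero, add_zero, hx0mem.1], fun i => ?_⟩
  have hi0 := hup i
  have hi1 := hdown i
  have hsi := hs i
  simp only [mulVec_add, mulVec_smul, mulVec_sub, Pi.add_apply, Pi.smul_apply, Pi.sub_apply,
    smul_eq_mul]
  rcases lt_trichotomy ((A2ᵀ *ᵥ x0) i) ((A2ᵀ *ᵥ x1) i) with h | h | h
  · nlinarith [mul_pos (sub_pos.2 h) (neg_lt_iff_pos_add.1 ht0)]
  · rw [h, sub_self, mul_zero, add_zero]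
    exact hx1mem.2 i
  · nlinarith [mul_pos (sub_pos.2 h) (sub_pos.2 ht1)]
end

section
/- For all natural numbers t̄, t with 1 ≤ t̄ < t, there exist k ≤ 2·⌈log₂ t⌉ and a strictly decreasing sequence t = t₀ > t₁ > ⋯ > t_k = t̄ of natural numbers such that for every z ∈ {0, …, k−1} there is a natural number ℓ_z with 2^{ℓ_z} dividing t_z and t_{z+1} = t_z − 2^{ℓ_z}. -/
/-- `DyadicDescent k t s` says that `s` is reached from `t` in exactly `k` steps, each of which
subtracts from the current number a power of two dividing it. -/
inductive DyadicDescent : ℕ → ℕ → ℕ → Prop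
  | refl (t : ℕ) : DyadicDescent 0 t t
  | head {k t s u : ℕ} (ℓ : ℕ) (hdvd : 2 ^ ℓ ∣ t) (hstep : t = s + 2 ^ ℓ)
      (h : DyadicDescent k s u) : DyadicDescent (k + 1) t u

namespace DyadicDescent

theorem trans {j k t s u : ℕ} (h : DyadicDescent j t s) (h' : DyadicDescent k s u) :
    DyadicDescent (j + k) t u := by
  induction h with
  | refl => simpa using h'
  | head ℓ hdvd hstep _ ih =>
    rw [Nat.add_right_comm]
    exact head ℓ hdvd hstep (ih h')

theorem two_mul {k t s : ℕ} (h : DyadicDescent k t s) :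
    DyadicDescent k (2 * t) (2 * s) := by
  induction h with
  | refl => exact refl _
  | head ℓ hdvd hstep _ ih =>
    refine head (ℓ + 1) ?_ ?_ ih
    · rw [pow_succ']
      exact Nat.mul_dvd_mul_left 2 hdvd
    · rw [hstep, pow_succ', Nat.mul_add]

/-- At most one step is needed to get from a number to itself or to its predecessor. -/
theorem exists_le_one {t s : ℕ} (h : t = s ∨ t = s + 1) :
    ∃ k ≤ 1, DyadicDescent k t s := by
  rcases h with rfl | rfl
  · exact ⟨0, zero_le_one, refl _⟩
  · exact ⟨1, le_rfl, head 0 (by simp) (by simp) (refl _)⟩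

theorem exists_le_two_mul_clog {t s : ℕ} (hs : 1 ≤ s) (hst : s ≤ t) :
    ∃ k ≤ 2 * Nat.clog 2 t, DyadicDescent k t s := by
  induction t using Nat.strong_induction_on generalizing s with
  | _ t ih =>
    rcases hst.eq_or_lt with rfl | hlt
    · exact ⟨0, Nat.zero_le _, refl _⟩
    obtain ⟨k, hk, h⟩ := ih (t / 2) (by omega) (s := (s + 1) / 2) (by omega) (by omega)
    obtain ⟨i, hi, hfirst⟩ := exists_le_one (t := t) (s := 2 * (t / 2)) (by omega)
    obtain ⟨j, hj, hlast⟩ := exists_le_one (t := 2 * ((s + 1) / 2)) (s := s) (by omega)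
    refine ⟨i + (k + j), ?_, hfirst.trans (h.two_mul.trans hlast)⟩
    have hclog : Nat.clog 2 t = Nat.clog 2 ((t + 1) / 2) + 1 :=
      Nat.clog_of_two_le one_lt_two (by omega)
    have hmono : Nat.clog 2 (t / 2) ≤ Nat.clog 2 ((t + 1) / 2) :=
      Nat.clog_mono_right 2 (by omega)
    omega

theorem exists_sequence {k t s : ℕ} (h : DyadicDescent k t s) :
    ∃ ts : Fin (k + 1) → ℕ, ts 0 = t ∧ ts (Fin.last k) = s ∧
      ∀ z : Fin k, ∃ ℓ : ℕ, 2 ^ ℓ ∣ ts z.castSucc ∧ ts z.castSucc = ts z.succ + 2 ^ ℓ := by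
  induction h with
  | refl t => exact ⟨fun _ => t, rfl, rfl, fun z => z.elim0⟩
  | @head k t s u ℓ hdvd hstep _ ih =>
    obtain ⟨ts, hzero, hlast, hts⟩ := ih
    refine ⟨Fin.cons t ts, rfl, ?_, Fin.cases ⟨ℓ, ?_⟩ fun z => ?_⟩
    · rwa [← Fin.succ_last, Fin.cons_succ]
    · simpa [hzero] using And.intro hdvd hstep
    · simpa only [← Fin.succ_castSucc, Fin.cons_succ] using hts z

end DyadicDescent

/-- **Binary descent between two time steps.**  For naturals `1 ≤ t̄ < t` there is a
strictly decreasing sequence `t = t₀ > t₁ > ⋯ > t_k = t̄` with `k ≤ 2⌈log₂ t⌉` such that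
each step subtracts a power of two dividing the current term:
`2^{ℓ_z} ∣ t_z` and `t_{z+1} = t_z - 2^{ℓ_z}`. -/
theorem binary_descent (tbar t : ℕ) (h1 : 1 ≤ tbar) (h2 : tbar < t) :
    ∃ (k : ℕ) (ts : Fin (k + 1) → ℕ),
      k ≤ 2 * Nat.clog 2 t ∧
      ts 0 = t ∧
      ts (Fin.last k) = tbar ∧
      StrictAnti ts ∧
      ∀ z : Fin k, ∃ ℓ : ℕ, 2 ^ ℓ ∣ ts z.castSucc ∧ ts z.castSucc = ts z.succ + 2 ^ ℓ := by
  obtain ⟨k, hk, h⟩ := DyadicDescent.exists_le_two_mul_clog h1 h2.le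
  obtain ⟨ts, hzero, hlast, hts⟩ := h.exists_sequence
  refine ⟨k, ts, hk, hzero, hlast, Fin.strictAnti_iff_succ_lt.2 fun z => ?_, hts⟩
  obtain ⟨ℓ, -, hstep⟩ := hts z
  rw [hstep]
  exact Nat.lt_add_of_pos_right (Nat.two_pow_pos ℓ)
end

section
/- Let k, n ≥ 1 and let {I^{(1)}, …, I^{(k)}} be a partition of {1, …, n}. Let x̄, v̄ ∈ ℝ^k and define ḡ ∈ ℝ^k by ḡ_i := √|I^{(i)}|, and define x, v ∈ ℝ^n by x = Σ_{i=1}^k x̄_i·𝟙_{I^{(i)}} and v = Σ_{i=1}^k v̄_i·𝟙_{I^{(i)}} (so x_j = x̄_i and v_j = v̄_i whenever j ∈ I^{(i)}). Let ū ∈ ℝ^k attain the maximum of ⟨x̄·ḡ², w̄⟩ over {w̄ ∈ ℝ^k : ‖(ḡ·v̄)·w̄‖₂ + ‖w̄‖_∞ ≤ 1}, and define u := Σ_{i=1}^k ū_i·𝟙_{I^{(i)}} ∈ ℝ^n. Then u satisfies ‖v·u‖₂ + ‖u‖_∞ ≤ 1 and ⟨x, u⟩ = max{ ⟨x, w⟩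 : w ∈ ℝ^n, ‖v·w‖₂ + ‖w‖_∞ ≤ 1 }; that is, the lifted vector u is a maximizer of the full n-dimensional problem. -/
open Finset

/-- The average of `w` over the finite set `s` (zero if `s` is empty). -/
noncomputable def blockAverage {ι : Type*} (s : Finset ι) (w : ι → ℝ) : ℝ :=
  (∑ j ∈ s, w j) / s.card

theorem card_mul_blockAverage {ι : Type*} (s : Finset ι) (w : ι → ℝ) :
    s.card * blockAverage s w = ∑ j ∈ s, w j := by
  rcases s.eq_empty_or_nonempty with rfl | hs
  · simp
  · exact mul_div_cancel₀ _ (Nat.cast_ne_zero.2 hs.card_ne_zero)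

theorem card_mul_blockAverage_sq_le {ι : Type*} (s : Finset ι) (w : ι → ℝ) :
    s.card * blockAverage s w ^ 2 ≤ ∑ j ∈ s, w j ^ 2 := by
  rcases s.eq_empty_or_nonempty with rfl | hs
  · simp
  · have hpos : (0 : ℝ) < s.card := Nat.cast_pos.2 hs.card_pos
    refine le_of_mul_le_mul_left ?_ hpos
    calc (s.card : ℝ) * (s.card * blockAverage s w ^ 2)
        = (∑ j ∈ s, w j) ^ 2 := by rw [← card_mul_blockAverage]; ring
      _ ≤ s.card * ∑ j ∈ s, w j ^ 2 := sq_sum_le_card_mul_sum_sq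

theorem abs_blockAverage_le {ι : Type*} (s : Finset ι) (w : ι → ℝ) {M : ℝ} (hM : 0 ≤ M)
    (h : ∀ j, |w j| ≤ M) : |blockAverage s w| ≤ M := by
  rw [blockAverage, abs_div, Nat.abs_cast]
  refine div_le_of_le_mul₀ (Nat.cast_nonneg _) hM ?_
  calc |∑ j ∈ s, w j| ≤ ∑ j ∈ s, |w j| := abs_sum_le_sum_abs _ _
    _ ≤ ∑ _j ∈ s, M := sum_le_sum fun j _ => h j
    _ = M * s.card := by rw [sum_const, nsmul_eq_mul, mul_comm]

/-- **Lifting a low-dimensional maximizer of the mixed norm problem.**  Given a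
partition `I⁽¹⁾ ∪ ⋯ ∪ I⁽ᵏ⁾ = [n]`, block-constant vectors `x, v` built from `x̄, v̄`
with `ḡᵢ = √|I⁽ⁱ⁾|`, and `ū` a maximizer of `⟨x̄ḡ², w̄⟩` over
`{w̄ : ‖(ḡv̄)w̄‖₂ + ‖w̄‖_∞ ≤ 1}`, the lifted block-constant vector `u` is feasible for and
maximizes `⟨x, w⟩` over `{w : ‖vw‖₂ + ‖w‖_∞ ≤ 1}`. -/
theorem projected_flat
    {k n : ℕ} (hk : 0 < k) (hn : 0 < n)
    (I : Fin k → Finset (Fin n))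
    (hpart : ∀ j : Fin n, ∃! i : Fin k, j ∈ I i)
    (xb vb ub : Fin k → ℝ)
    (hubFeas : Real.sqrt (∑ i, (Real.sqrt ((I i).card) * vb i * ub i) ^ 2) +
        (⨆ i, |ub i|) ≤ 1)
    (hubMax : ∀ wb : Fin k → ℝ,
      Real.sqrt (∑ i, (Real.sqrt ((I i).card) * vb i * wb i) ^ 2) + (⨆ i, |wb i|) ≤ 1 →
      ∑ i, xb i * Real.sqrt ((I i).card) ^ 2 * wb i ≤
        ∑ i, xb i * Real.sqrt ((I i).card) ^ 2 * ub i)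
    (x v u : Fin n → ℝ)
    (hx : ∀ j, x j = ∑ i, if j ∈ I i then xb i else 0)
    (hv : ∀ j, v j = ∑ i, if j ∈ I i then vb i else 0)
    (hu : ∀ j, u j = ∑ i, if j ∈ I i then ub i else 0) :
    (Real.sqrt (∑ j, (v j * u j) ^ 2) + (⨆ j, |u j|) ≤ 1) ∧
    ∀ w : Fin n → ℝ, Real.sqrt (∑ j, (v j * w j) ^ 2) + (⨆ j, |w j|) ≤ 1 →
      ∑ j, x j * w j ≤ ∑ j, x j * u j := by
  choose f hf hfu using hpart
  have hf : ∀ i j, j ∈ I i ↔ f j = i :=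
    fun i j => ⟨fun h => (hfu j i h).symm, fun h => h ▸ hf j⟩
  have hx : ∀ j, x j = xb (f j) := fun j => by simp [hx, hf]
  have hv : ∀ j, v j = vb (f j) := fun j => by simp [hv, hf]
  have hu : ∀ j, u j = ub (f j) := fun j => by simp [hu, hf]
  have hsq : ∀ i, Real.sqrt ((I i).card) ^ 2 = (I i).card :=
    fun i => Real.sq_sqrt (Nat.cast_nonneg _)
  have hsum : ∀ F : Fin n → ℝ, ∑ j, F j = ∑ i, ∑ j ∈ I i, F j := fun F => by
    have hI : ∀ i, I i = univ.filter fun j => f j = i := fun i => by ext j; simp [hf]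
    simp_rw [hI]
    exact (sum_fiberwise _ _ _).symm
  have : Nonempty (Fin n) := ⟨⟨0, hn⟩⟩
  have : Nonempty (Fin k) := ⟨⟨0, hk⟩⟩
  have hnorm : Real.sqrt (∑ j, (v j * u j) ^ 2) =
      Real.sqrt (∑ i, (Real.sqrt ((I i).card) * vb i * ub i) ^ 2) := by
    congr 1
    rw [hsum]
    refine sum_congr rfl fun i _ => ?_
    rw [sum_congr rfl fun j hj => by rw [hv, hu, (hf i j).1 hj], sum_const, nsmul_eq_mul,
      mul_assoc, mul_pow (Real.sqrt _), hsq]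
  refine ⟨?_, fun w hw => ?_⟩
  · have hsup : (⨆ j, |u j|) ≤ ⨆ i, |ub i| :=
      ciSup_le fun j => hu j ▸ le_ciSup (f := fun i => |ub i|) (Finite.bddAbove_range _) (f j)
    linarith
  have hpair : ∀ y : Fin n → ℝ, ∑ j, x j * y j = ∑ i, xb i * ∑ j ∈ I i, y j := fun y => by
    rw [hsum]
    refine sum_congr rfl fun i _ => ?_
    rw [mul_sum]
    exact sum_congr rfl fun j hj => by rw [hx, (hf i j).1 hj]
  have hmax := hubMax (fun i => blockAverage (I i) w) <| by
    refine le_trans (add_le_add (Real.sqrt_le_sqrt ?_) ?_) hw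
    · rw [hsum]
      refine sum_le_sum fun i _ => ?_
      calc (Real.sqrt ((I i).card) * vb i * blockAverage (I i) w) ^ 2
          = vb i ^ 2 * ((I i).card * blockAverage (I i) w ^ 2) := by
            rw [mul_pow, mul_pow, hsq]; ring
        _ ≤ vb i ^ 2 * ∑ j ∈ I i, w j ^ 2 :=
            mul_le_mul_of_nonneg_left (card_mul_blockAverage_sq_le _ _) (sq_nonneg _)
        _ = ∑ j ∈ I i, (v j * w j) ^ 2 := by
            rw [mul_sum]
            exact sum_congr rfl fun j hj => by rw [hv, (hf i j).1 hj, mul_pow]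
    · exact ciSup_le fun i => abs_blockAverage_le _ _
        (Real.iSup_nonneg fun j => abs_nonneg (w j))
        fun j => le_ciSup (f := fun j => |w j|) (Finite.bddAbove_range _) j
  have hw_sum : ∑ j, x j * w j =
      ∑ i, xb i * Real.sqrt ((I i).card) ^ 2 * blockAverage (I i) w := by
    rw [hpair]
    exact sum_congr rfl fun i _ => by rw [hsq, mul_assoc, card_mul_blockAverage]
  have hu_sum : ∑ j, x j * u j = ∑ i, xb i * Real.sqrt ((I i).card) ^ 2 * ub i := by
    rw [hpair]
    refine sum_congr rfl fun i _ => ?_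
    rw [sum_congr rfl fun j hj => by rw [hu, (hf i j).1 hj], sum_const, nsmul_eq_mul, hsq,
      mul_assoc]
  rw [hw_sum, hu_sum]
  exact hmax
end

section
/- Let W be a positive integer and let Π = (G, b, c) be a minimum-cost flow instance, where G is a directed graph with m edges, b ∈ {−W, …, W}^V is the demand vector, and c ∈ {−W, …, W}^E is the cost vector. Assume that an optimal (minimum-cost) feasible flow for Π exists and that every optimal feasible flow for Π has congestion at most W. Let the perturbed instance be Π̃ = (G, b, c̃) with c̃_e = c_e + z_e, where the z_e are independent and uniformly distributed over the set { 1/(4m²W²), 2/(4m²W²), …, (2mW)/(4m²W²) }. Let f̃ be any feasible (possibly fractional) flow for Π̃ whose cost satisfies c̃ᵀf̃ ≤ OPT(Π̃) + 1/(12m²W³), where OPT(Π̃) is the minimum cost of a feasible flow for Π̃, and let f be obtained from f̃ by rounding each coordinate to the nearest integer. Then, with probability at least 1/2 over the choice of the z_e, f is an optimal feasible flow for Π. -/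
open Finset

/-- `f : E → ℝ` is a feasible flow in the directed graph with edges `e = (tail e, head e)`
and integral demand vector `b`: it is nonnegative and satisfies the conservation
constraints `Aᵀf = b`. -/
def FlowFeasible {V : Type*} [Fintype V] [DecidableEq V] {m : ℕ}
    (head tail : Fin m → V) (b : V → ℤ) (f : Fin m → ℝ) : Prop :=
  (∀ e, 0 ≤ f e) ∧
  ∀ v : V, (∑ e, if head e = v then f e else 0) - (∑ e, if tail e = v then f e else 0) =
    (b v : ℝ)

/-- The cost `cᵀ f` of a flow. -/
def FlowCost {m : ℕ} (c : Fin m → ℝ) (f : Fin m → ℝ) : ℝ := ∑ e, c e * f e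

/-- A feasible flow is optimal if it minimizes the cost among all feasible flows. -/
def FlowOptimal {V : Type*} [Fintype V] [DecidableEq V] {m : ℕ}
    (head tail : Fin m → V) (b : V → ℤ) (c : Fin m → ℝ) (f : Fin m → ℝ) : Prop :=
  FlowFeasible head tail b f ∧
    ∀ g : Fin m → ℝ, FlowFeasible head tail b g → FlowCost c f ≤ FlowCost c g

/-- The entry of the edge-vertex incidence matrix at edge `e` and vertex `v`. -/
def incidence {V E : Type*} [DecidableEq V] (head tail : E → V) (e : E) (v : V) : ℤ :=
  (if head e = v then 1 else 0) - (if tail e = v then 1 else 0)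

lemma sum_incidence {V E : Type*} [Fintype V] [DecidableEq V] (head tail : E → V) (e : E) :
    ∑ v, incidence head tail e v = 0 := by
  simp [incidence]

lemma incidence_eq_zero {V E : Type*} [DecidableEq V] (head tail : E → V) {e : E} {v : V}
    (h : ¬ (head e = v ∨ tail e = v)) :
    incidence head tail e v = 0 := by
  rw [not_or] at h
  simp [incidence, h.1, h.2]

/-- Moving along a nonzero direction supported on fractional coordinates, one can make a further
coordinate integral without crossing an integer in any coordinate. -/
lemma exists_step_to_integer {E : Type*} [Fintype E] (x w : E → ℝ) (hw0 : w ≠ 0)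
    (hw : ∀ e, Int.fract (x e) = 0 → w e = 0) :
    ∃ t : ℝ, 0 ≤ t ∧ (∀ e, (⌊x e⌋ : ℝ) ≤ x e + t * w e ∧ x e + t * w e ≤ ⌈x e⌉) ∧
      ∃ e, Int.fract (x e) ≠ 0 ∧ Int.fract (x e + t * w e) = 0 := by
  let r : E → ℝ := fun e => if 0 < w e then (⌈x e⌉ : ℝ) else ⌊x e⌋
  let s : E → ℝ := fun e => (r e - x e) / w e
  obtain ⟨e₁, he₁⟩ : ∃ e, w e ≠ 0 := Function.ne_iff.1 hw0
  obtain ⟨e₀, he₀, hmin⟩ := Finset.exists_min_image ({e | w e ≠ 0} : Finset E) s ⟨e₁, by simp [he₁]⟩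
  simp only [Finset.mem_filter, Finset.mem_univ, true_and] at he₀ hmin
  have hs0 : 0 ≤ s e₀ := by
    simp only [s, r]
    split_ifs with h
    · exact div_nonneg (sub_nonneg.2 (Int.le_ceil _)) h.le
    · exact div_nonneg_of_nonpos (sub_nonpos.2 (Int.floor_le _)) (not_lt.1 h)
  refine ⟨s e₀, hs0, fun e => ?_, e₀, fun h => he₀ (hw e₀ h), ?_⟩
  · have hfl := Int.floor_le (x e)
    have hcl := Int.le_ceil (x e)
    rcases lt_trichotomy (w e) 0 with h | h | h
    · have h1 := hmin e h.ne
      have h2 : s e * w e = ⌊x e⌋ - x e := by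
        simp only [s, r, not_lt.2 h.le, if_false]
        exact div_mul_cancel₀ _ h.ne
      have h3 := mul_le_mul_of_nonpos_right h1 h.le
      have h4 := mul_nonpos_of_nonneg_of_nonpos hs0 h.le
      constructor <;> linarith
    · rw [h, mul_zero, add_zero]
      exact ⟨hfl, hcl⟩
    · have h1 := hmin e h.ne'
      have h2 : s e * w e = ⌈x e⌉ - x e := by
        simp only [s, r, h, if_true]
        exact div_mul_cancel₀ _ h.ne'
      have h3 := mul_le_mul_of_nonneg_right h1 h.le
      have h4 := mul_nonneg hs0 h.le
      constructor <;> linarith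
  · have h2 : s e₀ * w e₀ = r e₀ - x e₀ := div_mul_cancel₀ _ he₀
    rw [h2, add_sub_cancel]
    simp only [r]
    split_ifs <;> simp

section Incidence

variable {V E : Type*} [Fintype V] [DecidableEq V] [Fintype E] [DecidableEq E]
  (head tail : E → V)

/-- A nonempty set of edges such that no vertex is incident to exactly one of them
supports a nonzero circulation. -/
lemma exists_circulation_of_degree_ne_one (F : Finset E) (hF : F.Nonempty)
    (hdeg : ∀ v, #{e ∈ F | head e = v ∨ tail e = v} ≠ 1) :
    ∃ w : E → ℝ, w ≠ 0 ∧ (∀ e ∉ F, w e = 0) ∧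
      ∀ v, ∑ e, (incidence head tail e v : ℝ) * w e = 0 := by
  set U : Finset V := F.image head ∪ F.image tail with hU
  have hcard : #U ≤ #F := by
    have h1 := Finset.sum_card_bipartiteAbove_eq_sum_card_bipartiteBelow
      (s := U) (t := F) (fun v e => head e = v ∨ tail e = v)
    have h2 : #U • 2 ≤ ∑ v ∈ U, #(F.bipartiteAbove (fun v e => head e = v ∨ tail e = v) v) := by
      refine Finset.card_nsmul_le_sum _ _ _ fun v hv => ?_
      have h3 : 0 < #{e ∈ F | head e = v ∨ tail e = v} := by
        rw [Finset.card_pos]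
        simp only [hU, Finset.mem_union, Finset.mem_image] at hv
        rcases hv with ⟨e, he, h⟩ | ⟨e, he, h⟩
        · exact ⟨e, by simp [he, h]⟩
        · exact ⟨e, by simp [he, h]⟩
      have h4 := hdeg v
      simp only [Finset.bipartiteAbove]
      omega
    have h3 : ∑ e ∈ F, #(U.bipartiteBelow (fun v e => head e = v ∨ tail e = v) e) ≤ #F • 2 := by
      refine Finset.sum_le_card_nsmul _ _ _ fun e _ => ?_
      refine (Finset.card_le_card (t := {head e, tail e}) fun v hv => ?_).trans
        Finset.card_le_two
      simp only [Finset.bipartiteBelow, Finset.mem_filter] at hv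
      simp only [Finset.mem_insert, Finset.mem_singleton]
      exact hv.2.imp Eq.symm Eq.symm
    simp only [smul_eq_mul] at h2 h3
    omega
  obtain ⟨e₀, he₀⟩ := hF
  set v₀ := head e₀
  have hv₀ : v₀ ∈ U := by
    rw [hU, Finset.mem_union]
    exact Or.inl (Finset.mem_image_of_mem _ he₀)
  let T : (F → ℝ) →ₗ[ℝ] (↥(U.erase v₀) → ℝ) :=
    Matrix.mulVecLin (Matrix.of fun v e => (incidence head tail e.1 v.1 : ℝ))
  have hker : LinearMap.ker T ≠ ⊥ := by
    apply LinearMap.ker_ne_bot_of_finrank_lt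
    have hpos := Finset.card_pos.2 ⟨v₀, hv₀⟩
    simp only [Module.finrank_fintype_fun_eq_card, Fintype.card_coe,
      Finset.card_erase_of_mem hv₀]
    omega
  obtain ⟨u, hu, hu0⟩ := (Submodule.ne_bot_iff _).1 hker
  let w : E → ℝ := fun e => if h : e ∈ F then u ⟨e, h⟩ else 0
  have hw : ∀ e ∉ F, w e = 0 := fun e he => by simp [w, he]
  have hsum : ∀ v, ∑ e, (incidence head tail e v : ℝ) * w e
      = ∑ e : F, (incidence head tail e.1 v : ℝ) * u e := by
    intro v
    rw [← Finset.sum_subset (Finset.subset_univ F)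
      (fun e _ he => by rw [hw e he, mul_zero]), ← Finset.sum_coe_sort]
    exact Finset.sum_congr rfl fun e _ => by simp [w]
  have hne : ∀ v, v ≠ v₀ → ∑ e, (incidence head tail e v : ℝ) * w e = 0 := by
    intro v hv
    by_cases hvU : v ∈ U
    · have := congrFun (LinearMap.mem_ker.1 hu) ⟨v, Finset.mem_erase.2 ⟨hv, hvU⟩⟩
      rw [hsum]
      simpa [T, Matrix.mulVec, dotProduct] using this
    · refine Finset.sum_eq_zero fun e _ => ?_
      by_cases he : e ∈ F
      · rw [incidence_eq_zero, Int.cast_zero, zero_mul]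
        rintro (h | h)
        · exact hvU (by rw [hU, ← h]; exact Finset.mem_union_left _ (Finset.mem_image_of_mem _ he))
        · exact hvU (by rw [hU, ← h]; exact Finset.mem_union_right _ (Finset.mem_image_of_mem _ he))
      · rw [hw e he, mul_zero]
  refine ⟨w, fun h0 => hu0 ?_, hw, fun v => ?_⟩
  · ext ⟨e, he⟩
    simpa [w, he] using congrFun h0 e
  · by_cases hv : v = v₀
    · have htot : ∑ v, ∑ e, (incidence head tail e v : ℝ) * w e = 0 := by
        rw [Finset.sum_comm]
        refine Finset.sum_eq_zero fun e _ => ?_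
        rw [← Finset.sum_mul, ← Int.cast_sum, sum_incidence, Int.cast_zero, zero_mul]
      rw [Finset.sum_eq_single v₀ (fun v _ h => hne v h) (by simp)] at htot
      rw [hv, htot]
    · exact hne v hv

/-- If `x` has integral net flows but is not integral, then some nonzero circulation is supported
on the fractional coordinates of `x`. -/
lemma exists_circulation_of_fractional (b : V → ℤ) (x : E → ℝ)
    (hx : ∀ v, ∑ e, (incidence head tail e v : ℝ) * x e = b v)
    (hfrac : ∃ e, Int.fract (x e) ≠ 0) :
    ∃ w : E → ℝ, w ≠ 0 ∧ (∀ e, Int.fract (x e) = 0 → w e = 0) ∧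
      ∀ v, ∑ e, (incidence head tail e v : ℝ) * w e = 0 := by
  by_cases hl : ∃ e, Int.fract (x e) ≠ 0 ∧ head e = tail e
  · obtain ⟨e, he, hloop⟩ := hl
    refine ⟨Pi.single e 1, by simp, fun e' he' => ?_, fun v => ?_⟩
    · refine Pi.single_eq_of_ne ?_ _
      rintro rfl
      exact he he'
    · rw [Finset.sum_eq_single e (fun e' _ h => by simp [h]) (by simp)]
      simp [incidence, hloop]
  · push Not at hl
    set F : Finset E := {e | Int.fract (x e) ≠ 0} with hF
    have hmem : ∀ e, e ∈ F ↔ Int.fract (x e) ≠ 0 := fun e => by simp [hF]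
    obtain ⟨w, hw0, hwF, hw⟩ := exists_circulation_of_degree_ne_one head tail F
      (hfrac.imp fun e he => (hmem e).2 he) (by
        intro v hv
        obtain ⟨e₀, he₀⟩ := Finset.card_eq_one.1 hv
        have h0 : e₀ ∈ ({e ∈ F | head e = v ∨ tail e = v} : Finset E) := by simp [he₀]
        rw [Finset.mem_filter] at h0
        have hint : ∀ e, e ≠ e₀ → (incidence head tail e v : ℝ) * x e
            = ((incidence head tail e v * ⌊x e⌋ : ℤ) : ℝ) := by
          intro e hne
          push_cast
          by_cases he : e ∈ F
          · rw [incidence_eq_zero]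
            · simp
            · intro h
              have h1 : e ∈ ({e ∈ F | head e = v ∨ tail e = v} : Finset E) :=
                Finset.mem_filter.2 ⟨he, h⟩
              rw [he₀, Finset.mem_singleton] at h1
              exact hne h1
          · rw [hmem, not_not] at he
            have := Int.floor_add_fract (x e)
            rw [he, add_zero] at this
            rw [this]
        have hsum := hx v
        rw [← Finset.add_sum_erase _ _ (Finset.mem_univ e₀),
          Finset.sum_congr rfl fun e he => hint e (Finset.ne_of_mem_erase he),
          ← Int.cast_sum] at hsum
        apply (hmem e₀).1 h0.1
        have hl' := hl e₀ ((hmem e₀).1 h0.1)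
        rw [Int.fract_eq_iff]
        refine ⟨le_rfl, one_pos, ?_⟩
        set k := ∑ e ∈ Finset.univ.erase e₀, incidence head tail e v * ⌊x e⌋
        rcases h0.2 with h | h
        · have h' : tail e₀ ≠ v := fun h' => hl' (h.trans h'.symm)
          simp only [incidence, h, h', if_true, if_false] at hsum
          refine ⟨b v - k, ?_⟩
          push_cast at hsum ⊢
          linarith
        · have h' : head e₀ ≠ v := fun h' => hl' (h'.trans h.symm)
          simp only [incidence, h, h', if_true, if_false] at hsum
          refine ⟨k - b v, ?_⟩
          push_cast at hsum ⊢
          linarith)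
    exact ⟨w, hw0, fun e he => hwF e (by simp [hmem, he]), hw⟩

/-- A real vector with integral net flows can be rounded, coordinatewise to its floor or ceiling,
to an integral vector with the same net flows, without increasing a given linear functional. -/
lemma exists_integral_rounding (b : V → ℤ) (L : E → ℝ) (x : E → ℝ)
    (hx : ∀ v, ∑ e, (incidence head tail e v : ℝ) * x e = b v) :
    ∃ y : E → ℤ, (∀ v, ∑ e, incidence head tail e v * y e = b v) ∧
      (∀ e, ⌊x e⌋ ≤ y e ∧ y e ≤ ⌈x e⌉) ∧ ∑ e, L e * y e ≤ ∑ e, L e * x e := by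
  induction hn : #{e | Int.fract (x e) ≠ 0} using Nat.strong_induction_on generalizing x with
  | _ n ih =>
  by_cases hfrac : ∃ e, Int.fract (x e) ≠ 0
  · obtain ⟨w, hw0, hwx, hw, hLw⟩ : ∃ w : E → ℝ, w ≠ 0 ∧ (∀ e, Int.fract (x e) = 0 → w e = 0) ∧
        (∀ v, ∑ e, (incidence head tail e v : ℝ) * w e = 0) ∧ ∑ e, L e * w e ≤ 0 := by
      obtain ⟨w, hw0, hwx, hw⟩ := exists_circulation_of_fractional head tail b x hx hfrac
      rcases le_total (∑ e, L e * w e) 0 with h | h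
      · exact ⟨w, hw0, hwx, hw, h⟩
      · refine ⟨-w, neg_ne_zero.2 hw0, fun e he => by simp [hwx e he], fun v => ?_, ?_⟩
        · simp [hw v]
        · simpa using h
    obtain ⟨t, ht, hbox, e₀, he₀, he₀'⟩ := exists_step_to_integer x w hw0 hwx
    have hx' : ∀ v, ∑ e, (incidence head tail e v : ℝ) * (x e + t * w e) = b v := by
      intro v
      simp only [mul_add, Finset.sum_add_distrib, hx v, mul_left_comm _ t, ← Finset.mul_sum,
        hw v, mul_zero, add_zero]
    have hlt : #{e | Int.fract (x e + t * w e) ≠ 0} < n := by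
      rw [← hn]
      refine Finset.card_lt_card (Finset.ssubset_iff_of_subset ?_ |>.2 ⟨e₀, ?_, ?_⟩)
      · intro e he
        simp only [Finset.mem_filter, Finset.mem_univ, true_and] at he ⊢
        intro h
        rw [hwx e h, mul_zero, add_zero] at he
        exact he h
      · simpa using he₀
      · simpa using he₀'
    obtain ⟨y, hy, hyb, hyL⟩ := ih _ hlt _ hx' rfl
    refine ⟨y, hy, fun e => ⟨(Int.le_floor.2 (hbox e).1).trans (hyb e).1,
      (hyb e).2.trans (Int.ceil_le.2 (hbox e).2)⟩, hyL.trans ?_⟩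
    simp only [mul_add, Finset.sum_add_distrib, mul_left_comm _ t, ← Finset.mul_sum]
    linarith [mul_nonpos_of_nonneg_of_nonpos ht hLw]
  · push Not at hfrac
    have hfl : ∀ e, (⌊x e⌋ : ℝ) = x e := fun e => by
      have := Int.floor_add_fract (x e)
      rwa [hfrac e, add_zero] at this
    refine ⟨fun e => ⌊x e⌋, fun v => ?_, fun e => ⟨le_rfl, Int.floor_le_ceil _⟩, ?_⟩
    · have h : ∑ e, (incidence head tail e v : ℝ) * (⌊x e⌋ : ℝ) = b v := by
        simpa only [hfl] using hx v
      exact_mod_cast h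
    · simp only [hfl, le_refl]

/-- An integral vector that is optimal among nonnegative integral vectors with the given net flows
is optimal among all such real vectors. -/
lemma cost_le_of_integral_optimal (b : V → ℤ) (C : E → ℝ) (y₀ : E → ℤ)
    (hmin : ∀ y : E → ℤ, (∀ e, 0 ≤ y e) → (∀ v, ∑ e, incidence head tail e v * y e = b v) →
      ∑ e, C e * y₀ e ≤ ∑ e, C e * y e)
    (x : E → ℝ) (hx0 : ∀ e, 0 ≤ x e)
    (hx : ∀ v, ∑ e, (incidence head tail e v : ℝ) * x e = b v) :
    ∑ e, C e * y₀ e ≤ ∑ e, C e * x e := by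
  obtain ⟨y, hy, hyb, hyL⟩ := exists_integral_rounding head tail b C x hx
  exact (hmin y (fun e => (Int.floor_nonneg.2 (hx0 e)).trans (hyb e).1) hy).trans hyL

/-- If an integral vector beats every other integral vector by at least one, then every
real vector that is optimal up to `1/3` rounds to it. -/
lemma round_eq_of_cost_le (b : V → ℤ) (C : E → ℝ) (y₀ : E → ℤ)
    (hgap : ∀ y : E → ℤ, (∀ e, 0 ≤ y e) → (∀ v, ∑ e, incidence head tail e v * y e = b v) →
      y ≠ y₀ → ∑ e, C e * y₀ e + 1 ≤ ∑ e, C e * y e)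
    (x : E → ℝ) (hx0 : ∀ e, 0 ≤ x e)
    (hx : ∀ v, ∑ e, (incidence head tail e v : ℝ) * x e = b v)
    (hcost : ∑ e, C e * x e ≤ ∑ e, C e * y₀ e + 1 / 3) (e : E) :
    round (x e) = y₀ e := by
  have hround : ∀ L : E → ℝ, ∃ y : E → ℤ, (∀ e, ⌊x e⌋ ≤ y e ∧ y e ≤ ⌈x e⌉) ∧
      ∑ e, L e * y e ≤ ∑ e, L e * x e ∧ (y = y₀ ∨ ∑ e, C e * y₀ e + 1 ≤ ∑ e, C e * y e) := by
    intro L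
    obtain ⟨y, hy, hyb, hyL⟩ := exists_integral_rounding head tail b L x hx
    refine ⟨y, hyb, hyL, or_iff_not_imp_left.2 ?_⟩
    exact hgap y (fun e => (Int.floor_nonneg.2 (hx0 e)).trans (hyb e).1) hy
  have hbox : ⌊x e⌋ ≤ y₀ e ∧ y₀ e ≤ ⌈x e⌉ := by
    obtain ⟨y, hyb, hyL, rfl | h⟩ := hround C
    · exact hyb e
    · linarith
  have hshift : ∀ (s : ℝ) (z : E → ℝ),
      ∑ e', (C + Pi.single e s : E → ℝ) e' * z e' = ∑ e', C e' * z e' + s * z e := by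
    intro s z
    simp only [Pi.add_apply, add_mul, Finset.sum_add_distrib]
    rw [Finset.sum_eq_single (f := fun e' => (Pi.single e s : E → ℝ) e' * z e') e
      (fun e' _ h => by simp [h]) (by simp), Pi.single_eq_same]
  have hfl := Int.floor_le (x e)
  have hfl' := Int.lt_floor_add_one (x e)
  have hcl : (⌈x e⌉ : ℝ) ≤ ⌊x e⌋ + 1 := by exact_mod_cast Int.ceil_le_floor_add_one (x e)
  have hclx := Int.le_ceil (x e)
  have hupper : x e ≤ y₀ e + 1 / 3 := by
    obtain ⟨y, hyb, hyL, hy⟩ := hround (C + Pi.single e (-1))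
    rw [hshift, hshift] at hyL
    rcases hy with rfl | h
    · linarith
    · have h1 : (y e : ℝ) ≤ ⌈x e⌉ := by exact_mod_cast (hyb e).2
      have h2 : (⌊x e⌋ : ℝ) ≤ y₀ e := by exact_mod_cast hbox.1
      linarith
  have hlower : y₀ e - 1 / 3 ≤ x e := by
    obtain ⟨y, hyb, hyL, hy⟩ := hround (C + Pi.single e 1)
    rw [hshift, hshift] at hyL
    rcases hy with rfl | h
    · linarith
    · have h1 : (⌊x e⌋ : ℝ) ≤ y e := by exact_mod_cast (hyb e).1
      have h2 : (y₀ e : ℝ) ≤ ⌈x e⌉ := by exact_mod_cast hbox.2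
      linarith
  rw [round_eq, Int.floor_eq_iff]
  constructor <;> linarith

end Incidence

section Isolation

variable {E : Type*} [Fintype E] [DecidableEq E] {N : ℕ}

/-- The weight of `y` under the positive integral weights `ω e + 1`. -/
def perturbWeight (ω : E → Fin N) (y : E → ℤ) : ℤ := ∑ e, (((ω e : ℕ) : ℤ) + 1) * y e

lemma perturbWeight_update (ω : E → Fin N) (e : E) (a : Fin N) (y : E → ℤ) :
    perturbWeight (Function.update ω e a) y
      = perturbWeight ω y + (((a : ℕ) : ℤ) - ((ω e : ℕ) : ℤ)) * y e := by
  unfold perturbWeight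
  rw [← Finset.add_sum_erase _ _ (Finset.mem_univ e),
    ← Finset.add_sum_erase _ (fun e => (((ω e : ℕ) : ℤ) + 1) * y e) (Finset.mem_univ e),
    Function.update_self, Finset.sum_congr rfl fun e' he' => by
      rw [Function.update_of_ne (Finset.ne_of_mem_erase he')]]
  ring

/-- The weights for which two minimizers over `S` differ in coordinate `e`. -/
def ambiguousAt (N : ℕ) (S : Set (E → ℤ)) (e : E) : Set (E → Fin N) :=
  {ω | ∃ y ∈ S, ∃ y' ∈ S, IsMinOn (perturbWeight ω) S y ∧ IsMinOn (perturbWeight ω) S y' ∧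
    y e < y' e}

lemma card_ambiguousAt_mul_le (S : Set (E → ℤ)) (W : ℕ)
    (hS : ∀ y ∈ S, ∀ e, 0 ≤ y e ∧ y e ≤ W) (e : E) :
    Nat.card (ambiguousAt N S e) * N ≤ N ^ Fintype.card E * W := by
  choose! y hy y' hy' hmin hmin' hlt using
    fun (ω : E → Fin N) (h : ω ∈ ambiguousAt N S e) => h
  have hk : ∀ ω ∈ ambiguousAt N S e, (y' ω e - 1).toNat < W := by
    intro ω hω
    have h1 := hS _ (hy ω hω) e
    have h2 := hS _ (hy' ω hω) e
    have h3 := hlt ω hω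
    omega
  have key : ∀ ω₁ ∈ ambiguousAt N S e, ∀ ω₂ ∈ ambiguousAt N S e, ∀ a,
      ω₂ = Function.update ω₁ e a → ω₁ e < a → y' ω₂ e < y' ω₁ e := by
    intro ω₁ h₁ ω₂ h₂ a ha hlt'
    have i1 := isMinOn_iff.1 (hmin ω₁ h₁) _ (hy' ω₂ h₂)
    have i2 := isMinOn_iff.1 (hmin' ω₂ h₂) _ (hy ω₁ h₁)
    rw [ha, perturbWeight_update, perturbWeight_update, ← ha] at i2
    have hpos : (0 : ℤ) < ((a : ℕ) : ℤ) - ((ω₁ e : ℕ) : ℤ) := by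
      have : (ω₁ e : ℕ) < (a : ℕ) := hlt'
      omega
    have h3 : y' ω₂ e ≤ y ω₁ e := by nlinarith
    exact h3.trans_lt (hlt ω₁ h₁)
  let φ : ambiguousAt N S e × Fin N → (E → Fin N) × Fin W := fun p =>
    (Function.update p.1.1 e p.2, ⟨(y' p.1.1 e - 1).toNat, hk _ p.1.2⟩)
  have hφ : Function.Injective φ := by
    rintro ⟨⟨ω₁, h₁⟩, a₁⟩ ⟨⟨ω₂, h₂⟩, a₂⟩ h
    simp only [φ, Prod.mk.injEq, Fin.mk.injEq] at h
    obtain ⟨hu, hval⟩ := h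
    have ha : a₁ = a₂ := by simpa using congrFun hu e
    have hoff : ∀ e', e' ≠ e → ω₁ e' = ω₂ e' := fun e' he' => by
      simpa [he'] using congrFun hu e'
    have hval' : y' ω₁ e = y' ω₂ e := by
      have h1 := hS _ (hy ω₁ h₁) e
      have h2 := hS _ (hy ω₂ h₂) e
      have h3 := hlt ω₁ h₁
      have h4 := hlt ω₂ h₂
      omega
    have hupd : ∀ α β : E → Fin N, (∀ e', e' ≠ e → α e' = β e') →
        β = Function.update α e (β e) := by
      intro α β h
      rw [Function.eq_update_iff]
      exact ⟨rfl, fun e' he' => (h e' he').symm⟩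
    have he : ω₁ e = ω₂ e := by
      rcases lt_trichotomy (ω₁ e) (ω₂ e) with h | h | h
      · exact absurd hval' (key ω₁ h₁ ω₂ h₂ _ (hupd _ _ hoff) h).ne'
      · exact h
      · exact absurd hval'
          (key ω₂ h₂ ω₁ h₁ _ (hupd _ _ fun e' he' => (hoff e' he').symm) h).ne
    have hω : ω₁ = ω₂ := by
      ext1 e'
      by_cases h : e' = e
      · rw [h, he]
      · exact hoff e' h
    subst hω ha
    rfl
  simpa [Nat.card_prod, Nat.card_fun] using Nat.card_le_card_of_injective φ hφ

/-- **Isolation lemma.** For vectors in `{0, …, W}^E` and uniform weights from `{1, …, 2|E|W}`,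
minimizers are unique with probability at least `1/2`. -/
lemma two_mul_card_unique_minimizer_ge [Nonempty E] (S : Set (E → ℤ)) (W : ℕ) (hW : 0 < W)
    (hS : ∀ y ∈ S, ∀ e, 0 ≤ y e ∧ y e ≤ W) (hN : N = 2 * Fintype.card E * W) :
    N ^ Fintype.card E ≤ 2 * Nat.card {ω : E → Fin N | ∀ y ∈ S, ∀ y' ∈ S,
      IsMinOn (perturbWeight ω) S y → IsMinOn (perturbWeight ω) S y' → y = y'} := by
  set G : Set (E → Fin N) := {ω | ∀ y ∈ S, ∀ y' ∈ S,
      IsMinOn (perturbWeight ω) S y → IsMinOn (perturbWeight ω) S y' → y = y'} with hG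
  have hsub : Gᶜ ⊆ ⋃ e, ambiguousAt N S e := by
    intro ω hω
    simp only [hG, Set.mem_compl_iff, Set.mem_ofPred_eq, not_forall] at hω
    obtain ⟨y, hy, y', hy', h, h', hne⟩ := hω
    obtain ⟨e, he⟩ := Function.ne_iff.1 hne
    refine Set.mem_iUnion.2 ⟨e, ?_⟩
    rcases lt_or_gt_of_ne he with hlt | hlt
    · exact ⟨y, hy, y', hy', h, h', hlt⟩
    · exact ⟨y', hy', y, hy, h', h, hlt⟩
  have hbad : Nat.card (Gᶜ : Set _) * N ≤ Fintype.card E * (N ^ Fintype.card E * W) := by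
    have h1 : Nat.card (Gᶜ : Set _) ≤ ∑ e, Nat.card (ambiguousAt N S e) := by
      simp only [Nat.card_coe_set_eq]
      refine (Set.ncard_le_ncard hsub (Set.toFinite _)).trans ?_
      simpa using Finset.set_ncard_biUnion_le Finset.univ (ambiguousAt N S)
    calc Nat.card (Gᶜ : Set _) * N ≤ (∑ e, Nat.card (ambiguousAt N S e)) * N :=
          Nat.mul_le_mul_right _ h1
      _ = ∑ e, Nat.card (ambiguousAt N S e) * N := Finset.sum_mul _ _ _
      _ ≤ ∑ _e : E, N ^ Fintype.card E * W :=
          Finset.sum_le_sum fun e _ => card_ambiguousAt_mul_le S W hS e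
      _ = _ := by simp
  have htot : Nat.card G + Nat.card (Gᶜ : Set _) = N ^ Fintype.card E := by
    simp only [Nat.card_coe_set_eq]
    rw [Set.ncard_add_ncard_compl]
    simp
  have hpos : 0 < Fintype.card E * W := Nat.mul_pos Fintype.card_pos hW
  have h2 : 2 * Nat.card (Gᶜ : Set _) ≤ N ^ Fintype.card E := by
    refine Nat.le_of_mul_le_mul_left ?_ hpos
    calc Fintype.card E * W * (2 * Nat.card (Gᶜ : Set _)) = Nat.card (Gᶜ : Set _) * (2 * Fintype.card E * W) := by
          ring
      _ = Nat.card (Gᶜ : Set _) * N := congrArg _ hN.symm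
      _ ≤ _ := hbad
      _ = _ := by ring
  omega

end Isolation

lemma flowFeasible_iff {V : Type*} [Fintype V] [DecidableEq V] {m : ℕ}
    (head tail : Fin m → V) (b : V → ℤ) (f : Fin m → ℝ) :
    FlowFeasible head tail b f ↔
      (∀ e, 0 ≤ f e) ∧ ∀ v, ∑ e, (incidence head tail e v : ℝ) * f e = b v := by
  simp [FlowFeasible, incidence, sub_mul, Finset.sum_sub_distrib]

lemma flowFeasible_intCast_iff {V : Type*} [Fintype V] [DecidableEq V] {m : ℕ}
    (head tail : Fin m → V) (b : V → ℤ) (y : Fin m → ℤ) :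
    FlowFeasible head tail b (fun e => (y e : ℝ)) ↔
      (∀ e, 0 ≤ y e) ∧ ∀ v, ∑ e, incidence head tail e v * y e = b v := by
  rw [flowFeasible_iff]
  refine and_congr (by simp) (forall_congr' fun v => ?_)
  norm_cast

lemma exists_integral_flowOptimal {V : Type*} [Fintype V] [DecidableEq V] {m : ℕ}
    (head tail : Fin m → V) (b : V → ℤ) (c : Fin m → ℝ)
    (hopt : ∃ f : Fin m → ℝ, FlowOptimal head tail b c f) :
    ∃ y : Fin m → ℤ, FlowOptimal head tail b c (fun e => (y e : ℝ)) := by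
  obtain ⟨f, hf, hmin⟩ := hopt
  have hf' := (flowFeasible_iff head tail b f).1 hf
  obtain ⟨y, hy, hyb, hyL⟩ := exists_integral_rounding head tail b c f hf'.2
  refine ⟨y, (flowFeasible_intCast_iff head tail b y).2
    ⟨fun e => (Int.floor_nonneg.2 (hf'.1 e)).trans (hyb e).1, hy⟩, fun g hg => ?_⟩
  exact hyL.trans (hmin g hg)

/-- The cost, scaled by `M`, of an integral vector under the costs `c e + (ω e + 1) / M`. -/
lemma sum_scaled_cost {m N : ℕ} (M : ℤ) (c : Fin m → ℤ) (ω : Fin m → Fin N) (y : Fin m → ℤ) :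
    ∑ e, ((M * c e + (((ω e : ℕ) : ℤ) + 1) : ℤ) : ℝ) * y e
      = ((M * ∑ e, c e * y e + perturbWeight ω y : ℤ) : ℝ) := by
  unfold perturbWeight
  rw [Finset.mul_sum, ← Finset.sum_add_distrib]
  push_cast
  exact Finset.sum_congr rfl fun e _ => by ring

/-- If the perturbation has total effect less than `M` on bounded vectors, a unique minimizer of
the perturbation among the optimal integral flows beats every other integral flow under the scaled
perturbed costs by at least one. -/
lemma scaled_cost_gap {V : Type*} [Fintype V] [DecidableEq V] {m N W : ℕ}
    (head tail : Fin m → V) (b : V → ℤ) (c : Fin m → ℤ) (M : ℤ) (hM : m * (N * W) < M)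
    (ω : Fin m → Fin N) (y₀ : Fin m → ℤ)
    (hW : ∀ e, y₀ e ≤ W)
    (hopt : FlowOptimal head tail b (fun e => (c e : ℝ)) (fun e => (y₀ e : ℝ)))
    (huniq : ∀ y : Fin m → ℤ, FlowOptimal head tail b (fun e => (c e : ℝ)) (fun e => (y e : ℝ)) →
      y ≠ y₀ → perturbWeight ω y₀ < perturbWeight ω y)
    (y : Fin m → ℤ) (hy0 : ∀ e, 0 ≤ y e) (hy : ∀ v, ∑ e, incidence head tail e v * y e = b v)
    (hne : y ≠ y₀) :
    ∑ e, ((M * c e + (((ω e : ℕ) : ℤ) + 1) : ℤ) : ℝ) * y₀ e + 1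
      ≤ ∑ e, ((M * c e + (((ω e : ℕ) : ℤ) + 1) : ℤ) : ℝ) * y e := by
  have hyf := (flowFeasible_intCast_iff head tail b y).2 ⟨hy0, hy⟩
  rw [sum_scaled_cost, sum_scaled_cost]
  norm_cast
  have hcast : ∀ y : Fin m → ℤ, FlowCost (fun e => (c e : ℝ)) (fun e => (y e : ℝ))
      = ((∑ e, c e * y e : ℤ) : ℝ) := fun y => by simp [FlowCost]
  have hle := hopt.2 _ hyf
  rw [hcast, hcast, Int.cast_le] at hle
  have hy₀0 := ((flowFeasible_intCast_iff head tail b y₀).1 hopt.1).1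
  have hMpos : 0 < M := lt_of_le_of_lt (by positivity) hM
  by_cases hyo : FlowOptimal head tail b (fun e => (c e : ℝ)) (fun e => (y e : ℝ))
  · have h1 := huniq y hyo hne
    have h2 := mul_le_mul_of_nonneg_left hle hMpos.le
    linarith
  · have hlt : ∑ e, c e * y₀ e < ∑ e, c e * y e := by
      refine lt_of_le_of_ne hle fun heq => hyo ⟨hyf, fun g hg => ?_⟩
      rw [hcast, ← heq, ← hcast]
      exact hopt.2 g hg
    have h1 : 0 ≤ perturbWeight ω y :=
      Finset.sum_nonneg fun e _ => mul_nonneg (by positivity) (hy0 e)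
    have h2 : perturbWeight ω y₀ ≤ m * (N * W) := by
      calc perturbWeight ω y₀ ≤ ∑ _e : Fin m, (N * W : ℤ) := by
            refine Finset.sum_le_sum fun e _ => mul_le_mul ?_ (hW e) (hy₀0 e) (by positivity)
            have := (ω e).2
            omega
        _ = _ := by simp
    have h3 : M * (∑ e, c e * y₀ e + 1) ≤ M * ∑ e, c e * y e :=
      mul_le_mul_of_nonneg_left hlt hMpos.le
    rw [mul_add, mul_one] at h3
    linarith

/-- **Isolation lemma for minimum-cost flow.**  Perturb each integral cost `c_e` by an
independent uniform `z_e ∈ {1/(4m²W²), …, 2mW/(4m²W²)}`.  If every optimal flow of the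
unperturbed instance has congestion at most `W`, then with probability at least `1/2`,
rounding any feasible flow of the perturbed instance whose cost is within
`1/(12m²W³)` of optimal yields an optimal feasible flow for the original instance.
(Probability is expressed by counting outcomes `ω : Fin m → Fin (2mW)`, where
`z_e = (ω_e + 1)/(4m²W²)`.) -/
theorem isolation_lemma_flow
    (W m : ℕ) (hW : 0 < W)
    {V : Type*} [Fintype V] [DecidableEq V]
    (head tail : Fin m → V)
    (b : V → ℤ) (hb : ∀ v, |b v| ≤ (W : ℤ))
    (c : Fin m → ℤ) (hc : ∀ e, |c e| ≤ (W : ℤ))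
    (hopt : ∃ f : Fin m → ℝ, FlowOptimal head tail b (fun e => (c e : ℝ)) f)
    (hcong : ∀ f : Fin m → ℝ, FlowOptimal head tail b (fun e => (c e : ℝ)) f →
      ∀ e, f e ≤ (W : ℝ)) :
    (2 * m * W) ^ m ≤ 2 * Nat.card {ω : Fin m → Fin (2 * m * W) //
      ∀ ft : Fin m → ℝ, FlowFeasible head tail b ft →
        FlowCost (fun e => (c e : ℝ) + ((ω e : ℕ) + 1 : ℝ) / (4 * (m : ℝ) ^ 2 * (W : ℝ) ^ 2)) ft ≤
          sInf {r : ℝ | ∃ f : Fin m → ℝ, FlowFeasible head tail b f ∧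
              r = FlowCost (fun e => (c e : ℝ) + ((ω e : ℕ) + 1 : ℝ) / (4 * (m : ℝ) ^ 2 * (W : ℝ) ^ 2)) f}
            + 1 / (12 * (m : ℝ) ^ 2 * (W : ℝ) ^ 3) →
        FlowOptimal head tail b (fun e => (c e : ℝ)) (fun e => (round (ft e) : ℝ))} := by
  rcases Nat.eq_zero_or_pos m with rfl | hm
  · obtain ⟨f, hf⟩ := hopt
    have : Nonempty {ω : Fin 0 → Fin (2 * 0 * W) //
      ∀ ft : Fin 0 → ℝ, FlowFeasible head tail b ft →
        FlowCost (fun e => (c e : ℝ) + ((ω e : ℕ) + 1 : ℝ) / (4 * ((0 : ℕ) : ℝ) ^ 2 * (W : ℝ) ^ 2)) ft ≤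
          sInf {r : ℝ | ∃ f : Fin 0 → ℝ, FlowFeasible head tail b f ∧
              r = FlowCost (fun e => (c e : ℝ) + ((ω e : ℕ) + 1 : ℝ) / (4 * ((0 : ℕ) : ℝ) ^ 2 * (W : ℝ) ^ 2)) f}
            + 1 / (12 * ((0 : ℕ) : ℝ) ^ 2 * (W : ℝ) ^ 3) →
        FlowOptimal head tail b (fun e => (c e : ℝ)) (fun e => (round (ft e) : ℝ))} := by
      refine ⟨⟨Fin.elim0, fun ft _ _ => ?_⟩⟩
      rwa [Subsingleton.elim (fun e => (round (ft e) : ℝ)) f]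
    have := Nat.card_pos_iff.2 ⟨this, inferInstance⟩
    rw [pow_zero]
    omega
  have : Nonempty (Fin m) := ⟨⟨0, hm⟩⟩
  set S : Set (Fin m → ℤ) :=
    {y | FlowOptimal head tail b (fun e => (c e : ℝ)) (fun e => (y e : ℝ))}
  have hbound : ∀ y ∈ S, ∀ e, 0 ≤ y e ∧ y e ≤ W := by
    intro y hy e
    have h1 := hcong _ hy e
    exact ⟨((flowFeasible_intCast_iff head tail b y).1 hy.1).1 e, by exact_mod_cast h1⟩
  have hSne : S.Nonempty := exists_integral_flowOptimal head tail b _ hopt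
  have hSfin : S.Finite := (Set.finite_Icc (0 : Fin m → ℤ) (fun _ => (W : ℤ))).subset
    fun y hy => ⟨fun e => (hbound y hy e).1, fun e => (hbound y hy e).2⟩
  have hcard := two_mul_card_unique_minimizer_ge S W hW hbound
    (N := 2 * m * W) (by rw [Fintype.card_fin])
  rw [Fintype.card_fin] at hcard
  refine hcard.trans (Nat.mul_le_mul_left 2 (Nat.card_mono (Set.toFinite _) ?_))
  intro ω hω ft hft hcost
  obtain ⟨y₀, hy₀, hmin⟩ := Set.exists_min_image S (perturbWeight ω) hSfin hSne
  have huniq : ∀ y ∈ S, y ≠ y₀ → perturbWeight ω y₀ < perturbWeight ω y := by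
    intro y hy hne
    by_contra! hle
    exact hne (hω y hy y₀ hy₀ (isMinOn_iff.2 fun z hz => hle.trans (hmin z hz))
      (isMinOn_iff.2 hmin))
  have hmR : (1 : ℝ) ≤ m := by exact_mod_cast hm
  have hWR : (1 : ℝ) ≤ W := by exact_mod_cast hW
  have hM : (m : ℤ) * ((2 * m * W : ℕ) * W) < 4 * (m : ℤ) ^ 2 * (W : ℤ) ^ 2 := by
    have : (0 : ℤ) < (m : ℤ) ^ 2 * (W : ℤ) ^ 2 := by positivity
    push_cast
    linarith
  have hgap := scaled_cost_gap head tail b c _ hM ω y₀ (fun e => (hbound y₀ hy₀ e).2) hy₀ huniq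
  set C : Fin m → ℝ := fun e =>
    ((4 * (m : ℤ) ^ 2 * (W : ℤ) ^ 2 * c e + (((ω e : ℕ) : ℤ) + 1) : ℤ) : ℝ) with hC
  have hMR : (0 : ℝ) < 4 * (m : ℝ) ^ 2 * (W : ℝ) ^ 2 := by positivity
  have hscale : ∀ f : Fin m → ℝ, FlowCost (fun e => (c e : ℝ) +
      ((ω e : ℕ) + 1 : ℝ) / (4 * (m : ℝ) ^ 2 * (W : ℝ) ^ 2)) f
      = (∑ e, C e * f e) / (4 * (m : ℝ) ^ 2 * (W : ℝ) ^ 2) := by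
    intro f
    rw [FlowCost, Finset.sum_div]
    refine Finset.sum_congr rfl fun e _ => ?_
    simp only [hC]
    push_cast
    field_simp
  have hopt₀ : ∀ g : Fin m → ℝ, FlowFeasible head tail b g →
      ∑ e, C e * y₀ e ≤ ∑ e, C e * g e := by
    intro g hg
    rw [flowFeasible_iff] at hg
    refine cost_le_of_integral_optimal head tail b C y₀ (fun y h0 h => ?_) g hg.1 hg.2
    by_cases hne : y = y₀
    · rw [hne]
    · exact (le_add_of_nonneg_right zero_le_one).trans (hgap y h0 h hne)
  simp only [hscale] at hcost
  have hinf : sInf {r : ℝ | ∃ f : Fin m → ℝ, FlowFeasible head tail b f ∧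
      r = (∑ e, C e * f e) / (4 * (m : ℝ) ^ 2 * (W : ℝ) ^ 2)}
      ≤ (∑ e, C e * y₀ e) / (4 * (m : ℝ) ^ 2 * (W : ℝ) ^ 2) := by
    refine csInf_le ⟨(∑ e, C e * y₀ e) / (4 * (m : ℝ) ^ 2 * (W : ℝ) ^ 2), ?_⟩ ⟨_, hy₀.1, rfl⟩
    rintro r ⟨g, hg, rfl⟩
    exact div_le_div_of_nonneg_right (hopt₀ g hg) hMR.le
  have hnear : ∑ e, C e * ft e ≤ ∑ e, C e * y₀ e + 1 / 3 := by
    have h1 : (1 : ℝ) / (12 * (m : ℝ) ^ 2 * (W : ℝ) ^ 3)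
        ≤ (1 / 3) / (4 * (m : ℝ) ^ 2 * (W : ℝ) ^ 2) := by
      rw [div_div]
      refine one_div_le_one_div_of_le (by positivity) ?_
      have : (m : ℝ) ^ 2 * (W : ℝ) ^ 2 * 1 ≤ (m : ℝ) ^ 2 * (W : ℝ) ^ 2 * W :=
        mul_le_mul_of_nonneg_left hWR (by positivity)
      linarith
    have h2 := hcost.trans (add_le_add hinf h1)
    rwa [← add_div, div_le_div_iff_of_pos_right hMR] at h2
  have hft' := (flowFeasible_iff head tail b ft).1 hft
  have hround := round_eq_of_cost_le head tail b C y₀ hgap ft hft'.1 hft'.2 hnear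
  simp only [hround]
  exact hy₀
end
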